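/- Let G=(V,E) be a sparse graph and let {G_i=(V_i,E_i)}_{i∈I} be its max-tight decomposition. Assume that for every i∈I there are a natural number n_i ≥ 1 and a nonzero polynomial F_i in the variables (x_e)_{e∈E_i} over ℂ such that for every λ_i ∈ ℂ^{E_i} with F_i(λ_i) ≠ 0 the set E_{G_i}⁻¹(λ_i) has exactly n_i equivalence classes under the relation r ∼ s :⟺ there exists t ∈ T with s = t∘r. Then there exists a nonzero polynomial F in the variables (x_e)_{e∈E} over ℂ such that for every λ ∈ ℂ^E with F(λ) ≠ 0, the number of minimal prime ideals over the vanishing ideal of E_G⁻¹(λ) in ℂ[x_v, y_v : v∈V] (i.e. the number of irreducible components of the set of λ-compatible realizations) equals the product ∏_{i∈I} n_i. -/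

import Mathlib

open scoped Classical

noncomputable section

/-- The squared distance function on `ℂ²`. -/
def sd (x y : ℂ × ℂ) : ℂ := (x.1 - y.1) ^ 2 + (x.2 - y.2) ^ 2

/-- Membership in the transformation group `T`. -/
def IsTransf (t : ℂ × ℂ → ℂ × ℂ) : Prop :=
  ∃ c s u v : ℂ, c ^ 2 + s ^ 2 = 1 ∧
    ∀ x, t x = (c * x.1 - s * x.2 + u, s * x.1 + c * x.2 + v)

variable {α : Type*} [DecidableEq α]

/-- `(V, E)` is a finite simple undirected graph: edges are non-diagonal
unordered pairs with both endpoints in `V`. -/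
def IsGraph (V : Finset α) (E : Finset (Sym2 α)) : Prop :=
  ∀ e ∈ E, ¬ e.IsDiag ∧ ∀ v ∈ e, v ∈ V

/-- `(V', E')` is a subgraph of `(V, E)`. -/
def IsSubgraph (V' : Finset α) (E' : Finset (Sym2 α))
    (V : Finset α) (E : Finset (Sym2 α)) : Prop :=
  IsGraph V' E' ∧ V' ⊆ V ∧ E' ⊆ E

/-- A graph is sparse if every subgraph `(V', E')` with `|V'| ≥ 2`
satisfies `|E'| ≤ 2|V'| - 3`. -/
def IsSparse (V : Finset α) (E : Finset (Sym2 α)) : Prop :=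
  IsGraph V E ∧ ∀ V' E', IsSubgraph V' E' V E → 2 ≤ V'.card →
    (E'.card : ℤ) ≤ 2 * V'.card - 3

/-- A graph is tight if it is sparse and `|V| = 1` or `|E| = 2|V| - 3`. -/
def IsTight (V : Finset α) (E : Finset (Sym2 α)) : Prop :=
  IsSparse V E ∧ (V.card = 1 ∨ (E.card : ℤ) = 2 * V.card - 3)

/-- `(V', E')` is a max-tight subgraph of `(V, E)`. -/
def IsMaxTight (V' : Finset α) (E' : Finset (Sym2 α))
    (V : Finset α) (E : Finset (Sym2 α)) : Prop :=
  IsSubgraph V' E' V E ∧ IsTight V' E' ∧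
    ∀ V'' E'', IsSubgraph V'' E'' V E → IsTight V'' E'' →
      V' ⊆ V'' → E' ⊆ E'' → V' = V'' ∧ E' = E''

/-- `{(Vi i, Ei i)}_{i ∈ I}` is a max-tight decomposition of `(V, E)`. -/
def IsMaxTightDecomp {I : Type*} (V : Finset α) (E : Finset (Sym2 α))
    (Vi : I → Finset α) (Ei : I → Finset (Sym2 α)) : Prop :=
  (∀ i, IsMaxTight (Vi i) (Ei i) V E) ∧
  (∀ v ∈ V, ∃ i, v ∈ Vi i) ∧
  (∀ e ∈ E, ∃ i, e ∈ Ei i) ∧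
  (∀ i j, i ≠ j → ∀ e, ¬ (e ∈ Ei i ∧ e ∈ Ei j))

/-- Extend a realization of `V` to all of `α` (by zero off `V`). -/
def extendR (V : Finset α) (r : ↥V → ℂ × ℂ) : α → ℂ × ℂ :=
  fun a => if h : a ∈ V then r ⟨a, h⟩ else 0

/-- The squared distance along an unordered pair of vertices. -/
def edgeVal (r : α → ℂ × ℂ) : Sym2 α → ℂ :=
  Sym2.lift ⟨fun u v => sd (r u) (r v), fun u v => by simp only [sd]; ring⟩

/-- The edge map `E_G : (ℂ²)^V → ℂ^E`. -/
def edgeMap (V : Finset α) (E : Finset (Sym2 α)) (r : ↥V → ℂ × ℂ) :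
    {e // e ∈ E} → ℂ :=
  fun e => edgeVal (extendR V r) e.1

/-- The set `E_G⁻¹(λ)` of `λ`-compatible realizations. -/
def fiber (V : Finset α) (E : Finset (Sym2 α)) (lam : {e // e ∈ E} → ℂ) :
    Set (↥V → ℂ × ℂ) :=
  {r | edgeMap V E r = lam}

/-- The set of equivalence classes of `S` under `r ∼ s ↔ ∃ t ∈ T, s = t ∘ r`. -/
def TClasses {β : Type*} (S : Set (β → ℂ × ℂ)) : Set (Set (β → ℂ × ℂ)) :=
  {C | ∃ r ∈ S, C = {s | s ∈ S ∧ ∃ t, IsTransf t ∧ s = fun v => t (r v)}}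

/-- The coordinates of a realization, as a point of affine space with
coordinate ring `ℂ[x_v, y_v : v ∈ β]`. -/
def coords {β : Type*} (r : β → ℂ × ℂ) : β × Fin 2 → ℂ :=
  fun p => if p.2 = 0 then (r p.1).1 else (r p.1).2

/-- The vanishing ideal of a set of realizations in `ℂ[x_v, y_v : v ∈ β]`. -/
def vanishingIdeal {β : Type*} (S : Set (β → ℂ × ℂ)) :
    Ideal (MvPolynomial (β × Fin 2) ℂ) where
  carrier := {f | ∀ r ∈ S, MvPolynomial.eval (coords r) f = 0}
  add_mem' := by
    intro a b ha hb r hr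
    simp only [Set.mem_setOf_eq] at ha hb ⊢
    simp [map_add, ha r hr, hb r hr]
  zero_mem' := by intro r hr; simp
  smul_mem' := by
    intro c f hf r hr
    simp only [Set.mem_setOf_eq] at hf ⊢
    simp [smul_eq_mul, map_mul, hf r hr]

end

section

theorem exists_derivation_of_algebraicIndependent {k L ι : Type*} [Field k] [Field L] [Algebra k L]
    [CharZero k] {g : ι → L} (hg : AlgebraicIndependent k g) (v : ι → L) :
    ∃ D : Derivation k L L, ∀ i, D (g i) = v i := by
  obtain ⟨s, hgs, hs⟩ := exists_isTranscendenceBasis_superset (AlgebraicIndependent.to_subtype_range hg)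
  let w : s → L := fun x => if h : ∃ i, g i = (x : L) then v h.choose else 0
  have hw : ∀ i, w ⟨g i, hgs ⟨i, rfl⟩⟩ = v i := fun i => by
    have h : ∃ j, g j = g i := ⟨i, rfl⟩
    have : h.choose = i := hg.injective h.choose_spec
    simp only [w, dif_pos h, this]
  have hind := hs.1
  let F := IntermediateField.adjoin k (Set.range ((↑) : s → L))
  let φ0 : MvPolynomial s k →ₐ[k] (TrivSqZeroExt L L) :=
    MvPolynomial.aeval fun x => (TrivSqZeroExt.inl (x : L) + TrivSqZeroExt.inr (w x) : (TrivSqZeroExt L L))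
  have hfst0 : (TrivSqZeroExt.fstHom k L L).comp φ0 = MvPolynomial.aeval ((↑) : s → L) := by
    apply MvPolynomial.algHom_ext
    intro i
    simp [φ0]
  have hfst0' : ∀ p, TrivSqZeroExt.fst (φ0 p) = MvPolynomial.aeval ((↑) : s → L) p := fun p => by
    rw [← hfst0]; rfl
  have hu : ∀ y : nonZeroDivisors (MvPolynomial s k), IsUnit (φ0 y) := by
    intro y
    rw [TrivSqZeroExt.isUnit_iff_isUnit_fst, hfst0', isUnit_iff_ne_zero]
    intro h0
    have := (algebraicIndependent_iff_injective_aeval.1 hind)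
      (h0.trans (map_zero _).symm)
    exact nonZeroDivisors.ne_zero y.2 this
  let φ1 : FractionRing (MvPolynomial s k) →ₐ[k] (TrivSqZeroExt L L) := IsLocalization.liftAlgHom hu
  let φF : F →ₐ[k] (TrivSqZeroExt L L) := φ1.comp hind.reprField
  have hfst1 : (TrivSqZeroExt.fstHom k L L).comp φ1 =
      IsFractionRing.liftAlgHom (algebraicIndependent_iff_injective_aeval.1 hind) := by
    apply IsLocalization.algHom_ext (nonZeroDivisors (MvPolynomial s k))
    apply MvPolynomial.algHom_ext
    intro i
    have e1 : φ1 (algebraMap (MvPolynomial s k) _ (MvPolynomial.X i)) = φ0 (MvPolynomial.X i) :=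
      IsLocalization.lift_eq _ _
    have e2 : IsFractionRing.liftAlgHom (K := FractionRing (MvPolynomial s k))
        (algebraicIndependent_iff_injective_aeval.1 hind)
        (algebraMap (MvPolynomial s k) _ (MvPolynomial.X i)) =
        MvPolynomial.aeval ((↑) : s → L) (MvPolynomial.X i) :=
      IsFractionRing.lift_algebraMap (algebraicIndependent_iff_injective_aeval.1 hind) _
    exact (congrArg TrivSqZeroExt.fst e1).trans ((hfst0' (MvPolynomial.X i)).trans e2.symm)
  have hfst : ∀ x : F, TrivSqZeroExt.fst (φF x) = (x : L) := fun x => by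
    have := congrArg (fun f => f (hind.reprField x)) hfst1
    exact this.trans (hind.lift_reprField x)
  let _ : Algebra F (TrivSqZeroExt L L) := φF.toRingHom.toAlgebra
  have halgF : ∀ x : F, algebraMap F (TrivSqZeroExt L L) x = φF x := fun x => rfl
  let fstF : (TrivSqZeroExt L L) →ₐ[F] L := { TrivSqZeroExt.fstHom k L L with
    commutes' := fun x => hfst x }
  have : Algebra.IsAlgebraic F L := hs.isAlgebraic_field
  have : Algebra.FormallyEtale F L := Algebra.FormallyEtale.of_isSeparable F L
  have hsurj : Function.Surjective fstF := fun x => ⟨TrivSqZeroExt.inl x, rfl⟩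
  have hnil : IsNilpotent (RingHom.ker (fstF : (TrivSqZeroExt L L) →+* L)) := by
    refine ⟨2, ?_⟩
    exact TrivSqZeroExt.kerIdeal_sq L L
  let ψ : L →ₐ[F] (TrivSqZeroExt L L) := Algebra.FormallySmooth.liftOfSurjective (AlgHom.id F L) fstF hsurj hnil
  have hψ : ∀ x, TrivSqZeroExt.fst (ψ x) = x := fun x => by
    exact Algebra.FormallySmooth.liftOfSurjective_apply (AlgHom.id F L) fstF hsurj hnil x
  have hψF : ∀ x : F, ψ x = φF x := fun x => ψ.commutes x
  refine ⟨⟨⟨⟨fun x => TrivSqZeroExt.snd (ψ x), fun x y => by simp⟩, fun c x => ?_⟩, ?_, ?_⟩, ?_⟩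
  · have : ψ (c • x) = c • ψ x := by
      rw [Algebra.smul_def, map_mul]
      have : ψ (algebraMap k L c) = algebraMap k (TrivSqZeroExt L L) c := by
        rw [IsScalarTower.algebraMap_apply k F L]
        exact (hψF _).trans (φF.commutes c)
      rw [this, ← Algebra.smul_def]
    simp [this]
  · simp
  · intro a b
    simp [hψ, mul_comm]
  · intro i
    have hmem : g i ∈ F := IntermediateField.subset_adjoin _ _ ⟨⟨g i, hgs ⟨i, rfl⟩⟩, rfl⟩
    have h1 : hind.reprField ⟨g i, hmem⟩ =
        algebraMap (MvPolynomial s k) _ (MvPolynomial.X ⟨g i, hgs ⟨i, rfl⟩⟩) := by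
      apply hind.aevalEquivField.injective
      apply Subtype.ext
      rw [hind.aevalEquivField_algebraMap_apply_coe]
      simp [AlgebraicIndependent.reprField]
    have h2 := hψF ⟨g i, hmem⟩
    change TrivSqZeroExt.snd (ψ (g i)) = v i
    have h3 : ψ (g i) = φ0 (MvPolynomial.X ⟨g i, hgs ⟨i, rfl⟩⟩) := by
      refine h2.trans ?_
      change φ1 (hind.reprField ⟨g i, hmem⟩) = _
      rw [h1]
      simp [φ1]
    rw [h3]
    simp [φ0, hw]

end

section

theorem Derivation.eq_zero_of_isAlgebraic {S R M : Type*} [CommRing S] [CommRing R] [IsDomain S]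
    [CharZero S] [Algebra S R] [FaithfulSMul S R] [AddCommGroup M] [Module S M] [Module R M] [IsScalarTower S R M]
    [IsDomain R] [Module.IsTorsionFree R M] (D : Derivation S R M) {θ : R} (h : IsAlgebraic S θ) :
    D θ = 0 := by
  have hinj := FaithfulSMul.algebraMap_injective S R
  suffices H : ∀ n, ∀ p : Polynomial S, p.natDegree = n → p ≠ 0 → Polynomial.aeval θ p = 0 →
      D θ = 0 by
    obtain ⟨p, hp, hpθ⟩ := h
    exact H _ p rfl hp hpθ
  intro n
  induction n using Nat.strong_induction_on with
  | _ n ih =>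
    intro p hpn hp hpθ
    have h1 := D.map_aeval p θ
    rw [hpθ, map_zero] at h1
    by_cases h2 : Polynomial.aeval θ (Polynomial.derivative p) = 0
    · by_cases h3 : p.natDegree = 0
      · rw [Polynomial.eq_C_of_natDegree_eq_zero h3] at hpθ hp
        simp only [Polynomial.aeval_C] at hpθ
        rw [← map_zero (algebraMap S R)] at hpθ
        rw [hinj hpθ] at hp
        simp at hp
      · have h4 := Polynomial.natDegree_derivative_lt h3
        refine ih _ (hpn ▸ h4) _ rfl ?_ h2
        intro h5
        exact h3 (Polynomial.derivative_eq_zero.1 h5)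
    · exact (smul_eq_zero.1 h1.symm).resolve_left h2

theorem isAlgebraic_of_forall_derivation {F L : Type*} [Field F] [Field L] [Algebra F L]
    [CharZero F] {x : L} (h : ∀ D : Derivation F L L, D x = 0) : IsAlgebraic F x := by
  by_contra hx
  have : AlgebraicIndependent F (fun _ : Unit => x) := by
    rw [algebraicIndependent_unique_type_iff]; exact hx
  obtain ⟨D, hD⟩ := exists_derivation_of_algebraicIndependent this (fun _ => 1)
  have := h D
  rw [hD ()] at this
  exact one_ne_zero this

/-- A derivation vanishing on a generating set of an intermediate field, as a derivation over it. -/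
def Derivation.overAdjoin {k L M : Type*} [Field k] [Field L] [Algebra k L] [AddCommGroup M]
    [Module k M] [Module L M] [IsScalarTower k L M] (D : Derivation k L M)
    (S : Set L) (h : ∀ x ∈ S, D x = 0) : Derivation (IntermediateField.adjoin k S) L M where
  toLinearMap :=
  { toFun := D
    map_add' := D.map_add
    map_smul' := fun a x => by
      have : D (a : L) = 0 := by
        obtain ⟨a, ha⟩ := a
        refine IntermediateField.adjoin_induction k (p := fun x _ => D x = 0) ?_ ?_ ?_ ?_ ?_ ha
        · exact fun x hx => h x hx
        · exact fun x => D.map_algebraMap x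
        · intro x y _ _ hx hy; simp [hx, hy]
        · intro x _ hx; rw [Derivation.leibniz_inv, hx, smul_zero]
        · intro x y _ _ hx hy; simp [hx, hy]
      rw [IntermediateField.smul_def, smul_eq_mul, D.leibniz, this, smul_zero, add_zero]
      rfl }
  map_one_eq_zero' := D.map_one_eq_zero
  leibniz' := D.leibniz

theorem Derivation.eq_zero_of_isAlgebraic_adjoin {k L M : Type*} [Field k] [Field L] [Algebra k L]
    [CharZero k] [AddCommGroup M] [Module k M] [Module L M] [IsScalarTower k L M]
    (D : Derivation k L M)
    {S : Set L} (h : ∀ x ∈ S, D x = 0) {x : L}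
    (hx : IsAlgebraic (IntermediateField.adjoin k S) x) : D x = 0 :=
  (D.overAdjoin S h).eq_zero_of_isAlgebraic hx

theorem exists_derivation_extending {k B L ι : Type*} [Field k] [Field B] [Field L] [Algebra k B]
    [Algebra B L] [Algebra k L] [IsScalarTower k B L] [CharZero k] (δ : Derivation k B B)
    {g : ι → L} (hg : AlgebraicIndependent B g) (v : ι → L) :
    ∃ Δ : Derivation k L L, (∀ b, Δ (algebraMap B L b) = algebraMap B L (δ b)) ∧
      ∀ i, Δ (g i) = v i := by
  obtain ⟨s, hs⟩ := exists_isTranscendenceBasis k B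
  obtain ⟨Δ, hΔ⟩ := exists_derivation_of_algebraicIndependent (hs.1.sumElim_comp hg)
    (Sum.elim v fun x => algebraMap B L (δ x))
  refine ⟨Δ, fun b => ?_, fun i => hΔ (Sum.inl i)⟩
  let D : Derivation k B L := Δ.compAlgebraMap B - (Algebra.linearMap B L).compDer δ
  have hD : ∀ b, D b = Δ (algebraMap B L b) - algebraMap B L (δ b) := fun b => rfl
  have : Algebra.IsAlgebraic (IntermediateField.adjoin k (Set.range ((↑) : s → B))) B :=
    hs.isAlgebraic_field
  have h0 : D b = 0 := by
    refine D.eq_zero_of_isAlgebraic_adjoin (S := Set.range ((↑) : s → B)) ?_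
      (Algebra.IsAlgebraic.isAlgebraic b)
    rintro _ ⟨x, rfl⟩
    rw [hD, sub_eq_zero]
    exact hΔ (Sum.inr x)
  rwa [hD, sub_eq_zero] at h0

section DualDerivations

variable {k L ι : Type*} [Field k] [Field L] [Algebra k L] [CharZero k]
  {g : ι → L} {D : ι → Derivation k L L}

theorem Derivation.apply_eq_sum_dual [Fintype ι] (hD : ∀ i j, D i (g j) = if i = j then 1 else 0)
    (Δ : Derivation k L L) {x : L}
    (hx : IsAlgebraic (IntermediateField.adjoin k (Set.range g)) x) :
    Δ x = ∑ i, D i x * Δ (g i) := by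
  let Δ' : Derivation k L L := Δ - ∑ i, Δ (g i) • D i
  have h : ∀ y, Δ' y = Δ y - ∑ i, Δ (g i) * D i y := fun y => by
    simp only [Δ', Derivation.sub_apply]
    congr 1
    rw [← Derivation.coeFnAddMonoidHom_apply, map_sum, Finset.sum_apply]
    rfl
  have h0 : Δ' x = 0 := by
    refine Δ'.eq_zero_of_isAlgebraic_adjoin ?_ hx
    rintro _ ⟨j, rfl⟩
    simp [h, hD]
  rw [h, sub_eq_zero] at h0
  rw [h0]
  exact Finset.sum_congr rfl fun i _ => mul_comm _ _

theorem isAlgebraic_dual_apply (hD : ∀ i j, D i (g j) = if i = j then 1 else 0) (i : ι) {x : L}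
    (hx : IsAlgebraic (IntermediateField.adjoin k (Set.range g)) x) :
    IsAlgebraic (IntermediateField.adjoin k (Set.range g)) (D i x) := by
  apply isAlgebraic_of_forall_derivation
  intro Δ
  have h1 : ∀ j, Δ (g j) = 0 := fun j =>
    Δ.map_algebraMap (⟨g j, IntermediateField.subset_adjoin _ _ ⟨j, rfl⟩⟩ :
      IntermediateField.adjoin k (Set.range g))
  have h2 : Δ x = 0 := Δ.eq_zero_of_isAlgebraic hx
  have h3 := (⁅Δ.restrictScalars k, D i⁆).eq_zero_of_isAlgebraic_adjoin (S := Set.range g) (x := x)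
    (by rintro _ ⟨j, rfl⟩; simp [Derivation.commutator_apply, h1, hD, apply_ite Δ]) hx
  simpa [Derivation.commutator_apply, h2] using h3

omit [CharZero k] in
theorem dual_apply_mem_adjoin (hD : ∀ i j, D i (g j) = if i = j then 1 else 0) (i : ι) {x : L}
    (hx : x ∈ IntermediateField.adjoin k (Set.range g)) :
    D i x ∈ IntermediateField.adjoin k (Set.range g) := by
  refine IntermediateField.adjoin_induction k
    (p := fun x _ => D i x ∈ IntermediateField.adjoin k (Set.range g)) ?_ ?_ ?_ ?_ ?_ hx
  · rintro _ ⟨j, rfl⟩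
    rw [hD]; split_ifs
    exacts [one_mem _, zero_mem _]
  · intro x; simp [zero_mem]
  · intro x y _ _ hx hy; rw [map_add]; exact add_mem hx hy
  · intro x hx' hx
    rw [Derivation.leibniz_inv]
    exact mul_mem (neg_mem (pow_mem (inv_mem hx') _)) hx
  · intro x y hx' hy' hx hy
    rw [Derivation.leibniz]
    exact add_mem (mul_mem hx' hy) (mul_mem hy' hx)

theorem isAlgebraic_of_dual_apply_eq_zero [Fintype ι] (hD : ∀ i j, D i (g j) = if i = j then 1 else 0) {x : L}
    (hx : IsAlgebraic (IntermediateField.adjoin k (Set.range g)) x) (h0 : ∀ i, D i x = 0) :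
    IsAlgebraic k x := by
  apply isAlgebraic_of_forall_derivation
  intro Δ
  rw [Δ.apply_eq_sum_dual hD hx]
  simp [h0]

omit [CharZero k] in
theorem dual_aeval (hD : ∀ i j, D i (g j) = if i = j then 1 else 0) (i : ι) (x : L)
    (p : Polynomial (IntermediateField.adjoin k (Set.range g))) :
    ∃ q : Polynomial (IntermediateField.adjoin k (Set.range g)),
      (∀ j, (q.coeff j : L) = D i (p.coeff j : L)) ∧ D i (Polynomial.aeval x p) =
        Polynomial.aeval x q + Polynomial.aeval x (Polynomial.derivative p) * D i x := by
  induction p using Polynomial.induction_on' with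
  | add p q hp hq =>
    obtain ⟨p', hp1, hp2⟩ := hp
    obtain ⟨q', hq1, hq2⟩ := hq
    refine ⟨p' + q', fun j => by simp [hp1, hq1], ?_⟩
    simp only [map_add, hp2, hq2]; ring
  | monomial n a =>
    refine ⟨Polynomial.monomial n ⟨D i (a : L), dual_apply_mem_adjoin hD i a.2⟩, fun j => ?_, ?_⟩
    · simp only [Polynomial.coeff_monomial]
      split_ifs <;> simp
    · simp only [Polynomial.aeval_monomial, Polynomial.derivative_monomial, Derivation.leibniz,
        Derivation.leibniz_pow, map_mul, map_natCast, smul_eq_mul, nsmul_eq_mul,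
        IntermediateField.algebraMap_apply]
      ring

/-- An element algebraic over `k(g)` all of whose dual derivatives lie in `k(g)` lies in `k(g)`,
provided `k` is algebraically closed in the ambient field. -/
theorem mem_adjoin_of_dual_apply_mem [Fintype ι] (hD : ∀ i j, D i (g j) = if i = j then 1 else 0)
    (hk : ∀ x : L, IsAlgebraic k x → x ∈ Set.range (algebraMap k L)) {x : L}
    (hx : IsAlgebraic (IntermediateField.adjoin k (Set.range g)) x)
    (h : ∀ i, D i x ∈ IntermediateField.adjoin k (Set.range g)) :
    x ∈ IntermediateField.adjoin k (Set.range g) := by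
  set F := IntermediateField.adjoin k (Set.range g) with hF
  let p := minpoly F x
  have hp : p.Monic := minpoly.monic hx.isIntegral
  have hn : 0 < p.natDegree := minpoly.natDegree_pos hx.isIntegral
  have hpx : Polynomial.aeval x p = 0 := minpoly.aeval F x
  -- the polynomial relation after differentiating
  have key : ∀ i, D i (p.coeff (p.natDegree - 1) : L) = - (p.natDegree : L) * D i x := by
    intro i
    obtain ⟨q, hqc, hq0⟩ := dual_aeval hD i x p
    have hq : q + Polynomial.C ⟨D i x, h i⟩ * Polynomial.derivative p = 0 := by
      by_contra hne
      refine absurd (minpoly.degree_le_of_ne_zero F x hne ?_) (not_le.2 ?_)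
      · rw [hpx, map_zero] at hq0
        rw [map_add, map_mul, Polynomial.aeval_C, hq0, mul_comm]
        rfl
      · refine (Polynomial.degree_add_le _ _).trans_lt (max_lt ?_ ?_)
        · rw [Polynomial.degree_eq_natDegree hp.ne_zero, Polynomial.degree_lt_iff_coeff_zero]
          intro m hm
          apply Subtype.ext
          rw [hqc]
          rcases hm.eq_or_lt with rfl | hm
          · rw [hp.coeff_natDegree]
            exact (D i).map_one_eq_zero
          · rw [Polynomial.coeff_eq_zero_of_natDegree_lt hm]
            exact map_zero _
        · rw [← Polynomial.smul_eq_C_mul]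
          exact (Polynomial.degree_smul_le _ _).trans_lt (Polynomial.degree_derivative_lt hp.ne_zero)
    have h3 := congrArg (fun r => ((r.coeff (p.natDegree - 1) : F) : L)) hq
    have h4 : p.natDegree - 1 + 1 = p.natDegree := by omega
    simp only [Polynomial.coeff_add, Polynomial.coeff_C_mul, Polynomial.coeff_derivative, h4,
      hp.coeff_natDegree, Polynomial.coeff_zero, one_mul] at h3
    push_cast [hqc] at h3
    have h5 : ((p.natDegree - 1 : ℕ) : L) + 1 = p.natDegree := by
      rw [← h4]; push_cast; simp
    rw [← h5]
    linear_combination h3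
  have hy : ∃ c : k, algebraMap k L c = p.natDegree * x + (p.coeff (p.natDegree - 1) : L) := by
    refine hk _ (isAlgebraic_of_dual_apply_eq_zero hD ?_ ?_)
    · exact ((isAlgebraic_algebraMap (p.natDegree : F)).mul hx).add
        (isAlgebraic_algebraMap (A := L) (p.coeff (p.natDegree - 1)))
    · intro i
      rw [map_add, key i, Derivation.leibniz]
      simp
  obtain ⟨c, hc⟩ := hy
  have hne : (p.natDegree : L) ≠ 0 := by
    have : CharZero L := charZero_of_injective_algebraMap (algebraMap k L).injective
    exact_mod_cast hn.ne'
  have : x = (algebraMap k L c - (p.coeff (p.natDegree - 1) : L)) / p.natDegree := by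
    field_simp; rw [hc]; ring
  rw [this]
  exact div_mem (sub_mem (F.algebraMap_mem c) (p.coeff _).2) (natCast_mem F _)

/-- Descent along a degree-like family of predicates. -/
theorem mem_adjoin_of_descent [Fintype ι] (hD : ∀ i j, D i (g j) = if i = j then 1 else 0)
    (hk : ∀ x : L, IsAlgebraic k x → x ∈ Set.range (algebraMap k L)) (P : ℕ → L → Prop)
    (hP : ∀ N x, P N x → IsAlgebraic (IntermediateField.adjoin k (Set.range g)) x →
      ∀ i, D i x = 0 ∨ ∃ N' < N, P N' (D i x)) (N : ℕ) {x : L} (hx : P N x)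
    (hxa : IsAlgebraic (IntermediateField.adjoin k (Set.range g)) x) :
    x ∈ IntermediateField.adjoin k (Set.range g) := by
  induction N using Nat.strong_induction_on generalizing x with
  | _ N ih =>
    refine mem_adjoin_of_dual_apply_mem hD hk hxa fun i => ?_
    rcases hP N x hx hxa i with h0 | ⟨N', hN', h⟩
    · rw [h0]; exact zero_mem _
    · exact ih N' hN' h (isAlgebraic_dual_apply hD i hxa)

end DualDerivations

end

section

section LowSpace

variable {B L : Type*} [Field B] [Field L] [Algebra B L]

/-- The `B`-span of the monomials of degree `< N` in two elements. -/
def lowSpace (B : Type*) {L : Type*} [Field B] [Field L] [Algebra B L] (g : Fin 2 → L) (N : ℕ) :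
    Submodule B L :=
  Submodule.span B {x | ∃ a b : ℕ, a + b < N ∧ x = g 0 ^ a * g 1 ^ b}

variable {g : Fin 2 → L}

theorem lowSpace_zero : lowSpace B g 0 = ⊥ := by
  rw [eq_bot_iff]
  refine Submodule.span_le.2 ?_
  rintro x ⟨a, b, h, -⟩; omega

theorem mul_mem_lowSpace {M N : ℕ} {x y : L} (hx : x ∈ lowSpace B g (M + 1))
    (hy : y ∈ lowSpace B g N) : x * y ∈ lowSpace B g (M + N) := by
  refine (?_ : lowSpace B g (M + 1) * lowSpace B g N ≤ lowSpace B g (M + N))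
    (Submodule.mul_mem_mul hx hy)
  rw [lowSpace, lowSpace, Submodule.span_mul_span]
  refine Submodule.span_le.2 ?_
  rintro _ ⟨_, ⟨a, b, h, rfl⟩, _, ⟨a', b', h', rfl⟩, rfl⟩
  exact Submodule.subset_span ⟨a + a', b + b', by omega, by simp only; ring⟩

theorem algebraMap_mem_lowSpace (b : B) (N : ℕ) : algebraMap B L b ∈ lowSpace B g (N + 1) := by
  rw [Algebra.algebraMap_eq_smul_one]
  exact Submodule.smul_mem _ _ (Submodule.subset_span ⟨0, 0, by omega, by simp⟩)

theorem gen_mem_lowSpace (i : Fin 2) (N : ℕ) : g i ∈ lowSpace B g (N + 2) := by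
  refine Submodule.subset_span ?_
  fin_cases i
  · exact ⟨1, 0, by omega, by simp⟩
  · exact ⟨0, 1, by omega, by simp⟩

theorem mem_lowSpace_iff {N : ℕ} {x : L} : x ∈ lowSpace B g N ↔
    ∃ p : MvPolynomial (Fin 2) B, (p = 0 ∨ p.totalDegree < N) ∧ MvPolynomial.aeval g p = x := by
  constructor
  · intro hx
    induction hx using Submodule.span_induction with
    | mem x hx =>
      obtain ⟨a, b, h, rfl⟩ := hx
      refine ⟨MvPolynomial.X 0 ^ a * MvPolynomial.X 1 ^ b, Or.inr ?_, by simp⟩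
      refine (MvPolynomial.totalDegree_mul _ _).trans_lt ?_
      simpa
    | zero => exact ⟨0, Or.inl rfl, by simp⟩
    | add x y _ _ hx hy =>
      obtain ⟨p, hp, rfl⟩ := hx
      obtain ⟨q, hq, rfl⟩ := hy
      refine ⟨p + q, ?_, by simp⟩
      rcases hp with rfl | hp
      · simpa using hq
      rcases hq with rfl | hq
      · simpa using Or.inr hp
      · exact Or.inr ((MvPolynomial.totalDegree_add _ _).trans_lt (max_lt hp hq))
    | smul b x _ hx =>
      obtain ⟨p, hp, rfl⟩ := hx
      refine ⟨b • p, ?_, by simp⟩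
      rcases hp with rfl | hp
      · simp
      · exact Or.inr ((MvPolynomial.totalDegree_smul_le _ _).trans_lt hp)
  · rintro ⟨p, hp, rfl⟩
    rcases hp with rfl | hp
    · simp
    rw [p.as_sum, map_sum]
    refine Submodule.sum_mem _ fun m hm => ?_
    rw [MvPolynomial.aeval_monomial, ← Algebra.smul_def]
    refine Submodule.smul_mem _ _ (Submodule.subset_span ⟨m 0, m 1, ?_, ?_⟩)
    · have := MvPolynomial.le_totalDegree hm
      rw [Finsupp.sum_fintype _ _ (by simp)] at this
      simp at this
      omega
    · rw [Finsupp.prod_fintype _ _ (by simp)]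
      simp

theorem derivation_mem_lowSpace_of_algebraMap {k : Type*} [Field k] [Algebra k L]
    (D : Derivation k L L) (hB : ∀ b : B, D (algebraMap B L b) = 0)
    (hg : ∀ i, ∃ b : B, D (g i) = algebraMap B L b) {N : ℕ} {x : L} (hx : x ∈ lowSpace B g N) :
    D x ∈ lowSpace B g (N - 1) := by
  choose c hc using hg
  induction hx using Submodule.span_induction with
  | mem x hx =>
    obtain ⟨a, b, h, rfl⟩ := hx
    have : D (g 0 ^ a * g 1 ^ b) =
        (b * c 1 : B) • (g 0 ^ a * g 1 ^ (b - 1)) + (a * c 0 : B) • (g 0 ^ (a - 1) * g 1 ^ b) := by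
      rw [Algebra.smul_def, Algebra.smul_def]
      simp only [Derivation.leibniz, Derivation.leibniz_pow, hc, smul_eq_mul, nsmul_eq_mul,
        map_mul, map_natCast]
      ring
    rw [this]
    refine add_mem ?_ ?_
    · rcases b with _ | b
      · simp
      · exact Submodule.smul_mem _ _ (Submodule.subset_span ⟨a, b, by omega, by simp⟩)
    · rcases a with _ | a
      · simp
      · exact Submodule.smul_mem _ _ (Submodule.subset_span ⟨a, b, by omega, by simp⟩)
  | zero => simp
  | add x y _ _ hx hy => rw [map_add]; exact add_mem hx hy
  | smul b x _ hx =>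
    rw [Algebra.smul_def, Derivation.leibniz, hB, smul_zero, add_zero, smul_eq_mul,
      ← Algebra.smul_def]
    exact Submodule.smul_mem _ _ hx

theorem derivation_mem_lowSpace {k : Type*} [Field k] [Algebra k L]
    (D : Derivation k L L) (hB : ∀ b : B, ∃ c : B, D (algebraMap B L b) = algebraMap B L c)
    (hg : ∀ i, D (g i) = 0) {N : ℕ} {x : L} (hx : x ∈ lowSpace B g N) :
    D x ∈ lowSpace B g N := by
  induction hx using Submodule.span_induction with
  | mem x hx =>
    obtain ⟨a, b, h, rfl⟩ := hx
    simp [Derivation.leibniz, Derivation.leibniz_pow, hg]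
  | zero => simp
  | add x y _ _ hx hy => rw [map_add]; exact add_mem hx hy
  | smul b x hx' hx =>
    obtain ⟨c, hc⟩ := hB b
    rw [Algebra.smul_def, Derivation.leibniz, hc, smul_eq_mul, smul_eq_mul, mul_comm x,
      ← Algebra.smul_def, ← Algebra.smul_def]
    exact add_mem (Submodule.smul_mem _ _ hx) (Submodule.smul_mem _ _ hx')

theorem mem_lowSpace_of_mul_mem (hg : AlgebraicIndependent B g) {q₁ q₂ : MvPolynomial (Fin 2) B}
    (hq : IsRelPrime q₁ q₂) (hq₁ : q₁ ≠ 0) {s : L} {N : ℕ}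
    (h₁ : s * MvPolynomial.aeval g q₁ ∈ lowSpace B g N)
    (h₂ : s * MvPolynomial.aeval g q₂ ∈ lowSpace B g N) :
    s ∈ lowSpace B g (N - q₁.totalDegree) := by
  rw [mem_lowSpace_iff] at h₁ h₂ ⊢
  obtain ⟨p₁, hp₁, e₁⟩ := h₁
  obtain ⟨p₂, hp₂, e₂⟩ := h₂
  have hinj := algebraicIndependent_iff_injective_aeval.1 hg
  have h : p₁ * q₂ = p₂ * q₁ := by
    apply hinj
    rw [map_mul, map_mul, e₁, e₂]; ring
  have hd : q₁ ∣ p₁ := hq.dvd_of_dvd_mul_right ⟨p₂, by rw [h, mul_comm]⟩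
  obtain ⟨r, rfl⟩ := hd
  have hne : MvPolynomial.aeval g q₁ ≠ 0 := fun h0 => hq₁ (hinj (h0.trans (map_zero _).symm))
  refine ⟨r, ?_, ?_⟩
  · by_cases hr : r = 0
    · exact Or.inl hr
    · rcases hp₁ with hp₁ | hp₁
      · exact absurd hp₁ (mul_ne_zero hq₁ hr)
      · rw [MvPolynomial.totalDegree_mul_of_isDomain hq₁ hr] at hp₁
        exact Or.inr (by omega)
  · rw [map_mul, mul_comm] at e₁
    exact mul_right_cancel₀ hne e₁

/-- The affine-linear form `a + b X + c Y`. -/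
noncomputable def affineForm (a b c : B) : MvPolynomial (Fin 2) B :=
  MvPolynomial.C a + MvPolynomial.C b * MvPolynomial.X 0 + MvPolynomial.C c * MvPolynomial.X 1

theorem coeff_affineForm (a b c : B) : (affineForm a b c).coeff 0 = a ∧
    (affineForm a b c).coeff (Finsupp.single 0 1) = b ∧
    (affineForm a b c).coeff (Finsupp.single 1 1) = c := by
  simp [affineForm, MvPolynomial.coeff_C_mul, MvPolynomial.coeff_X, MvPolynomial.coeff_C,
    Finsupp.single_left_inj, eq_comm]

theorem totalDegree_affineForm {a b c : B} (h : b ≠ 0 ∨ c ≠ 0) :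
    (affineForm a b c).totalDegree = 1 := by
  apply le_antisymm
  · refine (MvPolynomial.totalDegree_add _ _).trans (max_le
      ((MvPolynomial.totalDegree_add _ _).trans (max_le (by simp) ?_)) ?_)
    all_goals exact (MvPolynomial.totalDegree_mul _ _).trans (by simp)
  · obtain ⟨-, h1, h2⟩ := coeff_affineForm a b c
    rcases h with h | h
    · have := MvPolynomial.le_totalDegree (MvPolynomial.mem_support_iff.2 (h1.symm ▸ h))
      simpa using this
    · have := MvPolynomial.le_totalDegree (MvPolynomial.mem_support_iff.2 (h2.symm ▸ h))
      simpa using this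

theorem isRelPrime_affineForm {a b c a' b' c' : B} (h : b ≠ 0 ∨ c ≠ 0) (h' : b' ≠ 0 ∨ c' ≠ 0)
    (H : ∀ u : B, u * a = a' → u * b = b' → u * c = c' → False) :
    IsRelPrime (affineForm a b c) (affineForm a' b' c') := by
  have hirr : Irreducible (affineForm a b c) := by
    apply MvPolynomial.irreducible_of_totalDegree_eq_one (totalDegree_affineForm h)
    intro x hx
    obtain ⟨-, h1, h2⟩ := coeff_affineForm a b c
    have hb := hx (Finsupp.single 0 1)
    have hc := hx (Finsupp.single 1 1)
    rw [h1] at hb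
    rw [h2] at hc
    rcases h with h | h
    · exact (ne_zero_of_dvd_ne_zero h hb).isUnit
    · exact (ne_zero_of_dvd_ne_zero h hc).isUnit
  rw [hirr.isRelPrime_iff_not_dvd]
  rintro ⟨r, hr⟩
  have hd := congrArg MvPolynomial.totalDegree hr
  have hne : affineForm a' b' c' ≠ 0 := fun h0 => by
    have := totalDegree_affineForm (a := a') h'
    rw [h0] at this; simp at this
  rw [MvPolynomial.totalDegree_mul_of_isDomain (by rintro h0; simp [h0] at hr; exact hne hr)
    (by rintro h0; simp [h0] at hr; exact hne hr), totalDegree_affineForm h,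
    totalDegree_affineForm h'] at hd
  rw [MvPolynomial.totalDegree_eq_zero_iff_eq_C.1 (by omega : r.totalDegree = 0)] at hr
  set u := r.coeff 0
  obtain ⟨h0, h1, h2⟩ := coeff_affineForm a b c
  obtain ⟨h0', h1', h2'⟩ := coeff_affineForm a' b' c'
  rw [hr, mul_comm, MvPolynomial.coeff_C_mul] at h0' h1' h2'
  exact H u (by rw [← h0', h0]) (by rw [← h1', h1]) (by rw [← h2', h2])

end LowSpace

end

section

section

variable {k L ι : Type*} [Field k] [Field L] [Algebra k L]

theorem exists_polynomial_multiple {ι₀ : Type*} {h : ι₀ → L} (hh : AlgebraicIndependent k h)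
    {x : L} (hx : x ∈ IntermediateField.adjoin k (Set.range h))
    (hintegral : IsIntegral (Algebra.adjoin k (Set.range h)) x) : x ∈ Algebra.adjoin k (Set.range h) := by
  have : IsIntegrallyClosed (Algebra.adjoin k (Set.range h)) :=
    IsIntegrallyClosed.of_equiv hh.aevalEquiv.toRingEquiv
  open IntermediateField.algebraAdjoinAdjoin in
  have h2 : IsIntegral (Algebra.adjoin k (Set.range h))
      (⟨x, hx⟩ : IntermediateField.adjoin k (Set.range h)) := by
    rw [← isIntegral_algebraMap_iff (B := L) Subtype.val_injective]
    exact hintegral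
  open IntermediateField.algebraAdjoinAdjoin in
  obtain ⟨y, hy⟩ := IsIntegrallyClosed.isIntegral_iff.1 h2
  have := congrArg (fun z : IntermediateField.adjoin k (Set.range h) => (z : L)) hy
  simp only at this
  rw [← this]
  exact y.2

theorem isIntegral_of_forall_mem {k B L : Type*} [CommRing k] [CommRing B] [CommRing L]
    [Algebra k L] [Algebra B L] {S : Subalgebra k L} {T : Subalgebra B L} (h : ∀ y ∈ S, y ∈ T) {x : L}
    (hx : IsIntegral S x) : IsIntegral T x := by
  let incl : S →+* T :=
    { toFun := fun y => ⟨y, h y y.2⟩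
      map_one' := rfl
      map_mul' := fun _ _ => rfl
      map_zero' := rfl
      map_add' := fun _ _ => rfl }
  exact hx.map_of_comp_eq incl (RingHom.id L) (by ext; rfl)

theorem isAlgebraic_of_forall_mem {k B L : Type*} [Field k] [Field B] [Field L]
    [Algebra k L] [Algebra B L] {S : IntermediateField k L} {T : IntermediateField B L}
    (h : ∀ y ∈ S, y ∈ T) {x : L}
    (hx : IsAlgebraic S x) : IsAlgebraic T x :=
  (isIntegral_of_forall_mem (S := S.toSubalgebra) (T := T.toSubalgebra) h hx.isIntegral).isAlgebraic

theorem mem_adjoin_of_lowSpace_descent {k k₀ B L ι : Type*} [Field k] [Field k₀] [Field B]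
    [Field L] [Algebra k₀ B]
    [Algebra B L] [Algebra k L] [Algebra k₀ L] [IsScalarTower k₀ B L] [CharZero k] [Fintype ι]
    {g : ι → L} {D : ι → Derivation k L L} (hD : ∀ i j, D i (g j) = if i = j then 1 else 0)
    (hk : ∀ x : L, IsAlgebraic k x → x ∈ Set.range (algebraMap k L))
    {h : Fin 2 → L} (hh : AlgebraicIndependent B h)
    (hreg : ∀ x : L, IsAlgebraic (IntermediateField.adjoin B (Set.range h)) x →
      x ∈ IntermediateField.adjoin B (Set.range h))
    {G : Set L} (hG : ∀ y ∈ G, y ∈ Algebra.adjoin B (Set.range h))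
    (hGg : ∀ y, y ∈ IntermediateField.adjoin k₀ G ↔ y ∈ IntermediateField.adjoin k (Set.range g))
    (hdesc : ∀ N x, x ∈ lowSpace B h N → IsAlgebraic (IntermediateField.adjoin k (Set.range g)) x →
      ∀ i, D i x ∈ lowSpace B h (N - 1))
    {x : L} (hx : IsAlgebraic (IntermediateField.adjoin k₀ G) x) :
    x ∈ IntermediateField.adjoin k₀ G := by
  have hle : ∀ y ∈ Algebra.adjoin k₀ G, y ∈ Algebra.adjoin B (Set.range h) := by
    intro y hy
    exact (Algebra.adjoin_le (S := (Algebra.adjoin B (Set.range h)).restrictScalars k₀) hG) hy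
  have hx' := IntermediateField.isAlgebraic_adjoin_iff.1 hx
  obtain ⟨d, hd0, hd⟩ := hx'.exists_integral_multiple
  have hd' : IsIntegral (Algebra.adjoin B (Set.range h)) (d • x) := isIntegral_of_forall_mem hle hd
  have hmem : d • x ∈ Algebra.adjoin B (Set.range h) := by
    refine exists_polynomial_multiple hh (hreg _ ?_) hd'
    exact IntermediateField.isAlgebraic_adjoin_iff.2 hd'.isAlgebraic
  have hlow : ∃ N, d • x ∈ lowSpace B h N := by
    rw [Algebra.adjoin_range_eq_range_aeval] at hmem
    obtain ⟨p, hp⟩ := hmem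
    exact ⟨p.totalDegree + 1, mem_lowSpace_iff.2 ⟨p, Or.inr (Nat.lt_succ_self _), hp⟩⟩
  obtain ⟨N, hN⟩ := hlow
  have hdx : d • x ∈ IntermediateField.adjoin k₀ G := by
    rw [hGg]
    refine mem_adjoin_of_descent hD hk (fun N x => x ∈ lowSpace B h N) ?_ N hN
      (isAlgebraic_of_forall_mem (fun y => (hGg y).1)
        (IntermediateField.isAlgebraic_adjoin_iff.2 hd.isAlgebraic))
    intro N x hx hxa i
    have h1 := hdesc N x hx hxa i
    rcases N with _ | N
    · rw [Nat.zero_sub, lowSpace_zero] at h1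
      exact Or.inl (by simpa using h1)
    · exact Or.inr ⟨N, by omega, h1⟩
  have hdF := IntermediateField.algebra_adjoin_le_adjoin k₀ G d.2
  have hdne : (d : L) ≠ 0 := fun h => hd0 (Subtype.ext h)
  have : x = (d : L)⁻¹ * (d • x) := by
    rw [Subalgebra.smul_def, smul_eq_mul, inv_mul_cancel_left₀ hdne]
  rw [this]
  exact mul_mem (inv_mem hdF) hdx

theorem totalDegree_eq_zero_of_pderiv {k ι : Type*} [Field k] [CharZero k] {p : MvPolynomial ι k}
    (h1 : ∀ i, MvPolynomial.pderiv i p = 0) : p.totalDegree = 0 := by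
  rw [MvPolynomial.totalDegree_eq_zero_iff]
  intro m hm i
  by_contra hmi
  have h2 := congrArg (MvPolynomial.coeff (m - Finsupp.single i 1)) (h1 i)
  have h3 : m - Finsupp.single i 1 + Finsupp.single i 1 = m :=
    tsub_add_cancel_of_le (Finsupp.single_le_iff.2 (Nat.one_le_iff_ne_zero.2 hmi))
  rw [MvPolynomial.coeff_pderiv, h3, MvPolynomial.coeff_zero] at h2
  rcases mul_eq_zero.1 h2 with h2 | h2
  · exact MvPolynomial.mem_support_iff.1 hm h2
  · exact Nat.cast_add_one_ne_zero _ h2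

/-- A Jacobian criterion for algebraic independence. -/
theorem algebraicIndependent_of_derivations {k L ι : Type*} [Field k] [Field L] [Algebra k L]
    [CharZero k] [Fintype ι] {g : ι → L}
    (h : ∀ a : ι → L, (∀ Δ : Derivation k L L, ∑ i, a i * Δ (g i) = 0) → a = 0) :
    AlgebraicIndependent k g := by
  rw [algebraicIndependent_iff]
  suffices H : ∀ n, ∀ p : MvPolynomial ι k, p.totalDegree = n → MvPolynomial.aeval g p = 0 → p = 0
    from fun p hp => H _ p rfl hp
  intro n
  induction n using Nat.strong_induction_on with
  | _ n ih =>
    intro p hpn hp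
    by_cases hn : n = 0
    · rw [MvPolynomial.totalDegree_eq_zero_iff_eq_C.1 (hpn.trans hn)] at hp ⊢
      simpa using hp
    have h1 : ∀ i, MvPolynomial.pderiv i p = 0 := by
      have h2 : (fun i => MvPolynomial.aeval g (MvPolynomial.pderiv i p)) = 0 := by
        apply h
        intro Δ
        have h3 := congrArg Δ hp
        rw [map_zero] at h3
        rw [← h3]
        clear h3 hp hpn
        induction p using MvPolynomial.induction_on with
        | C a => simp
        | add p q hp hq => simp [add_mul, Finset.sum_add_distrib, hp, hq]
        | mul_X p i hp =>
          simp only [Derivation.leibniz, map_add, map_mul, MvPolynomial.aeval_X, smul_eq_mul, ← hp,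
            MvPolynomial.pderiv_X, Finset.mul_sum, add_mul, Finset.sum_add_distrib, Pi.single_apply]
          congr 1
          · simp [ite_mul, apply_ite]
          · exact Finset.sum_congr rfl fun j _ => by ring
      intro i
      by_contra hne
      refine hne (ih _ ?_ _ rfl (congrFun h2 i))
      rw [MvPolynomial.totalDegree, Finset.sup_lt_iff (by simpa using Nat.pos_of_ne_zero hn)]
      intro m hm
      rw [MvPolynomial.mem_support_iff, MvPolynomial.coeff_pderiv] at hm
      have := MvPolynomial.le_totalDegree (MvPolynomial.mem_support_iff.2 (left_ne_zero_of_mul hm))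
      rw [Finsupp.sum_add_index' (by simp) (by simp), Finsupp.sum_single_index rfl] at this
      omega
    exact absurd (hpn.symm.trans (totalDegree_eq_zero_of_pderiv h1)) hn

end

end

section

section Bars

variable {k B L : Type*} [Field k] [Field B] [Field L] [Algebra k B] [Algebra B L] [Algebra k L]
  [IsScalarTower k B L] [CharZero k]

/-- The squared distance of two points in isotropic coordinates. -/
def isoDist {R : Type*} [CommRing R] (z w z' w' : R) : R := (z - z') * (w - w')

/-- Barycentric coordinates with respect to three affinely independent points. -/
theorem exists_barycentric {z w : Fin 3 → B}
    (hdet : (z 1 - z 0) * (w 2 - w 0) - (z 2 - z 0) * (w 1 - w 0) ≠ 0) (h : Fin 2 → L)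
    (hh : AlgebraicIndependent B h) :
    ∃ κ : Fin 3 → L, κ 0 + κ 1 + κ 2 = 1 ∧
      κ 0 * algebraMap B L (z 0) + κ 1 * algebraMap B L (z 1) + κ 2 * algebraMap B L (z 2) = h 0 ∧
      κ 0 * algebraMap B L (w 0) + κ 1 * algebraMap B L (w 1) + κ 2 * algebraMap B L (w 2) = h 1 ∧
      ∀ p : Fin 3 → B, ∃ a b c : B, (∀ i, a + b * z i + c * w i = p i) ∧
        MvPolynomial.aeval h (affineForm a b c) = ∑ i, algebraMap B L (p i) * κ i := by
  set d := (z 1 - z 0) * (w 2 - w 0) - (z 2 - z 0) * (w 1 - w 0) with hd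
  have hdL : algebraMap B L d ≠ 0 := by simpa using hdet
  set Z := fun i => algebraMap B L (z i)
  set W := fun i => algebraMap B L (w i)
  have hdL' : (Z 1 - Z 0) * (W 2 - W 0) - (Z 2 - Z 0) * (W 1 - W 0) = algebraMap B L d := by
    simp [hd, Z, W]
  refine ⟨![1 - ((h 0 - Z 0) * (W 2 - W 0) - (Z 2 - Z 0) * (h 1 - W 0)) / algebraMap B L d -
      ((Z 1 - Z 0) * (h 1 - W 0) - (h 0 - Z 0) * (W 1 - W 0)) / algebraMap B L d,
      ((h 0 - Z 0) * (W 2 - W 0) - (Z 2 - Z 0) * (h 1 - W 0)) / algebraMap B L d,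
      ((Z 1 - Z 0) * (h 1 - W 0) - (h 0 - Z 0) * (W 1 - W 0)) / algebraMap B L d], ?_, ?_, ?_, ?_⟩
  · simp only [Matrix.cons_val]
    ring
  · simp only [Matrix.cons_val]
    change _ * Z 0 + _ * Z 1 + _ * Z 2 = _
    field_simp
    rw [← hdL']
    ring
  · simp only [Matrix.cons_val]
    change _ * W 0 + _ * W 1 + _ * W 2 = _
    field_simp
    rw [← hdL']
    ring
  · intro p
    refine ⟨p 0 - ((p 1 - p 0) * (w 2 - w 0) - (p 2 - p 0) * (w 1 - w 0)) / d * z 0 -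
      ((z 1 - z 0) * (p 2 - p 0) - (z 2 - z 0) * (p 1 - p 0)) / d * w 0,
      ((p 1 - p 0) * (w 2 - w 0) - (p 2 - p 0) * (w 1 - w 0)) / d,
      ((z 1 - z 0) * (p 2 - p 0) - (z 2 - z 0) * (p 1 - p 0)) / d, ?_, ?_⟩
    · intro i
      fin_cases i
      · simp only [Fin.zero_eta]
        ring
      · simp only [Fin.mk_one]
        field_simp
        rw [hd]; ring
      · simp only [Fin.reduceFinMk]
        field_simp
        rw [hd]; ring
    · rw [Fin.sum_univ_three]
      simp only [Matrix.cons_val, affineForm, map_add, map_mul, map_sub, map_div₀,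
        MvPolynomial.aeval_X, MvPolynomial.algHom_C]
      change (algebraMap B L (p 0) - (_ * (W 2 - W 0) - _ * (W 1 - W 0)) / _ * Z 0 -
        ((Z 1 - Z 0) * _ - (Z 2 - Z 0) * _) / _ * W 0) + (_ * (W 2 - W 0) - _ * (W 1 - W 0)) / _ * _ +
        ((Z 1 - Z 0) * _ - (Z 2 - Z 0) * _) / _ * _ = _
      field_simp
      ring

variable {z w : Fin 3 → B} {h : Fin 2 → L}

omit [CharZero k] in
/-- The vector identity behind three bars at a vertex. -/
theorem sum_barycentric_mul_deriv {κ : Fin 3 → L} (Δ : Derivation k L L)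
    (h1 : κ 0 + κ 1 + κ 2 = 1) {x y : L} {Z W : Fin 3 → L}
    (hz : κ 0 * Z 0 + κ 1 * Z 1 + κ 2 * Z 2 = x) (hw : κ 0 * W 0 + κ 1 * W 1 + κ 2 * W 2 = y)
    (hx : Δ x = 0) (hy : Δ y = 0) :
    ∑ i, κ i * Δ (isoDist x y (Z i) (W i)) =
      κ 0 * κ 1 * Δ (isoDist (Z 0) (W 0) (Z 1) (W 1)) +
      κ 0 * κ 2 * Δ (isoDist (Z 0) (W 0) (Z 2) (W 2)) +
      κ 1 * κ 2 * Δ (isoDist (Z 1) (W 1) (Z 2) (W 2)) := by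
  rw [Fin.sum_univ_three]
  simp only [isoDist, Derivation.leibniz, map_sub, hx, hy, smul_eq_mul]
  obtain rfl := hz
  obtain rfl := hw
  have h0 : κ 0 = 1 - κ 1 - κ 2 := by linear_combination h1
  rw [h0]
  ring

omit [CharZero k] [Algebra k L] [IsScalarTower k B L] in
theorem exists_derivation_pair [CharZero k] {d : Fin 3 → B} (h12 : AlgebraicIndependent k ![d 0, d 1])
    (h3 : Transcendental k (d 2)) : ∃ δ₁ δ₂ : Derivation k B B, δ₁ (d 0) = 1 ∧ δ₁ (d 1) = 0 ∧
      δ₂ (d 0) = 0 ∧ δ₂ (d 1) = 1 ∧ (δ₁ (d 2) ≠ 0 ∨ δ₂ (d 2) ≠ 0) := by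
  obtain ⟨δ₁, h1⟩ := exists_derivation_of_algebraicIndependent h12 ![1, 0]
  obtain ⟨δ₂, h2⟩ := exists_derivation_of_algebraicIndependent h12 ![0, 1]
  obtain ⟨δ₃, h3⟩ := exists_derivation_of_algebraicIndependent
    (algebraicIndependent_unique_type_iff (ι := Unit) (x := fun _ => d 2) |>.2 h3) (fun _ => 1)
  have a1 := h1 0
  have a2 := h1 1
  have a3 := h2 0
  have a4 := h2 1
  have a5 := h3 ()
  simp only [Matrix.cons_val] at a1 a2 a3 a4
  by_cases h : δ₁ (d 2) ≠ 0 ∨ δ₂ (d 2) ≠ 0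
  · exact ⟨δ₁, δ₂, a1, a2, a3, a4, h⟩
  push Not at h
  refine ⟨δ₁ + (δ₃ - δ₃ (d 0) • δ₁ - δ₃ (d 1) • δ₂), δ₂, ?_, ?_, a3, a4, Or.inl ?_⟩ <;>
  simp [a1, a2, a3, a4, a5, h.1, h.2]

theorem barycentric_remainder {κ : Fin 3 → L} (h1 : κ 0 + κ 1 + κ 2 = 1) {x y P Q : L}
    {Z W : Fin 3 → L}
    (hz : κ 0 * Z 0 + κ 1 * Z 1 + κ 2 * Z 2 = x) (hw : κ 0 * W 0 + κ 1 * W 1 + κ 2 * W 2 = y)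
    {c : Fin 3 → L} (hP : ∑ i, c i * (y - W i) = P) (hQ : ∑ i, c i * (x - Z i) = Q) :
    (∑ i, (c i - (∑ j, c j) * κ i) = 0) ∧
    ((Z 1 - Z 0) * (W 2 - W 0) - (Z 2 - Z 0) * (W 1 - W 0)) * (c 1 - (∑ j, c j) * κ 1) =
      P * (Z 2 - Z 0) - Q * (W 2 - W 0) ∧
    ((Z 1 - Z 0) * (W 2 - W 0) - (Z 2 - Z 0) * (W 1 - W 0)) * (c 2 - (∑ j, c j) * κ 2) =
      Q * (W 1 - W 0) - P * (Z 1 - Z 0) := by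
  rw [← hP, ← hQ, ← hz, ← hw]
  have h0 : κ 0 = 1 - κ 1 - κ 2 := by linear_combination h1
  simp only [Fin.sum_univ_three]
  rw [h0]
  refine ⟨?_, ?_, ?_⟩ <;> ring

theorem three_bars
    (hdet : (z 1 - z 0) * (w 2 - w 0) - (z 2 - z 0) * (w 1 - w 0) ≠ 0)
    (hh : AlgebraicIndependent B h)
    (hreg : ∀ x : L, IsAlgebraic (IntermediateField.adjoin B (Set.range h)) x →
      x ∈ IntermediateField.adjoin B (Set.range h))
    (hk : ∀ x : L, IsAlgebraic k x → x ∈ Set.range (algebraMap k L))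
    (hd : AlgebraicIndependent k ![isoDist (z 0) (w 0) (z 1) (w 1), isoDist (z 0) (w 0) (z 2) (w 2)])
    (hd' : Transcendental k (isoDist (z 1) (w 1) (z 2) (w 2)))
    {x : L} (hx : IsAlgebraic (IntermediateField.adjoin k (Set.range fun i =>
      isoDist (h 0) (h 1) (algebraMap B L (z i)) (algebraMap B L (w i)))) x) :
    x ∈ IntermediateField.adjoin k (Set.range fun i =>
      isoDist (h 0) (h 1) (algebraMap B L (z i)) (algebraMap B L (w i))) := by
  obtain ⟨κ, k1, kz, kw, kaff⟩ := exists_barycentric hdet h hh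
  obtain ⟨δ₁, δ₂, e1, e2, e3, e4, e5⟩ := exists_derivation_pair
    (d := ![isoDist (z 0) (w 0) (z 1) (w 1), isoDist (z 0) (w 0) (z 2) (w 2),
      isoDist (z 1) (w 1) (z 2) (w 2)]) (by simpa using hd) (by simpa using hd')
  simp only [Matrix.cons_val] at e1 e2 e3 e4 e5
  set t₁ := δ₁ (isoDist (z 1) (w 1) (z 2) (w 2))
  set t₂ := δ₂ (isoDist (z 1) (w 1) (z 2) (w 2))
  obtain ⟨Δ₁, hΔ₁, hΔ₁'⟩ := exists_derivation_extending δ₁ hh 0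
  obtain ⟨Δ₂, hΔ₂, hΔ₂'⟩ := exists_derivation_extending δ₂ hh 0
  obtain ⟨DZ, hDZ, hDZ'⟩ := exists_derivation_extending (0 : Derivation k B B) hh ![1, 0]
  obtain ⟨DW, hDW, hDW'⟩ := exists_derivation_extending (0 : Derivation k B B) hh ![0, 1]
  have hZ0 := hDZ' 0
  have hZ1 := hDZ' 1
  have hW0 := hDW' 0
  have hW1 := hDW' 1
  simp only [Matrix.cons_val, Derivation.zero_apply, map_zero] at hZ0 hZ1 hW0 hW1 hDZ hDW
  set Z := fun i => algebraMap B L (z i) with hZ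
  set W := fun i => algebraMap B L (w i) with hW
  set f : Fin 3 → L := fun i => isoDist (h 0) (h 1) (Z i) (W i) with hf
  have hDZf : ∀ i, DZ (f i) = h 1 - W i := by
    intro i
    simp [hf, isoDist, hZ, hW, Derivation.leibniz, hDZ, hZ0, hZ1]
  have hDWf : ∀ i, DW (f i) = h 0 - Z i := by
    intro i
    simp [hf, isoDist, hZ, hW, Derivation.leibniz, hDW, hW0, hW1]
  -- the two coprime quadratic forms
  have hforms : ∃ l : (Fin 3 → B) → MvPolynomial (Fin 2) B,
      (∀ p, MvPolynomial.aeval h (l p) = ∑ i, algebraMap B L (p i) * κ i) ∧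
      (∀ p i, p 0 ≠ p i → (l p).totalDegree = 1) ∧
      (∀ p p' i j, p 0 ≠ p i → p' 0 ≠ p' j → (∀ u : B, (∀ i, u * p i = p' i) → False) →
        IsRelPrime (l p) (l p')) := by
    choose a b c h1 h2 using kaff
    have hne : ∀ p i, p 0 ≠ p i → b p ≠ 0 ∨ c p ≠ 0 := by
      intro p i hp
      by_contra! hcon
      apply hp
      rw [← h1 p 0, ← h1 p i, hcon.1, hcon.2]
      ring
    refine ⟨fun p => affineForm (a p) (b p) (c p), h2,
      fun p i hp => totalDegree_affineForm (hne p i hp), fun p p' i j hp hp' hu => ?_⟩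
    refine isRelPrime_affineForm (hne p i hp) (hne p' j hp') fun u u1 u2 u3 => hu u fun i => ?_
    rw [← h1 p, ← h1 p', ← u1, ← u2, ← u3]
    ring
  obtain ⟨l, l1, l2, l3⟩ := hforms
  have hl0 : ∀ p i, p 0 ≠ p i → l p ≠ 0 := by
    intro p i hp h0
    have := l2 p i hp
    rw [h0, MvPolynomial.totalDegree_zero] at this
    omega
  set q₁ := l ![0, 1, 0] * l ![1, 0, t₁] with hq₁
  set q₂ := l ![0, 0, 1] * l ![1, t₂, 0] with hq₂
  have hq₁0 : q₁ ≠ 0 := mul_ne_zero (hl0 _ 1 (by simp)) (hl0 _ 1 (by simp))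
  have hdeg : q₁.totalDegree = 2 := by
    rw [hq₁, MvPolynomial.totalDegree_mul_of_isDomain (hl0 _ 1 (by simp)) (hl0 _ 1 (by simp)),
      l2 _ 1 (by simp), l2 _ 1 (by simp)]
  have hrel : IsRelPrime q₁ q₂ := by
    refine IsRelPrime.mul_left (IsRelPrime.mul_right ?_ ?_) (IsRelPrime.mul_right ?_ ?_)
    · refine l3 _ _ 1 2 (by simp) (by simp) fun u hu => ?_
      have h1 := hu 1
      have h2 := hu 2
      simp at h1 h2
    · refine l3 _ _ 1 2 (by simp) (by simp) fun u hu => ?_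
      have h1 := hu 0
      simp at h1
    · refine l3 _ _ 1 2 (by simp) (by simp) fun u hu => ?_
      have h1 := hu 0
      have h2 := hu 2
      simp at h1 h2
      simp [h1] at h2
    · refine l3 _ _ 1 2 (by simp) (by simp) fun u hu => ?_
      have h1 := hu 0
      have h2 := hu 1
      have h3 := hu 2
      simp at h1 h2 h3
      subst h1
      simp at h3
      rcases e5 with h | h
      · exact h h3
      · exact h h2.symm
  have hdist : ∀ i j, isoDist (Z i) (W i) (Z j) (W j) =
      algebraMap B L (isoDist (z i) (w i) (z j) (w j)) := by
    intro i j
    simp [isoDist, hZ, hW]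
  have hsum : ∀ (Δ : Derivation k L L) (δ : Derivation k B B),
      (∀ b, Δ (algebraMap B L b) = algebraMap B L (δ b)) → (∀ i, Δ (h i) = (0 : Fin 2 → L) i) →
      ∑ i, κ i * Δ (f i) =
        κ 0 * κ 1 * algebraMap B L (δ (isoDist (z 0) (w 0) (z 1) (w 1))) +
        κ 0 * κ 2 * algebraMap B L (δ (isoDist (z 0) (w 0) (z 2) (w 2))) +
        κ 1 * κ 2 * algebraMap B L (δ (isoDist (z 1) (w 1) (z 2) (w 2))) := by
    intro Δ δ h1 h2
    rw [sum_barycentric_mul_deriv Δ k1 kz kw (h2 0) (h2 1), hdist, hdist, hdist, h1, h1, h1]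
  have hsum₁ : ∑ i, κ i * Δ₁ (f i) = MvPolynomial.aeval h q₁ := by
    rw [hsum Δ₁ δ₁ hΔ₁ hΔ₁', e1, e2, hq₁, map_mul, l1, l1]
    simp [Fin.sum_univ_three]
    ring
  have hsum₂ : ∑ i, κ i * Δ₂ (f i) = MvPolynomial.aeval h q₂ := by
    rw [hsum Δ₂ δ₂ hΔ₂ hΔ₂', e3, e4, hq₂, map_mul, l1, l1]
    simp [Fin.sum_univ_three]
    ring
  have hinj : ∀ q : MvPolynomial (Fin 2) B, MvPolynomial.aeval h q = 0 → q = 0 := fun q hq =>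
    (algebraicIndependent_iff.1 hh) q hq
  have hdetL : (Z 1 - Z 0) * (W 2 - W 0) - (Z 2 - Z 0) * (W 1 - W 0) ≠ 0 := by
    simp only [hZ, hW, ← map_sub, ← map_mul]
    exact (map_ne_zero _).2 hdet
  have hind : AlgebraicIndependent k f := by
    apply algebraicIndependent_of_derivations
    intro a ha
    obtain ⟨r0, r1, r2⟩ := barycentric_remainder k1 kz kw (c := a) (P := 0) (Q := 0)
      (by rw [← ha DZ]; exact Finset.sum_congr rfl fun i _ => by rw [hDZf])
      (by rw [← ha DW]; exact Finset.sum_congr rfl fun i _ => by rw [hDWf])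
    set s := ∑ j, a j
    simp only [zero_mul, sub_zero] at r1 r2
    replace r1 := (mul_eq_zero.1 r1).resolve_left hdetL
    replace r2 := (mul_eq_zero.1 r2).resolve_left hdetL
    rw [Fin.sum_univ_three, r1, r2, add_zero, add_zero] at r0
    have hs : s = 0 := by
      have h3 : s * MvPolynomial.aeval h q₁ = 0 := by
        rw [← hsum₁, ← ha Δ₁, Fin.sum_univ_three, Fin.sum_univ_three]
        linear_combination (-Δ₁ (f 0)) * r0 - Δ₁ (f 1) * r1 - Δ₁ (f 2) * r2
      exact (mul_eq_zero.1 h3).resolve_right fun h => hq₁0 (hinj _ h)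
    rw [hs, zero_mul, sub_zero] at r0 r1 r2
    funext i
    fin_cases i <;> assumption
  obtain ⟨D, hD⟩ : ∃ D : Fin 3 → Derivation k L L, ∀ i j, D i (f j) = if i = j then 1 else 0 := by
    choose D hD using fun i => exists_derivation_of_algebraicIndependent hind
      (fun j => if i = j then 1 else 0)
    exact ⟨D, hD⟩
  replace hD : ∀ i j, D i (f j) = @ite L (i = j) (Classical.propDecidable _) 1 0 := fun i j => by
    rw [hD]; congr
  refine mem_adjoin_of_lowSpace_descent (k₀ := k) (G := Set.range f) hD hk hh hreg ?_
    (fun _ => Iff.rfl) ?_ hx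
  · rintro _ ⟨i, rfl⟩
    have hmem : ∀ i, h i ∈ Algebra.adjoin B (Set.range h) := fun i =>
      Algebra.subset_adjoin ⟨i, rfl⟩
    have hmemB : ∀ b, algebraMap B L b ∈ Algebra.adjoin B (Set.range h) := fun b =>
      Subalgebra.algebraMap_mem _ b
    exact mul_mem (sub_mem (hmem 0) (hmemB _)) (sub_mem (hmem 1) (hmemB _))
  intro N x hxN hxa
  rcases Nat.eq_zero_or_pos N with rfl | hN
  · rw [lowSpace_zero, Submodule.mem_bot] at hxN
    intro i
    simp [hxN]
  have happ : ∀ Δ : Derivation k L L, Δ x = ∑ i, D i x * Δ (f i) := fun Δ =>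
    Δ.apply_eq_sum_dual hD hxa
  obtain ⟨r0, r1, r2⟩ := barycentric_remainder k1 kz kw (c := fun i => D i x) (P := DZ x) (Q := DW x)
      (by rw [happ DZ]; exact Finset.sum_congr rfl fun i _ => by rw [hDZf])
      (by rw [happ DW]; exact Finset.sum_congr rfl fun i _ => by rw [hDWf])
  set s := ∑ j, D j x with hs
  set e : Fin 3 → L := fun i => D i x - s * κ i with he
  have hDZx : DZ x ∈ lowSpace B h (N - 1) := by
    refine derivation_mem_lowSpace_of_algebraMap DZ hDZ (fun i => ?_) hxN
    fin_cases i
    · exact ⟨1, by simpa using hZ0⟩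
    · exact ⟨0, by simpa using hZ1⟩
  have hDWx : DW x ∈ lowSpace B h (N - 1) := by
    refine derivation_mem_lowSpace_of_algebraMap DW hDW (fun i => ?_) hxN
    fin_cases i
    · exact ⟨0, by simpa using hW0⟩
    · exact ⟨1, by simpa using hW1⟩
  have hcram : ∀ y, ((Z 1 - Z 0) * (W 2 - W 0) - (Z 2 - Z 0) * (W 1 - W 0)) * y ∈
      lowSpace B h (N - 1) → y ∈ lowSpace B h (N - 1) := by
    intro y hy
    have h1 := Submodule.smul_mem _
      ((z 1 - z 0) * (w 2 - w 0) - (z 2 - z 0) * (w 1 - w 0))⁻¹ hy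
    convert h1 using 1
    rw [Algebra.smul_def, map_inv₀, map_sub, map_mul, map_mul, map_sub, map_sub, map_sub, map_sub,
      inv_mul_cancel_left₀ hdetL]
  have hcoef : ∀ (b b' : B) (y : L), y ∈ lowSpace B h (N - 1) →
      y * (algebraMap B L b - algebraMap B L b') ∈ lowSpace B h (N - 1) := by
    intro b b' y hy
    rw [← map_sub, mul_comm, ← Algebra.smul_def]
    exact Submodule.smul_mem _ _ hy
  have he1 : e 1 ∈ lowSpace B h (N - 1) :=
    hcram _ (r1 ▸ sub_mem (hcoef _ _ _ hDZx) (hcoef _ _ _ hDWx))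
  have he2 : e 2 ∈ lowSpace B h (N - 1) :=
    hcram _ (r2 ▸ sub_mem (hcoef _ _ _ hDWx) (hcoef _ _ _ hDZx))
  have he0 : e 0 ∈ lowSpace B h (N - 1) := by
    rw [Fin.sum_univ_three] at r0
    have : e 0 = -e 1 - e 2 := by linear_combination r0
    rw [this]
    exact sub_mem (neg_mem he1) he2
  have hei : ∀ i, e i ∈ lowSpace B h (N - 1) := by
    intro i
    fin_cases i <;> assumption
  have hlow : ∀ (Δ : Derivation k L L) (δ : Derivation k B B),
      (∀ b, Δ (algebraMap B L b) = algebraMap B L (δ b)) → (∀ i, Δ (h i) = (0 : Fin 2 → L) i) →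
      s * ∑ i, κ i * Δ (f i) ∈ lowSpace B h N := by
    intro Δ δ h1 h2
    have h3 : s * ∑ i, κ i * Δ (f i) = Δ x - ∑ i, Δ (f i) * e i := by
      rw [happ Δ, Finset.mul_sum, ← Finset.sum_sub_distrib]
      exact Finset.sum_congr rfl fun i _ => by simp only [he]; ring
    rw [h3]
    refine sub_mem (derivation_mem_lowSpace Δ (fun b => ⟨_, h1 b⟩) h2 hxN)
      (Submodule.sum_mem _ fun i _ => ?_)
    have h4 : Δ (f i) ∈ lowSpace B h (1 + 1) := by
      have h5 : Δ (f i) = -((algebraMap B L (δ (w i))) * h 0 + (algebraMap B L (δ (z i))) * h 1) +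
          algebraMap B L (δ (w i) * z i + δ (z i) * w i) := by
        have a0 := h2 0
        have a1 := h2 1
        simp only [Pi.zero_apply] at a0 a1
        simp only [hf, isoDist, Derivation.leibniz, map_sub, a0, a1, hZ, hW, h1, smul_eq_mul,
          map_add, map_mul]
        ring
      rw [h5, ← Algebra.smul_def, ← Algebra.smul_def]
      exact add_mem (neg_mem (add_mem (Submodule.smul_mem _ _ (gen_mem_lowSpace 0 0))
        (Submodule.smul_mem _ _ (gen_mem_lowSpace 1 0)))) (algebraMap_mem_lowSpace _ 1)
    have := mul_mem_lowSpace h4 (hei i)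
    rwa [Nat.add_sub_cancel' hN] at this
  have hsN : s ∈ lowSpace B h (N - 2) := by
    rw [← hdeg]
    exact mem_lowSpace_of_mul_mem hh hrel hq₁0 (hsum₁ ▸ hlow Δ₁ δ₁ hΔ₁ hΔ₁')
      (hsum₂ ▸ hlow Δ₂ δ₂ hΔ₂ hΔ₂')
  have hκ : ∀ i, κ i ∈ lowSpace B h (1 + 1) := by
    intro i
    obtain ⟨a, b, c, h1, h2⟩ := kaff (Pi.single i 1)
    have h3 : κ i = ∑ j, algebraMap B L ((Pi.single i 1 : Fin 3 → B) j) * κ j := by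
      simp [Pi.single_apply, apply_ite]
    rw [h3, ← h2]
    simp only [affineForm, map_add, map_mul, MvPolynomial.aeval_X, MvPolynomial.algHom_C]
    rw [← Algebra.smul_def, ← Algebra.smul_def]
    exact add_mem (add_mem (algebraMap_mem_lowSpace _ 1)
      (Submodule.smul_mem _ _ (gen_mem_lowSpace 0 0)))
        (Submodule.smul_mem _ _ (gen_mem_lowSpace 1 0))
  intro i
  have h1 : D i x = κ i * s + e i := by simp only [he]; ring
  rw [h1]
  refine add_mem ?_ (hei i)
  have h2 := mul_mem_lowSpace (hκ i) hsN
  rcases Nat.lt_or_ge N 2 with hlt | hge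
  · have : N - 2 = 0 := by omega
    rw [this, lowSpace_zero, Submodule.mem_bot] at hsN
    simp [hsN]
  · rwa [show 1 + (N - 2) = N - 1 by omega] at h2

theorem one_body (hh : AlgebraicIndependent B h)
    (hreg : ∀ x : L, IsAlgebraic (IntermediateField.adjoin B (Set.range h)) x →
      x ∈ IntermediateField.adjoin B (Set.range h))
    (hk : ∀ x : L, IsAlgebraic k x → x ∈ Set.range (algebraMap k L))
    {x : L} (hx : IsAlgebraic (IntermediateField.adjoin k (Set.range h)) x) :
    x ∈ IntermediateField.adjoin k (Set.range h) := by
  obtain ⟨D, hD', hD⟩ : ∃ D : Fin 2 → Derivation k L L, (∀ i b, D i (algebraMap B L b) = 0) ∧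
      ∀ i j, D i (h j) = if i = j then 1 else 0 := by
    choose D hD using fun i => exists_derivation_extending (0 : Derivation k B B) hh
      (fun j => if i = j then 1 else 0)
    exact ⟨D, fun i b => by simpa using (hD i).1 b, fun i => (hD i).2⟩
  replace hD : ∀ i j, D i (h j) = @ite L (i = j) (Classical.propDecidable _) 1 0 := fun i j => by
    rw [hD]; congr
  refine mem_adjoin_of_lowSpace_descent (k₀ := k) (G := Set.range h) hD hk hh hreg
    (fun y hy => Algebra.subset_adjoin hy) (fun _ => Iff.rfl) ?_ hx
  intro N x hxN _ i
  refine derivation_mem_lowSpace_of_algebraMap (D i) (hD' i) (fun j => ?_) hxN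
  rw [hD]
  exact ⟨if i = j then 1 else 0, by split_ifs <;> simp⟩

theorem one_body_one_bar (hh : AlgebraicIndependent B h)
    (hreg : ∀ x : L, IsAlgebraic (IntermediateField.adjoin B (Set.range h)) x →
      x ∈ IntermediateField.adjoin B (Set.range h))
    (hk : ∀ x : L, IsAlgebraic k x → x ∈ Set.range (algebraMap k L))
    {b b' : B} (hb : AlgebraicIndependent k ![b, b'])
    {x : L} (hx : IsAlgebraic (IntermediateField.adjoin k (insert
      (isoDist (h 0) (h 1) (algebraMap B L b) (algebraMap B L b')) (Set.range h))) x) :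
    x ∈ IntermediateField.adjoin k (insert
      (isoDist (h 0) (h 1) (algebraMap B L b) (algebraMap B L b')) (Set.range h)) := by
  set f := isoDist (h 0) (h 1) (algebraMap B L b) (algebraMap B L b') with hf
  obtain ⟨δ₁, h1⟩ := exists_derivation_of_algebraicIndependent hb ![1, 0]
  obtain ⟨δ₂, h2⟩ := exists_derivation_of_algebraicIndependent hb ![0, 1]
  obtain ⟨Δ₁, hΔ₁, hΔ₁'⟩ := exists_derivation_extending δ₁ hh 0
  obtain ⟨Δ₂, hΔ₂, hΔ₂'⟩ := exists_derivation_extending δ₂ hh 0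
  have a1 := h1 0
  have a2 := h1 1
  have a3 := h2 0
  have a4 := h2 1
  simp only [Matrix.cons_val] at a1 a2 a3 a4
  set q₁ : MvPolynomial (Fin 2) B := affineForm (-b') 0 1 with hq₁
  set q₂ : MvPolynomial (Fin 2) B := affineForm (-b) 1 0 with hq₂
  have hdeg : q₁.totalDegree = 1 := totalDegree_affineForm (Or.inr one_ne_zero)
  have hq₁0 : q₁ ≠ 0 := by
    intro h0
    rw [h0, MvPolynomial.totalDegree_zero] at hdeg
    omega
  have hrel : IsRelPrime q₁ q₂ := isRelPrime_affineForm (Or.inr one_ne_zero) (Or.inl one_ne_zero)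
    fun u _ h2 _ => by simp at h2
  have e1 : Δ₁ f = -MvPolynomial.aeval h q₁ := by
    have b0 := hΔ₁' 0
    have b1 := hΔ₁' 1
    simp [hf, isoDist, Derivation.leibniz, b0, b1, hΔ₁, a1, a2, hq₁, affineForm]
    ring
  have e2 : Δ₂ f = -MvPolynomial.aeval h q₂ := by
    have b0 := hΔ₂' 0
    have b1 := hΔ₂' 1
    simp [hf, isoDist, Derivation.leibniz, b0, b1, hΔ₂, a3, a4, hq₂, affineForm]
    ring
  set k₁ := IntermediateField.adjoin k (Set.range h) with hk₁
  set E₁ : Derivation k₁ L L := Δ₁.overAdjoin (Set.range h) (by rintro _ ⟨i, rfl⟩; exact hΔ₁' i)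
  set E₂ : Derivation k₁ L L := Δ₂.overAdjoin (Set.range h) (by rintro _ ⟨i, rfl⟩; exact hΔ₂' i)
  have hE₁ : ∀ y, E₁ y = Δ₁ y := fun y => rfl
  have hE₂ : ∀ y, E₂ y = Δ₂ y := fun y => rfl
  have hft : AlgebraicIndependent k₁ (fun _ : Unit => f) := by
    rw [algebraicIndependent_unique_type_iff]
    intro halg
    have h3 := E₁.eq_zero_of_isAlgebraic halg
    rw [hE₁, e1, neg_eq_zero] at h3
    exact hq₁0 ((algebraicIndependent_iff.1 hh) _ h3)
  obtain ⟨D, hD⟩ := exists_derivation_of_algebraicIndependent hft (fun _ => 1)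
  refine mem_adjoin_of_lowSpace_descent (k := k₁) (k₀ := k) (ι := Unit)
    (g := fun _ => f) (D := fun _ => D) (h := h) (B := B)
    (fun _ _ => by simp [hD ()]) (fun x hx => ⟨⟨x, one_body hh hreg hk hx⟩, rfl⟩) hh hreg ?_ ?_ ?_ hx
  · have hmem : ∀ i, h i ∈ Algebra.adjoin B (Set.range h) := fun i =>
      Algebra.subset_adjoin ⟨i, rfl⟩
    have hmemB : ∀ b, algebraMap B L b ∈ Algebra.adjoin B (Set.range h) := fun b =>
      Subalgebra.algebraMap_mem _ b
    rintro y (rfl | ⟨i, rfl⟩)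
    · exact mul_mem (sub_mem (hmem 0) (hmemB _)) (sub_mem (hmem 1) (hmemB _))
    · exact hmem i
  · intro y
    have := IntermediateField.adjoin_adjoin_left k (Set.range h) {f}
    rw [Set.union_singleton] at this
    rw [Set.range_const, ← this, IntermediateField.mem_restrictScalars]
  · intro N x hxN hxa _
    have happ : ∀ Δ : Derivation k₁ L L, Δ x = D x * Δ f := fun Δ => by
      simpa using Δ.apply_eq_sum_dual (D := fun _ : Unit => D) (g := fun _ => f)
        (fun _ _ => by simp [hD ()]) hxa
    have h3 : D x * MvPolynomial.aeval h q₁ ∈ lowSpace B h N := by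
      have : D x * MvPolynomial.aeval h q₁ = -Δ₁ x := by
        rw [← hE₁, happ E₁, hE₁, e1]; ring
      rw [this]
      exact neg_mem (derivation_mem_lowSpace Δ₁ (fun b => ⟨_, hΔ₁ b⟩) hΔ₁' hxN)
    have h4 : D x * MvPolynomial.aeval h q₂ ∈ lowSpace B h N := by
      have : D x * MvPolynomial.aeval h q₂ = -Δ₂ x := by
        rw [← hE₂, happ E₂, hE₂, e2]; ring
      rw [this]
      exact neg_mem (derivation_mem_lowSpace Δ₂ (fun b => ⟨_, hΔ₂ b⟩) hΔ₂' hxN)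
    have := mem_lowSpace_of_mul_mem hh hrel hq₁0 h3 h4
    rwa [hdeg] at this

end Bars

end

section

section PureTranscendental

theorem mem_range_of_isAlgebraic_adjoin {F L κ : Type*} [Field F] [Field L] [Algebra F L]
    [CharZero F] {p : κ → L} (hp : AlgebraicIndependent F p) {x : L}
    (hx : x ∈ IntermediateField.adjoin F (Set.range p)) (hxa : IsAlgebraic F x) :
    x ∈ Set.range (algebraMap F L) := by
  have h1 : IsIntegral (Algebra.adjoin F (Set.range p)) x := hxa.isIntegral.tower_top
  have h2 := exists_polynomial_multiple hp hx h1
  rw [Algebra.adjoin_range_eq_range_aeval] at h2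
  obtain ⟨q, rfl⟩ := h2
  have hq : IsAlgebraic F q := (isAlgebraic_algHom_iff _ hp).1 hxa
  have h3 := totalDegree_eq_zero_of_pderiv fun i =>
    (MvPolynomial.pderiv i).eq_zero_of_isAlgebraic hq
  rw [MvPolynomial.totalDegree_eq_zero_iff_eq_C] at h3
  rw [h3]
  exact ⟨q.coeff 0, by simp⟩

variable {F L κ : Type*} [Field F] [Field L] [Algebra F L] [CharZero F] {p : κ → L}

omit [CharZero F] in
theorem AlgebraicIndependent.adjoin_image_compl (hp : AlgebraicIndependent F p) (A : Set κ) :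
    AlgebraicIndepOn (IntermediateField.adjoin F (p '' A)) p Aᶜ :=
  IntermediateField.algebraicIndependent_adjoin_iff.2
    ((AlgebraicIndependent.iff_adjoin_image A).1 hp).2

end PureTranscendental

end

section

section Sparse

variable {ι : Type*}

/-- `(2, 3)`-sparsity, counting the edges induced on every finite set of vertices. -/
def EdgeSparse (E : Finset (Sym2 ι)) : Prop :=
  (∀ e ∈ E, ¬ e.IsDiag) ∧ ∀ X : Finset ι, 2 ≤ X.card → (E ∩ X.sym2).card + 3 ≤ 2 * X.card

theorem EdgeSparse.mono {E R : Finset (Sym2 ι)} (hE : EdgeSparse E) (h : R ⊆ E) : EdgeSparse R :=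
  ⟨fun e he => hE.1 e (h he), fun X hX =>
    (Nat.add_le_add_right (Finset.card_le_card (Finset.inter_subset_inter_right h)) 3).trans
      (hE.2 X hX)⟩

theorem inter_sym2_eq_empty {E : Finset (Sym2 ι)} (hE : ∀ e ∈ E, ¬ e.IsDiag) {X : Finset ι}
    (hX : X.card ≤ 1) : E ∩ X.sym2 = ∅ := by
  rw [Finset.eq_empty_iff_forall_notMem]
  intro e he
  rw [Finset.mem_inter] at he
  induction e with
  | _ u t =>
    rw [Finset.mk_mem_sym2_iff] at he
    exact hE _ he.1 (Sym2.mk_isDiag_iff.2 (Finset.card_le_one.1 hX _ he.2.1 _ he.2.2))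

theorem card_inter_sym2_le {E : Finset (Sym2 ι)} (hE : EdgeSparse E) (X : Finset ι)
    (hX : X.Nonempty) : (E ∩ X.sym2).card + 2 ≤ 2 * X.card := by
  rcases Nat.lt_or_ge X.card 2 with h | h
  · have := hX.card_pos
    rw [inter_sym2_eq_empty hE.1 (by omega), Finset.card_empty]
    omega
  · have := hE.2 X h
    omega

theorem card_inter_sym2_supermodular (E : Finset (Sym2 ι)) (X Y : Finset ι) :
    (E ∩ X.sym2).card + (E ∩ Y.sym2).card ≤
      (E ∩ (X ∪ Y).sym2).card + (E ∩ (X ∩ Y).sym2).card := by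
  rw [← Finset.card_union_add_card_inter]
  refine Nat.add_le_add (Finset.card_le_card ?_) (Finset.card_le_card ?_)
  · intro e he
    simp only [Finset.mem_union, Finset.mem_inter, Finset.mem_sym2_iff] at he ⊢
    rcases he with he | he
    · exact ⟨he.1, fun a ha => Or.inl (he.2 a ha)⟩
    · exact ⟨he.1, fun a ha => Or.inr (he.2 a ha)⟩
  · intro e he
    simp only [Finset.mem_inter, Finset.mem_sym2_iff] at he ⊢
    exact ⟨he.1.1, fun a ha => ⟨he.1.2 a ha, he.2.2 a ha⟩⟩

theorem disjoint_inter_sym2 {E : Finset (Sym2 ι)} (hE : ∀ e ∈ E, ¬ e.IsDiag) {X Y : Finset ι}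
    (hX : (X ∩ Y).card ≤ 1) : Disjoint (E ∩ X.sym2) (E ∩ Y.sym2) := by
  rw [Finset.disjoint_iff_inter_eq_empty, ← inter_sym2_eq_empty hE hX]
  ext e
  simp only [Finset.mem_inter, Finset.mem_sym2_iff]
  grind

/-- A vertex of degree at most three. -/
theorem EdgeSparse.exists_degree_le {E : Finset (Sym2 ι)} (hE : EdgeSparse E) {W : Finset ι}
    (hW : W.Nonempty) (hEW : E ⊆ W.sym2) : ∃ v ∈ W, (E.filter (v ∈ ·)).card ≤ 3 := by
  by_contra! hcon
  have h1 : ∑ v ∈ W, (E.filter (v ∈ ·)).card = ∑ e ∈ E, (W.filter (· ∈ e)).card :=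
    Finset.sum_card_bipartiteAbove_eq_sum_card_bipartiteBelow (fun v e => v ∈ e)
  have h2 : ∑ e ∈ E, (W.filter (· ∈ e)).card ≤ ∑ e ∈ E, 2 := by
    refine Finset.sum_le_sum fun e _ => ?_
    induction e with
    | _ u t =>
      refine (Finset.card_le_card (t := {u, t}) fun x hx => ?_).trans Finset.card_le_two
      simpa using (Finset.mem_filter.1 hx).2
  have h3 : ∑ v ∈ W, 4 ≤ ∑ v ∈ W, (E.filter (v ∈ ·)).card :=
    Finset.sum_le_sum fun v hv => hcon v hv
  have h4 := card_inter_sym2_le hE W hW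
  rw [Finset.inter_eq_left.2 hEW] at h4
  simp only [Finset.sum_const, smul_eq_mul] at h2 h3
  omega

theorem EdgeSparse.insert_edge {R : Finset (Sym2 ι)} (hR : EdgeSparse R) {a b : ι} (hab : a ≠ b)
    (h : ∀ X : Finset ι, a ∈ X → b ∈ X → (R ∩ X.sym2).card + 4 ≤ 2 * X.card) :
    EdgeSparse (insert s(a, b) R) := by
  constructor
  · intro e he
    rcases Finset.mem_insert.1 he with rfl | he
    · simpa using hab
    · exact hR.1 e he
  · intro X hX
    by_cases hX2 : a ∈ X ∧ b ∈ X
    · have h1 := h X hX2.1 hX2.2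
      have h2 := Finset.card_insert_le s(a, b) (R ∩ X.sym2)
      rw [Finset.insert_inter_of_mem (by simpa using hX2)]
      omega
    · rw [Finset.insert_inter_of_notMem (by simpa using hX2)]
      exact hR.2 X hX

/-- The combinatorial core of the Henneberg step at a vertex of degree three. -/
theorem EdgeSparse.exists_insert_edge {E : Finset (Sym2 ι)} (hE : EdgeSparse E) {v : ι} {n : Fin 3 → ι}
    (hn : Function.Injective n) (hv : ∀ i, n i ≠ v) (hnE : ∀ i, s(v, n i) ∈ E) :
    ∃ i j, i ≠ j ∧ s(n i, n j) ∉ E.filter (v ∉ ·) ∧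
      EdgeSparse (insert s(n i, n j) (E.filter (v ∉ ·))) := by
  set R := E.filter (v ∉ ·) with hRdef
  have hR : EdgeSparse R := hE.mono (Finset.filter_subset _ _)
  have hno : ∀ X : Finset ι, (∀ i, n i ∈ X) → (R ∩ X.sym2).card + 4 ≤ 2 * X.card := by
    intro X hX
    have hXc : 3 ≤ (X.erase v).card := by
      have := Finset.card_le_card (s := Finset.univ.image n) (t := X.erase v) (by
        intro x hx
        obtain ⟨i, -, rfl⟩ := Finset.mem_image.1 hx
        exact Finset.mem_erase.2 ⟨hv i, hX i⟩)
      rwa [Finset.card_image_of_injective _ hn] at this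
    have h1 := hE.2 (insert v X) (by
      have := Finset.card_le_card ((Finset.erase_subset v X).trans (Finset.subset_insert v X))
      omega)
    have h2 : (R ∩ X.sym2).card + 3 ≤ (E ∩ (insert v X).sym2).card := by
      have h3 : Disjoint (R ∩ X.sym2) (Finset.univ.image fun i => s(v, n i)) := by
        rw [Finset.disjoint_left]
        intro e he he'
        obtain ⟨i, -, rfl⟩ := Finset.mem_image.1 he'
        have := (Finset.mem_filter.1 (Finset.mem_inter.1 he).1).2
        simp at this
      have h4 : (Finset.univ.image fun i => s(v, n i)).card = 3 := by
        rw [Finset.card_image_of_injective]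
        · rfl
        · intro i j hij
          refine hn ?_
          simpa [(hv _), (hv _).symm] using hij
      rw [← h4, ← Finset.card_union_of_disjoint h3]
      refine Finset.card_le_card (Finset.union_subset ?_ ?_)
      · refine Finset.inter_subset_inter (Finset.filter_subset _ _) ?_
        exact Finset.sym2_mono (Finset.subset_insert _ _)
      · intro e he
        obtain ⟨i, -, rfl⟩ := Finset.mem_image.1 he
        simp [hnE, hX]
    by_cases hvX : v ∈ X
    · have h5 := hR.2 (X.erase v) (by omega)
      have h6 : R ∩ X.sym2 ⊆ R ∩ (X.erase v).sym2 := by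
        intro e he
        rw [Finset.mem_inter, Finset.mem_sym2_iff] at he ⊢
        refine ⟨he.1, fun a ha => Finset.mem_erase.2 ⟨?_, he.2 a ha⟩⟩
        rintro rfl
        exact (Finset.mem_filter.1 he.1).2 ha
      have := Finset.card_le_card h6
      have := Finset.card_erase_of_mem hvX
      omega
    · rw [Finset.card_insert_of_notMem hvX] at h1
      omega
  by_contra! hcon
  have htight : ∀ i j, i ≠ j → ∃ X : Finset ι, n i ∈ X ∧ n j ∈ X ∧
      2 * X.card < (R ∩ X.sym2).card + 4 := by
    intro i j hij
    by_contra! h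
    refine hcon i j hij (fun hmem => ?_) (hR.insert_edge (hn.ne hij) fun X h1 h2 => h X h1 h2)
    have h1 := h {n i, n j} (by simp) (by simp)
    have h2 : 0 < (R ∩ ({n i, n j} : Finset ι).sym2).card :=
      Finset.card_pos.2 ⟨s(n i, n j), by simp [hmem]⟩
    have h3 := Finset.card_le_two (a := n i) (b := n j)
    omega
  have hcase : ∀ X Y : Finset ι, (∀ i, n i ∈ X ∪ Y) → 2 * X.card < (R ∩ X.sym2).card + 4 →
      2 * Y.card < (R ∩ Y.sym2).card + 4 → (X ∩ Y).card ≤ 1 := by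
    intro X Y h hX hY
    by_contra! h1
    have h2 := hR.2 (X ∩ Y) h1
    have h3 := hno (X ∪ Y) h
    have h4 := card_inter_sym2_supermodular R X Y
    have h5 := Finset.card_union_add_card_inter X Y
    omega
  obtain ⟨X, hX0, hX1, hX⟩ := htight 0 1 (by simp)
  obtain ⟨Y, hY0, hY2, hY⟩ := htight 0 2 (by simp)
  obtain ⟨Z, hZ1, hZ2, hZ⟩ := htight 1 2 (by simp)
  have hXY := hcase X Y (by intro i; fin_cases i <;> simp [*]) hX hY
  have hXZ := hcase X Z (by intro i; fin_cases i <;> simp [*]) hX hZ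
  have hYZ := hcase Y Z (by intro i; fin_cases i <;> simp [*]) hY hZ
  have h1 := hno (X ∪ Y ∪ Z) (by intro i; fin_cases i <;> simp [*])
  have h2 : (R ∩ X.sym2).card + (R ∩ Y.sym2).card + (R ∩ Z.sym2).card ≤
      (R ∩ (X ∪ Y ∪ Z).sym2).card := by
    rw [← Finset.card_union_of_disjoint (disjoint_inter_sym2 hR.1 hXY),
      ← Finset.card_union_of_disjoint
        (Finset.disjoint_union_left.2 ⟨disjoint_inter_sym2 hR.1 hXZ, disjoint_inter_sym2 hR.1 hYZ⟩)]
    refine Finset.card_le_card fun e he => ?_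
    simp only [Finset.mem_union, Finset.mem_inter, Finset.mem_sym2_iff] at he ⊢
    grind
  have h3 : (X ∪ Y ∪ Z).card + 3 ≤ X.card + Y.card + Z.card := by
    have h4 := Finset.card_union_add_card_inter X Y
    have h5 := Finset.card_union_add_card_inter (X ∪ Y) Z
    have h6 : 1 ≤ (X ∩ Y).card := Finset.card_pos.2 ⟨n 0, by simp [*]⟩
    have h7 : 2 ≤ ((X ∪ Y) ∩ Z).card := by
      have := Finset.card_le_card (s := {n 1, n 2}) (t := (X ∪ Y) ∩ Z) (by
        intro x hx
        simp only [Finset.mem_insert, Finset.mem_singleton] at hx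
        rcases hx with rfl | rfl <;> simp [*])
      rwa [Finset.card_pair (hn.ne (by simp))] at this
    omega
  omega

theorem EdgeSparse.exists_insert_edge_card_eq_three {E : Finset (Sym2 ι)} (hE : EdgeSparse E) {v : ι}
    {N : Finset ι} (hN : N.card = 3) (hv : ∀ u ∈ N, u ≠ v) (hNE : ∀ u ∈ N, s(v, u) ∈ E) :
    ∃ n : Fin 3 → ι, Function.Injective n ∧ N = Finset.univ.image n ∧
      s(n 0, n 1) ∉ E.filter (v ∉ ·) ∧
      EdgeSparse (insert s(n 0, n 1) (E.filter (v ∉ ·))) := by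
  let e : Fin 3 ≃ N := (Fintype.equivFinOfCardEq (by simpa using hN)).symm
  obtain ⟨i, j, hij, h1, h2⟩ := hE.exists_insert_edge (v := v) (n := fun i => (e i : ι))
    (fun i j hij => e.injective (Subtype.ext hij)) (fun i => hv _ (e i).2) (fun i => hNE _ (e i).2)
  obtain ⟨σ, rfl, rfl⟩ : ∃ σ : Equiv.Perm (Fin 3), σ 0 = i ∧ σ 1 = j := by
    clear h1 h2
    revert i j
    decide
  refine ⟨fun i => (e (σ i) : ι), fun i j hij => σ.injective (e.injective (Subtype.ext hij)), ?_,
    h1, h2⟩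
  ext x
  simp only [Finset.mem_image, Finset.mem_univ, true_and]
  exact ⟨fun hx => ⟨σ.symm (e.symm ⟨x, hx⟩), by simp⟩, by rintro ⟨i, rfl⟩; exact (e (σ i)).2⟩

end Sparse

end

section

section Laman

variable {ι F L : Type*} [Field F] [Field L] [Algebra F L]

/-- The squared distance along a pair of vertices, in isotropic coordinates. -/
def sdist {R : Type*} [CommRing R] (p : ι × Fin 2 → R) : Sym2 ι → R :=
  Sym2.lift ⟨fun u t => isoDist (p (u, 0)) (p (u, 1)) (p (t, 0)) (p (t, 1)),
    fun u t => by simp only [isoDist]; ring⟩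

@[simp] theorem sdist_mk {R : Type*} [CommRing R] (p : ι × Fin 2 → R) (u t : ι) :
    sdist p s(u, t) = (p (u, 0) - p (t, 0)) * (p (u, 1) - p (t, 1)) := rfl

theorem derivation_isoDist {A : Type*} [CommRing A] [Algebra F A] (Δ : Derivation F A A)
    (x y z w : A) :
    Δ (isoDist x y z w) = (x - z) * (Δ y - Δ w) + (y - w) * (Δ x - Δ z) := by
  simp [isoDist, Derivation.leibniz]

variable [CharZero F] {p : ι × Fin 2 → L}

omit [CharZero F] in
theorem AlgebraicIndependent.coord_ne (hp : AlgebraicIndependent F p) {u t : ι} (h : u ≠ t)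
    (i : Fin 2) : p (u, i) - p (t, i) ≠ 0 := by
  have := hp.injective
  rw [sub_ne_zero]
  exact fun h' => h (congrArg Prod.fst (hp.injective h'))

theorem AlgebraicIndependent.det_ne_zero (hp : AlgebraicIndependent F p) {u t s : ι} (h1 : u ≠ t)
    (h2 : u ≠ s) (h3 : t ≠ s) :
    (p (t, 0) - p (u, 0)) * (p (s, 1) - p (u, 1)) -
      (p (s, 0) - p (u, 0)) * (p (t, 1) - p (u, 1)) ≠ 0 := by
  intro h0
  obtain ⟨Δ, hΔ⟩ := exists_derivation_of_algebraicIndependent hp (Pi.single (t, 0) 1)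
  have h4 := congrArg Δ h0
  simp [Derivation.leibniz, hΔ, h1, h3.symm] at h4
  exact hp.coord_ne h2.symm 1 h4

omit [CharZero F] in
theorem AlgebraicIndependent.vertex (hp : AlgebraicIndependent F p) (v : ι) :
    AlgebraicIndependent (IntermediateField.adjoin F (p '' {q | q.1 ≠ v})) (fun i => p (v, i)) := by
  have h := hp.adjoin_image_compl {q | q.1 ≠ v}
  exact AlgebraicIndependent.comp h (fun i : Fin 2 => (⟨(v, i), by simp⟩ : ↥({q : ι × Fin 2 | q.1 ≠ v}ᶜ)))
    (fun i j hij => by simpa using hij)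

/-- A Henneberg step of degree three. -/
theorem henneberg_two {k B L : Type*} [Field k] [Field B] [Field L] [Algebra k B] [Algebra B L]
    [Algebra k L] [IsScalarTower k B L] [CharZero k] {z w : Fin 3 → B} {h : Fin 2 → L}
    (hdet : (z 1 - z 0) * (w 2 - w 0) - (z 2 - z 0) * (w 1 - w 0) ≠ 0)
    (hh : AlgebraicIndependent B h) {δ : Derivation k B B}
    (hδ : δ (isoDist (z 0) (w 0) (z 1) (w 1)) = 1) {a : Fin 3 → L}
    (ha : ∀ Δ : Derivation k L L, (∀ b, Δ (algebraMap B L b) = 0) → ∑ i, a i *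
      Δ (isoDist (h 0) (h 1) (algebraMap B L (z i)) (algebraMap B L (w i))) = 0)
    (haδ : ∀ Δ : Derivation k L L, (∀ b, Δ (algebraMap B L b) = algebraMap B L (δ b)) → ∑ i, a i *
      Δ (isoDist (h 0) (h 1) (algebraMap B L (z i)) (algebraMap B L (w i))) = 0) :
    a = 0 := by
  have : CharZero B := charZero_of_injective_algebraMap (algebraMap k B).injective
  have : CharZero L := charZero_of_injective_algebraMap (algebraMap B L).injective
  have hpart : ∀ v : Fin 2 → L, ∃ Δ : Derivation k L L, (∀ b, Δ (algebraMap B L b) = 0) ∧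
      Δ (h 0) = v 0 ∧ Δ (h 1) = v 1 := by
    intro v
    obtain ⟨Δ, h1, h2⟩ := exists_derivation_extending (0 : Derivation k B B) hh v
    exact ⟨Δ, by simpa using h1, h2 0, h2 1⟩
  obtain ⟨D, hD, hD0, hD1⟩ := hpart ![1, 0]
  obtain ⟨D', hD', hD0', hD1'⟩ := hpart ![0, 1]
  obtain ⟨Δ, hΔ, hΔh⟩ := exists_derivation_extending δ hh 0
  have e1 := ha D hD
  have e2 := ha D' hD'
  have e3 := haδ Δ hΔ
  have hdist : Δ (isoDist (algebraMap B L (z 0)) (algebraMap B L (w 0))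
      (algebraMap B L (z 1)) (algebraMap B L (w 1))) = 1 := by
    have : isoDist (algebraMap B L (z 0)) (algebraMap B L (w 0))
      (algebraMap B L (z 1)) (algebraMap B L (w 1)) =
      algebraMap B L (isoDist (z 0) (w 0) (z 1) (w 1)) := by simp [isoDist]
    rw [this, hΔ, hδ, map_one]
  have hdist2 : ∀ i j, Δ (isoDist (algebraMap B L (z i)) (algebraMap B L (w i))
      (algebraMap B L (z j)) (algebraMap B L (w j))) =
      algebraMap B L (δ (isoDist (z i) (w i) (z j) (w j))) := by
    intro i j
    rw [← hΔ]
    simp [isoDist]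
  have hQ1 := hdist2 0 2
  have hQ2 := hdist2 1 2
  set P := δ (isoDist (z 0) (w 0) (z 2) (w 2))
  set Q := δ (isoDist (z 1) (w 1) (z 2) (w 2))
  have hdetL : (algebraMap B L (z 1) - algebraMap B L (z 0)) *
      (algebraMap B L (w 2) - algebraMap B L (w 0)) - (algebraMap B L (z 2) - algebraMap B L (z 0)) *
      (algebraMap B L (w 1) - algebraMap B L (w 0)) ≠ 0 := by
    rw [← map_sub, ← map_sub, ← map_sub, ← map_sub, ← map_mul, ← map_mul, ← map_sub]
    rwa [Ne, map_eq_zero]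
  set Z := fun i => algebraMap B L (z i)
  set W := fun i => algebraMap B L (w i)
  change (Z 1 - Z 0) * (W 2 - W 0) - (Z 2 - Z 0) * (W 1 - W 0) ≠ 0 at hdetL
  simp only [derivation_isoDist, hD0, hD1, hD0', hD1', hD, hD', Fin.sum_univ_three,
    Matrix.cons_val] at e1 e2
  change a 0 * ((h 0 - Z 0) * (0 - 0) + (h 1 - W 0) * (1 - 0)) +
    a 1 * ((h 0 - Z 1) * (0 - 0) + (h 1 - W 1) * (1 - 0)) +
    a 2 * ((h 0 - Z 2) * (0 - 0) + (h 1 - W 2) * (1 - 0)) = 0 at e1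
  change a 0 * ((h 0 - Z 0) * (1 - 0) + (h 1 - W 0) * (0 - 0)) +
    a 1 * ((h 0 - Z 1) * (1 - 0) + (h 1 - W 1) * (0 - 0)) +
    a 2 * ((h 0 - Z 2) * (1 - 0) + (h 1 - W 2) * (0 - 0)) = 0 at e2
  by_cases hs : a 0 + a 1 + a 2 = 0
  · have h1 : a 1 = 0 := by
      have : ((Z 1 - Z 0) * (W 2 - W 0) - (Z 2 - Z 0) * (W 1 - W 0)) * a 1 = 0 := by
        linear_combination -((W 0 - W 2) * h 0 + (Z 2 - Z 0) * h 1 + Z 0 * W 2 - Z 2 * W 0) * hs -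
          (W 2 - W 0) * e2 + (Z 2 - Z 0) * e1
      exact (mul_eq_zero.1 this).resolve_left hdetL
    have h2 : a 2 = 0 := by
      have : ((Z 1 - Z 0) * (W 2 - W 0) - (Z 2 - Z 0) * (W 1 - W 0)) * a 2 = 0 := by
        linear_combination -((W 1 - W 0) * h 0 - (Z 1 - Z 0) * h 1 - Z 0 * W 1 + Z 1 * W 0) * hs +
          (W 1 - W 0) * e2 - (Z 1 - Z 0) * e1
      exact (mul_eq_zero.1 this).resolve_left hdetL
    have h0 : a 0 = 0 := by linear_combination hs - h1 - h2
    funext i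
    fin_cases i
    exacts [h0, h1, h2]
  exfalso
  set s := a 0 + a 1 + a 2 with hsdef
  set κ : Fin 3 → L := fun i => a i / s with hκ
  have k1 : κ 0 + κ 1 + κ 2 = 1 := by
    simp only [hκ]
    rw [← add_div, ← add_div, div_self hs]
  have kz : κ 0 * Z 0 + κ 1 * Z 1 + κ 2 * Z 2 = h 0 := by
    simp only [hκ]
    field_simp
    linear_combination -e2
  have kw : κ 0 * W 0 + κ 1 * W 1 + κ 2 * W 2 = h 1 := by
    simp only [hκ]
    field_simp
    linear_combination -e1
  have hq := sum_barycentric_mul_deriv Δ k1 kz kw (hΔh 0) (hΔh 1)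
  have hq0 : ∑ i, κ i * Δ (isoDist (h 0) (h 1) (Z i) (W i)) = 0 := by
    have : ∑ i, κ i * Δ (isoDist (h 0) (h 1) (Z i) (W i)) =
        (∑ i, a i * Δ (isoDist (h 0) (h 1) (Z i) (W i))) / s := by
      rw [Finset.sum_div]
      exact Finset.sum_congr rfl fun i _ => by simp only [hκ]; ring
    rw [this]
    exact div_eq_zero_iff.2 (Or.inl e3)
  rw [hq0, hdist, hQ1, hQ2] at hq
  -- second derivatives of the quadratic form
  have k0' : κ 2 = 1 - κ 0 - κ 1 := by linear_combination k1
  have kder : ∀ i j : L, ∃ Δ : Derivation k L L, (∀ b, Δ (algebraMap B L b) = 0) ∧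
      Δ (κ 0) = i ∧ Δ (κ 1) = j := by
    intro i j
    obtain ⟨Δ, h1, h2, h3⟩ := hpart ![i * (Z 0 - Z 2) + j * (Z 1 - Z 2),
      i * (W 0 - W 2) + j * (W 1 - W 2)]
    simp only [Matrix.cons_val] at h2 h3
    refine ⟨Δ, h1, ?_⟩
    have h1Z : ∀ i, Δ (Z i) = 0 := fun i => h1 _
    have h1W : ∀ i, Δ (W i) = 0 := fun i => h1 _
    rw [k0'] at kz kw
    rw [← kz] at h2
    rw [← kw] at h3
    simp [Derivation.leibniz, h1Z, h1W] at h2 h3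
    constructor
    · have : ((Z 1 - Z 0) * (W 2 - W 0) - (Z 2 - Z 0) * (W 1 - W 0)) * (Δ (κ 0) - i) = 0 := by
        linear_combination (W 1 - W 2) * h2 - (Z 1 - Z 2) * h3
      exact sub_eq_zero.1 ((mul_eq_zero.1 this).resolve_left hdetL)
    · have : ((Z 1 - Z 0) * (W 2 - W 0) - (Z 2 - Z 0) * (W 1 - W 0)) * (Δ (κ 1) - j) = 0 := by
        linear_combination (Z 0 - Z 2) * h3 - (W 0 - W 2) * h2
      exact sub_eq_zero.1 ((mul_eq_zero.1 this).resolve_left hdetL)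
  obtain ⟨d, hd, hd0, hd1⟩ := kder 1 0
  obtain ⟨d', hd', hd0', hd1'⟩ := kder 0 1
  rw [k0'] at hq
  have q1 := congrArg d hq
  have q2 := congrArg d' hq
  simp only [map_zero, map_add, Derivation.leibniz, map_sub, hd, hd0, hd1, hd', hd0', hd1',
    Derivation.map_one_eq_zero, smul_eq_mul] at q1 q2
  have q11 := congrArg d q1
  have q12 := congrArg d' q1
  have q22 := congrArg d' q2
  simp only [map_zero, map_add, Derivation.leibniz, map_sub, hd, hd0, hd1, hd', hd0', hd1',
    Derivation.map_one_eq_zero, smul_eq_mul] at q11 q12 q22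
  have : (2 : L) = 0 := by linear_combination -2 * q12 + q11 + q22
  exact two_ne_zero this

theorem sdist_map {R S : Type*} [CommRing R] [CommRing S] (f : R →+* S) (p : ι × Fin 2 → R)
    (e : Sym2 ι) : f (sdist p e) = sdist (fun q => f (p q)) e := by
  induction e with
  | _ u t => simp

/-- The coordinates away from the vertex `v`, with junk value `0` at `v`. -/
noncomputable def coordsAway (F : Type*) {L ι : Type*} [Field F] [Field L] [Algebra F L]
    (p : ι × Fin 2 → L) (v : ι) :
    ι × Fin 2 → IntermediateField.adjoin F (p '' {q | q.1 ≠ v}) :=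
  fun q => if h : q.1 ≠ v then ⟨p q, IntermediateField.subset_adjoin _ _ ⟨q, h, rfl⟩⟩ else 0

omit [CharZero F] in
theorem coe_coordsAway {v u : ι} (h : u ≠ v) (i : Fin 2) :
    ((coordsAway F p v (u, i) : IntermediateField.adjoin F (p '' {q | q.1 ≠ v})) : L) = p (u, i) := by
  simp [coordsAway, h]

omit [CharZero F] in
theorem coe_sdist_coordsAway {v : ι} {e : Sym2 ι} (h : v ∉ e) :
    ((sdist (coordsAway F p v) e : IntermediateField.adjoin F (p '' {q | q.1 ≠ v})) : L) =
      sdist p e := by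
  induction e with
  | _ u t =>
    simp only [Sym2.mem_iff, not_or] at h
    simp [coe_coordsAway (Ne.symm h.1), coe_coordsAway (Ne.symm h.2)]

theorem algebraicIndependent_finset_iff {κ : Type*} {S : Finset κ} {d : κ → L} :
    AlgebraicIndependent F (fun e : S => d e) ↔ ∀ a : κ → L,
      (∀ Δ : Derivation F L L, ∑ e ∈ S, a e * Δ (d e) = 0) → ∀ e ∈ S, a e = 0 := by
  constructor
  · intro h a ha e he
    obtain ⟨Δ, hΔ⟩ := exists_derivation_of_algebraicIndependent h (Pi.single ⟨e, he⟩ 1)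
    rw [← ha Δ, ← Finset.sum_coe_sort, Finset.sum_congr rfl fun x _ => by rw [hΔ x]]
    simp [Pi.single_apply]
  · intro h
    refine algebraicIndependent_of_derivations fun a ha => funext fun e => ?_
    have := h (fun x => if hx : x ∈ S then a ⟨x, hx⟩ else 0) (fun Δ => ?_) e e.2
    · simpa using this
    · rw [← ha Δ, ← Finset.sum_coe_sort]
      exact Finset.sum_congr rfl fun x _ => by simp

/-- One half of Laman's theorem: the squared distances along a sparse graph are algebraically
independent. -/
theorem EdgeSparse.algebraicIndependent (hp : AlgebraicIndependent F p) {E : Finset (Sym2 ι)}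
    (hE : EdgeSparse E) : AlgebraicIndependent F (fun e : E => sdist p e) := by
  suffices H : ∀ n, ∀ W : Finset ι, W.card = n → ∀ E : Finset (Sym2 ι), E ⊆ W.sym2 → EdgeSparse E →
      AlgebraicIndependent F (fun e : E => sdist p e) by
    refine H _ (E.biUnion fun e => e.toFinset) rfl E (fun e he => ?_) hE
    rw [Finset.mem_sym2_iff]
    exact fun a ha => Finset.mem_biUnion.2 ⟨e, he, Sym2.mem_toFinset.2 ha⟩
  intro n
  induction n with
  | zero =>
    intro W hW E hEW _
    obtain rfl := Finset.card_eq_zero.1 hW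
    simp only [Finset.sym2_empty, Finset.subset_empty] at hEW
    subst hEW
    rw [algebraicIndependent_finset_iff]
    simp
  | succ n ih =>
    intro W hW E hEW hE
    obtain ⟨v, hvW, hdeg⟩ := hE.exists_degree_le (Finset.card_pos.1 (by omega)) hEW
    have hW' : (W.erase v).card = n := by rw [Finset.card_erase_of_mem hvW]; omega
    set R := E.filter (v ∉ ·) with hR
    have hRW : R ⊆ (W.erase v).sym2 := by
      intro e he
      rw [Finset.mem_filter] at he
      rw [Finset.mem_sym2_iff]
      refine fun a ha => Finset.mem_erase.2 ⟨?_, Finset.mem_sym2_iff.1 (hEW he.1) a ha⟩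
      rintro rfl
      exact he.2 ha
    have hRi := ih _ hW' R hRW (hE.mono (Finset.filter_subset _ _))
    have hRB : ∀ e ∈ R, v ∉ e := fun e he => (Finset.mem_filter.1 he).2
    rw [algebraicIndependent_finset_iff] at hRi ⊢
    intro a ha
    have hsplit : ∀ f : Sym2 ι → L, ∑ e ∈ E.filter (v ∈ ·), f e + ∑ e ∈ R, f e = ∑ e ∈ E, f e :=
      fun f => Finset.sum_filter_add_sum_filter_not _ _ _
    suffices hstar : ∀ e ∈ E.filter (v ∈ ·), a e = 0 by
      intro e he
      by_cases hev : v ∈ e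
      · exact hstar e (Finset.mem_filter.2 ⟨he, hev⟩)
      · refine hRi a (fun Δ => ?_) e (Finset.mem_filter.2 ⟨he, hev⟩)
        rw [← ha Δ, ← hsplit, Finset.sum_eq_zero (s := E.filter (v ∈ ·)) fun e he => by
          rw [hstar e he, zero_mul], zero_add]
    set B := IntermediateField.adjoin F (p '' {q | q.1 ≠ v}) with hB
    have hh := hp.vertex v
    -- the neighbours of `v`
    set N := W.filter (fun u => s(v, u) ∈ E) with hN
    have hNv : ∀ u ∈ N, u ≠ v := by
      rintro u hu rfl
      exact hE.1 _ (Finset.mem_filter.1 hu).2 (by simp)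
    have hstarN : E.filter (v ∈ ·) = N.image (s(v, ·)) := by
      ext e
      simp only [Finset.mem_filter, Finset.mem_image, hN]
      constructor
      · rintro ⟨he, u, rfl⟩
        exact ⟨u, ⟨(Finset.mk_mem_sym2_iff.1 (hEW he)).2, he⟩, rfl⟩
      · rintro ⟨u, ⟨-, hu⟩, rfl⟩
        exact ⟨hu, by simp⟩
    have hinj : Set.InjOn (s(v, ·)) (N : Set ι) := by
      intro u hu t _ hut
      simpa [(hNv u hu)] using hut
    rw [hstarN, Finset.card_image_of_injOn hinj] at hdeg
    simp only [hstarN, Finset.sum_image hinj] at hsplit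
    suffices hstar : ∀ u ∈ N, a s(v, u) = 0 by
      intro e he
      rw [hstarN] at he
      obtain ⟨u, hu, rfl⟩ := Finset.mem_image.1 he
      exact hstar u hu
    have key : ∀ Δ : Derivation F L L, (∀ e ∈ R, Δ (sdist p e) = 0) →
        ∑ u ∈ N, a s(v, u) * Δ (sdist p s(v, u)) = 0 := by
      intro Δ hΔ
      rw [← ha Δ, ← hsplit, Finset.sum_eq_zero (s := R) fun e he => by rw [hΔ e he, mul_zero],
        add_zero]
    have keyB : ∀ Δ : Derivation F L L, (∀ b : B, Δ (algebraMap B L b) = 0) →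
        ∑ u ∈ N, a s(v, u) * Δ (sdist p s(v, u)) = 0 := by
      intro Δ hΔ
      refine key Δ fun e he => ?_
      rw [← coe_sdist_coordsAway (F := F) (hRB e he)]
      exact hΔ _
    obtain ⟨D, hD, hD1⟩ := exists_derivation_extending (0 : Derivation F B B) hh ![1, 0]
    obtain ⟨D', hD', hD1'⟩ := exists_derivation_extending (0 : Derivation F B B) hh ![0, 1]
    have hcoord : ∀ u ∈ N, ∀ i, algebraMap B L (coordsAway F p v (u, i)) = p (u, i) :=
      fun u hu i => coe_coordsAway (hNv u hu) i
    have hDp : ∀ u ∈ N, ∀ i, D (p (u, i)) = 0 := by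
      intro u hu i
      rw [← hcoord u hu, hD]
      simp
    have hDp' : ∀ u ∈ N, ∀ i, D' (p (u, i)) = 0 := by
      intro u hu i
      rw [← hcoord u hu, hD']
      simp
    have hD10 := hD1 0
    have hD11 := hD1 1
    have hD10' := hD1' 0
    have hD11' := hD1' 1
    simp only [Matrix.cons_val] at hD10 hD11 hD10' hD11'
    have e1 : ∑ u ∈ N, a s(v, u) * (p (v, 1) - p (u, 1)) = 0 := by
      rw [← keyB D fun b => by rw [hD]; simp]
      refine Finset.sum_congr rfl fun u hu => ?_
      simp [Derivation.leibniz, hDp u hu, hD10, hD11]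
    have e2 : ∑ u ∈ N, a s(v, u) * (p (v, 0) - p (u, 0)) = 0 := by
      rw [← keyB D' fun b => by rw [hD']; simp]
      refine Finset.sum_congr rfl fun u hu => ?_
      simp [Derivation.leibniz, hDp' u hu, hD10', hD11']
    rcases Nat.lt_or_ge N.card 3 with hlt | hge
    · interval_cases hc : N.card
      · simp [Finset.card_eq_zero.1 hc]
      · obtain ⟨u, hu⟩ := Finset.card_eq_one.1 hc
        rw [hu, Finset.sum_singleton] at e1
        rw [hu]
        intro t ht
        rw [Finset.mem_singleton.1 ht]
        exact (mul_eq_zero.1 e1).resolve_right (hp.coord_ne (hNv u (by simp [hu])).symm 1)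
      · obtain ⟨u, t, hut, hN2⟩ := Finset.card_eq_two.1 hc
        rw [hN2, Finset.sum_pair hut] at e1 e2
        have hne := hp.det_ne_zero hut (hNv u (by simp [hN2])) (hNv t (by simp [hN2]))
        have h1 : a s(v, u) = 0 := by
          refine (mul_eq_zero.1 (?_ : _ * a s(v, u) = 0)).resolve_left hne
          linear_combination (p (v, 1) - p (t, 1)) * e2 - (p (v, 0) - p (t, 0)) * e1
        have h2 : a s(v, t) = 0 := by
          refine (mul_eq_zero.1 (?_ : _ * a s(v, t) = 0)).resolve_left hne
          linear_combination (p (v, 0) - p (u, 0)) * e1 - (p (v, 1) - p (u, 1)) * e2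
        intro x hx
        rw [hN2] at hx
        simp only [Finset.mem_insert, Finset.mem_singleton] at hx
        rcases hx with rfl | rfl <;> assumption
    · obtain ⟨n, hninj, hNn, hnotR, hins⟩ := hE.exists_insert_edge_card_eq_three (v := v)
        (le_antisymm hdeg hge) hNv fun u hu => (Finset.mem_filter.1 hu).2
      have hmem : ∀ i, n i ∈ N := fun i => by rw [hNn]; exact Finset.mem_image_of_mem _ (by simp)
      have hsum : ∀ f : ι → L, ∑ u ∈ N, f u = ∑ i, f (n i) := fun f => by
        rw [hNn, Finset.sum_image fun i _ j _ h => hninj h]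
      have hi := ih _ hW' _ (Finset.insert_subset (Finset.mk_mem_sym2_iff.2
        ⟨Finset.mem_erase.2 ⟨hNv _ (hmem 0), (Finset.mem_filter.1 (hmem 0)).1⟩,
          Finset.mem_erase.2 ⟨hNv _ (hmem 1), (Finset.mem_filter.1 (hmem 1)).1⟩⟩) hRW) hins
      have hiB : AlgebraicIndependent F (fun e : (insert s(n 0, n 1) R : Finset (Sym2 ι)) =>
          sdist (coordsAway F p v) e.1) := by
        rw [← AlgHom.algebraicIndependent_iff (IsScalarTower.toAlgHom F B L)
          (algebraMap B L).injective]
        convert hi using 2 with e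
        refine coe_sdist_coordsAway ?_
        rcases Finset.mem_insert.1 e.2 with he | he
        · rw [he]
          simp [(hNv _ (hmem 0)).symm, (hNv _ (hmem 1)).symm]
        · exact hRB _ he
      obtain ⟨δ, hδ⟩ := exists_derivation_of_algebraicIndependent hiB
        (Pi.single ⟨s(n 0, n 1), Finset.mem_insert_self _ _⟩ 1)
      have hcn : ∀ i j, algebraMap B L (coordsAway F p v (n i, j)) = p (n i, j) :=
        fun i j => hcoord _ (hmem i) j
      have h0 := henneberg_two (k := F) (B := B) (L := L)
        (z := fun i => coordsAway F p v (n i, 0)) (w := fun i => coordsAway F p v (n i, 1))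
        (δ := δ) (a := fun i => a s(v, n i)) ?_ hh ?_ ?_ ?_
      · intro u hu
        rw [hNn] at hu
        obtain ⟨i, -, rfl⟩ := Finset.mem_image.1 hu
        exact congrFun h0 i
      · intro h
        refine hp.det_ne_zero (hninj.ne (show (0 : Fin 3) ≠ 1 by decide))
          (hninj.ne (show (0 : Fin 3) ≠ 2 by decide)) (hninj.ne (show (1 : Fin 3) ≠ 2 by decide)) ?_
        simpa only [map_sub, map_mul, hcn, map_zero] using congrArg (algebraMap B L) h
      · exact (hδ ⟨s(n 0, n 1), Finset.mem_insert_self _ _⟩).trans (Pi.single_eq_same _ _)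
      · intro Δ hΔ
        rw [← keyB Δ hΔ, hsum]
        refine Finset.sum_congr rfl fun i _ => ?_
        rw [hcn, hcn]
        rfl
      · intro Δ hΔ
        rw [← key Δ, hsum]
        · refine Finset.sum_congr rfl fun i _ => ?_
          rw [hcn, hcn]
          rfl
        · intro e he
          have h1 := hΔ (sdist (coordsAway F p v) e)
          rw [hδ ⟨e, Finset.mem_insert_of_mem he⟩, Pi.single_eq_of_ne, map_zero] at h1
          · rw [← h1]
            exact congrArg Δ (coe_sdist_coordsAway (hRB e he)).symm
          · intro h
            rw [Subtype.mk.injEq] at h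
            exact hnotR (h ▸ he)

end Laman

end

section

section Fan

variable {ι : Type*}

/-- A Laman graph on `V` with base edge `{a, b}`: every other vertex is joined to `a` and `b`. -/
noncomputable def fan (a b : ι) (V : Finset ι) : Finset (Sym2 ι) :=
  insert s(a, b) ((V \ {a, b}).image (s(a, ·)) ∪ (V \ {a, b}).image (s(b, ·)))

theorem mem_fan {a b : ι} {V : Finset ι} {e : Sym2 ι} : e ∈ fan a b V ↔ e = s(a, b) ∨
    ∃ u ∈ V, u ≠ a ∧ u ≠ b ∧ (e = s(a, u) ∨ e = s(b, u)) := by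
  simp only [fan, Finset.mem_insert, Finset.mem_union, Finset.mem_image, Finset.mem_sdiff,
    Finset.mem_singleton, not_or]
  grind

theorem card_fan_le {a b : ι} {V : Finset ι} (ha : a ∈ V) (hb : b ∈ V) (hab : a ≠ b) :
    (fan a b V).card ≤ 2 * V.card - 3 := by
  have h1 := Finset.card_insert_le s(a, b) ((V \ {a, b}).image (s(a, ·)) ∪
    (V \ {a, b}).image (s(b, ·)))
  have h2 := Finset.card_union_le ((V \ {a, b}).image (s(a, ·))) ((V \ {a, b}).image (s(b, ·)))
  have h3 := Finset.card_image_le (s := V \ {a, b}) (f := (s(a, ·)))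
  have h4 := Finset.card_image_le (s := V \ {a, b}) (f := (s(b, ·)))
  have h5 := Finset.card_sdiff_add_card_eq_card (s := {a, b}) (t := V)
    (Finset.insert_subset ha (Finset.singleton_subset_iff.2 hb))
  rw [Finset.card_pair hab] at h5
  rw [← fan] at h1
  omega

theorem fan_not_isDiag {a b : ι} {V : Finset ι} (hab : a ≠ b) : ∀ e ∈ fan a b V, ¬ e.IsDiag := by
  intro e he
  rcases mem_fan.1 he with rfl | ⟨u, -, h1, h2, rfl | rfl⟩
  · simpa using hab
  · simpa using h1.symm
  · simpa using h2.symm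

theorem card_fan_inter_le {a b : ι} {V : Finset ι} (ha : a ∈ V) (hb : b ∈ V) (hab : a ≠ b)
    (X : Finset ι) : (fan a b V ∩ X.sym2).card ≤ 2 * (V ∩ X).card - 3 := by
  have hone : ∀ c, c ∈ V → c ∈ X → fan a b V ∩ X.sym2 ⊆ ((V ∩ X).erase c).image (s(c, ·)) →
      (fan a b V ∩ X.sym2).card ≤ 2 * (V ∩ X).card - 3 := by
    intro c hcV hcX h
    have h1 := Finset.card_le_card h
    have h2 := Finset.card_image_le (s := (V ∩ X).erase c) (f := (s(c, ·)))
    have hc : c ∈ V ∩ X := Finset.mem_inter.2 ⟨hcV, hcX⟩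
    rw [Finset.card_erase_of_mem hc] at h2
    have := Finset.card_pos.2 ⟨c, hc⟩
    omega
  by_cases haX : a ∈ X
  · by_cases hbX : b ∈ X
    · refine (Finset.card_le_card fun e he => ?_).trans (card_fan_le (V := V ∩ X)
        (Finset.mem_inter.2 ⟨ha, haX⟩) (Finset.mem_inter.2 ⟨hb, hbX⟩) hab)
      rw [Finset.mem_inter, mem_fan] at he
      rw [mem_fan]
      obtain ⟨he | ⟨u, hu, h1, h2, h3⟩, hX⟩ := he
      · exact Or.inl he
      · refine Or.inr ⟨u, Finset.mem_inter.2 ⟨hu, ?_⟩, h1, h2, h3⟩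
        rcases h3 with rfl | rfl <;> exact (Finset.mk_mem_sym2_iff.1 hX).2
    · refine hone a ha haX fun e he => ?_
      rw [Finset.mem_inter, mem_fan] at he
      obtain ⟨rfl | ⟨u, hu, h1, h2, rfl | rfl⟩, hX⟩ := he <;> rw [Finset.mk_mem_sym2_iff] at hX
      · exact absurd hX.2 hbX
      · exact Finset.mem_image.2 ⟨u, by simp [*], rfl⟩
      · exact absurd hX.1 hbX
  · by_cases hbX : b ∈ X
    · refine hone b hb hbX fun e he => ?_
      rw [Finset.mem_inter, mem_fan] at he
      obtain ⟨rfl | ⟨u, hu, h1, h2, rfl | rfl⟩, hX⟩ := he <;> rw [Finset.mk_mem_sym2_iff] at hX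
      · exact absurd hX.1 haX
      · exact absurd hX.1 haX
      · exact Finset.mem_image.2 ⟨u, by simp [*], rfl⟩
    · rw [Finset.card_eq_zero.2]
      · omega
      rw [Finset.eq_empty_iff_forall_notMem]
      intro e he
      rw [Finset.mem_inter, mem_fan] at he
      obtain ⟨rfl | ⟨u, hu, h1, h2, rfl | rfl⟩, hX⟩ := he <;> rw [Finset.mk_mem_sym2_iff] at hX
      · exact haX hX.1
      · exact haX hX.1
      · exact hbX hX.1

end Fan

section Body

variable {ι F L : Type*} [Field F] [Field L] [Algebra F L]

/-- The invariants of a body with vertex set `V`. -/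
def bodyGen {R : Type*} [CommRing R] (p : ι × Fin 2 → R) (V : Finset ι) : Set R :=
  {x | ∃ u ∈ V, ∃ t ∈ V, ∃ u' ∈ V, ∃ t' ∈ V,
    x = (p (u, 0) - p (t, 0)) * (p (u', 1) - p (t', 1))}

theorem bodyGen_mono {R : Type*} [CommRing R] (p : ι × Fin 2 → R) {V V' : Finset ι} (h : V ⊆ V') :
    bodyGen p V ⊆ bodyGen p V' := by
  rintro x ⟨u, hu, t, ht, u', hu', t', ht', rfl⟩
  exact ⟨u, h hu, t, h ht, u', h hu', t', h ht', rfl⟩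

theorem sdist_mem_bodyGen {R : Type*} [CommRing R] (p : ι × Fin 2 → R) {V : Finset ι} {u t : ι}
    (hu : u ∈ V) (ht : t ∈ V) : sdist p s(u, t) ∈ bodyGen p V :=
  ⟨u, hu, t, ht, u, hu, t, ht, rfl⟩

theorem bodyGen_eq_zero_of_card_le_one {R : Type*} [CommRing R] (p : ι × Fin 2 → R) {V : Finset ι}
    (hV : V.card ≤ 1) {x : R} (hx : x ∈ bodyGen p V) : x = 0 := by
  obtain ⟨u, hu, t, ht, u', hu', t', ht', rfl⟩ := hx
  rw [Finset.card_le_one.1 hV u hu t ht]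
  simp

/-- The generators of the invariants of a body, relative to a base. -/
theorem bodyGen_mul_base {R : Type*} [CommRing R] (p : ι × Fin 2 → R) (a b u t u' t' : ι) :
    (p (u, 0) - p (t, 0)) * (p (u', 1) - p (t', 1)) * sdist p s(b, a) =
      ((p (u, 0) - p (a, 0)) * (p (b, 1) - p (a, 1)) - (p (t, 0) - p (a, 0)) * (p (b, 1) - p (a, 1))) *
      ((p (u', 1) - p (a, 1)) * (p (b, 0) - p (a, 0)) -
        (p (t', 1) - p (a, 1)) * (p (b, 0) - p (a, 0))) := by
  simp only [sdist_mk]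
  ring

/-- A derivation that vanishes on the edges of a fan vanishes on the invariants of the body. -/
theorem derivation_bodyGen_eq_zero [CharZero F] {p : ι × Fin 2 → L} (hp : AlgebraicIndependent F p)
    {a b : ι} {V : Finset ι} (hab : a ≠ b) (Δ : Derivation F L L)
    (hΔ : ∀ e ∈ fan a b V, Δ (sdist p e) = 0) {x : L} (hx : x ∈ bodyGen p V) : Δ x = 0 := by
  have hd : sdist p s(b, a) ≠ 0 := mul_ne_zero (hp.coord_ne hab.symm 0) (hp.coord_ne hab.symm 1)
  have hΔd : Δ (sdist p s(b, a)) = 0 := by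
    rw [Sym2.eq_swap]
    exact hΔ _ (mem_fan.2 (Or.inl rfl))
  have key : ∀ u ∈ V, Δ ((p (u, 0) - p (a, 0)) * (p (b, 1) - p (a, 1))) = 0 ∧
      Δ ((p (u, 1) - p (a, 1)) * (p (b, 0) - p (a, 0))) = 0 := by
    intro u hu
    by_cases hua : u = a
    · subst hua
      simp
    by_cases hub : u = b
    · subst hub
      rw [mul_comm (p (u, 1) - p (a, 1))]
      exact ⟨hΔd, hΔd⟩
    have h1 := hΔ _ (mem_fan.2 (Or.inr ⟨u, hu, hua, hub, Or.inl rfl⟩))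
    have h2 := hΔ _ (mem_fan.2 (Or.inr ⟨u, hu, hua, hub, Or.inr rfl⟩))
    set X := (p (u, 0) - p (a, 0)) * (p (b, 1) - p (a, 1)) with hX
    set Y := (p (u, 1) - p (a, 1)) * (p (b, 0) - p (a, 0)) with hY
    set d := sdist p s(b, a) with hdd
    have h3 : X * Y = d * sdist p s(a, u) := by
      simp only [hX, hY, hdd, sdist_mk]
      ring
    have h4 : (X - d) * (Y - d) = d * sdist p s(b, u) := by
      simp only [hX, hY, hdd, sdist_mk]
      ring
    have h5 := congrArg Δ h3
    have h6 := congrArg Δ h4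
    simp only [Derivation.leibniz, map_sub, h1, h2, hΔd, smul_eq_mul, mul_zero, add_zero,
      sub_zero] at h5 h6
    have h7 : Δ X + Δ Y = 0 := by
      refine (mul_eq_zero.1 (?_ : d * (Δ X + Δ Y) = 0)).resolve_left hd
      linear_combination h5 - h6
    have hXY : X - Y ≠ 0 := by
      have := hp.det_ne_zero (Ne.symm hua) hab hub
      intro h
      apply this
      rw [← h]
      ring
    have h8 : Δ X = 0 := by
      refine (mul_eq_zero.1 (?_ : (X - Y) * Δ X = 0)).resolve_left hXY
      linear_combination X * h7 - h5
    exact ⟨h8, by linear_combination h7 - h8⟩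
  obtain ⟨u, hu, t, ht, u', hu', t', ht', rfl⟩ := hx
  have h1 := congrArg Δ (bodyGen_mul_base p a b u t u' t')
  rw [Δ.leibniz (_ * _) (sdist _ _), Δ.leibniz (_ * _ - _) (_ * _ - _), hΔd, map_sub (f := Δ) (_ * _),
    map_sub (f := Δ) (_ * _), (key u hu).1, (key t ht).1,
    (key u' hu').2, (key t' ht').2] at h1
  rw [sub_zero, smul_zero, smul_zero, smul_zero, add_zero, zero_add, smul_eq_mul] at h1
  exact (mul_eq_zero.1 h1).resolve_left hd

variable {J : Type*}

/-- The field of invariants of a system of bodies. -/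
noncomputable def bodyField (F : Type*) {L ι J : Type*} [Field F] [Field L] [Algebra F L]
    (p : ι × Fin 2 → L) (𝒱 : J → Finset ι) : IntermediateField F L :=
  IntermediateField.adjoin F (⋃ j, bodyGen p (𝒱 j))

theorem mem_bodyField (p : ι × Fin 2 → L) {𝒱 : J → Finset ι} (j : J) {x : L}
    (hx : x ∈ bodyGen p (𝒱 j)) : x ∈ bodyField F p 𝒱 :=
  IntermediateField.subset_adjoin _ _ (Set.mem_iUnion.2 ⟨j, hx⟩)

theorem bodyField_le {p : ι × Fin 2 → L} {𝒱 : J → Finset ι} {K : IntermediateField F L}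
    (h : ∀ j, bodyGen p (𝒱 j) ⊆ K) : bodyField F p 𝒱 ≤ K :=
  IntermediateField.adjoin_le_iff.2 (Set.iUnion_subset h)

/-- The number of constraints that a system of bodies imposes on the vertices in `X`. -/
noncomputable def bodyCount [Fintype J] (𝒱 : J → Finset ι) (X : Finset ι) : ℕ := ∑ j, (2 * (𝒱 j ∩ X).card - 3)

/-- There is a set of edges spanning the bodies. -/
theorem exists_fans [Fintype J] (𝒱 : J → Finset ι) : ∃ E : Finset (Sym2 ι),
    (∀ e ∈ E, ¬ e.IsDiag) ∧ (∀ X : Finset ι, (E ∩ X.sym2).card ≤ bodyCount 𝒱 X) ∧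
    (∀ e ∈ E, ∃ j, e ∈ (𝒱 j).sym2) ∧ E.card ≤ ∑ j, (2 * (𝒱 j).card - 3) ∧
    ∀ (F L : Type _) [Field F] [Field L] [Algebra F L] [CharZero F] (p : ι × Fin 2 → L),
      AlgebraicIndependent F p →
      ∀ Δ : Derivation F L L, (∀ e ∈ E, Δ (sdist p e) = 0) →
        ∀ j, ∀ x ∈ bodyGen p (𝒱 j), Δ x = 0 := by
  have h : ∀ j, ∃ E : Finset (Sym2 ι),
    (∀ e ∈ E, ¬ e.IsDiag) ∧ (∀ X : Finset ι, (E ∩ X.sym2).card ≤ 2 * (𝒱 j ∩ X).card - 3) ∧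
    (∀ e ∈ E, e ∈ (𝒱 j).sym2) ∧ E.card ≤ 2 * (𝒱 j).card - 3 ∧
    ∀ (F L : Type _) [Field F] [Field L] [Algebra F L] [CharZero F] (p : ι × Fin 2 → L),
      AlgebraicIndependent F p →
      ∀ Δ : Derivation F L L, (∀ e ∈ E, Δ (sdist p e) = 0) → ∀ x ∈ bodyGen p (𝒱 j), Δ x = 0 := by
    intro j
    rcases Nat.lt_or_ge 1 (𝒱 j).card with h | h
    · obtain ⟨a, ha, b, hb, hab⟩ := Finset.one_lt_card.1 h
      refine ⟨fan a b (𝒱 j), fan_not_isDiag hab, card_fan_inter_le ha hb hab, ?_,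
        card_fan_le ha hb hab, fun F L _ _ _ _ p hp Δ hΔ x hx =>
          derivation_bodyGen_eq_zero hp hab Δ hΔ hx⟩
      intro e he
      rcases mem_fan.1 he with rfl | ⟨u, hu, -, -, rfl | rfl⟩ <;> simp [*]
    · exact ⟨∅, by simp, by simp, by simp, by simp, fun F L _ _ _ _ p hp Δ hΔ x hx => by
        rw [bodyGen_eq_zero_of_card_le_one p h hx, map_zero]⟩
  choose E h1 h2 h3 h4 h5 using h
  refine ⟨Finset.univ.biUnion E, ?_, ?_, ?_, ?_, ?_⟩
  · intro e he
    obtain ⟨j, -, he⟩ := Finset.mem_biUnion.1 he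
    exact h1 j e he
  · intro X
    rw [Finset.biUnion_inter]
    exact Finset.card_biUnion_le.trans (Finset.sum_le_sum fun j _ => h2 j X)
  · intro e he
    obtain ⟨j, -, he⟩ := Finset.mem_biUnion.1 he
    exact ⟨j, h3 j e he⟩
  · exact Finset.card_biUnion_le.trans (Finset.sum_le_sum fun j _ => h4 j)
  · intro F L _ _ _ _ p hp Δ hΔ j x hx
    exact h5 j F L p hp Δ (fun e he => hΔ e (Finset.mem_biUnion.2 ⟨j, by simp, he⟩)) x hx

end Body

end

section

section Body

variable {ι F L : Type*} [Field F] [Field L] [Algebra F L] {J : Type*} [Fintype J]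

theorem bodyCount_eq_zero {𝒱 : J → Finset ι} {X : Finset ι} (hX : X.card ≤ 1) :
    bodyCount 𝒱 X = 0 := by
  refine Finset.sum_eq_zero fun j _ => ?_
  have := Finset.card_le_card (Finset.inter_subset_right (s₁ := 𝒱 j) (s₂ := X))
  omega

/-- Two pairs of vertices have algebraically independent distances over the invariants. -/
theorem algebraicIndependent_sdist_pair [CharZero F] {p : ι × Fin 2 → L}
    (hp : AlgebraicIndependent F p) {𝒱 : J → Finset ι}
    (hf : ∀ X : Finset ι, 2 ≤ X.card → bodyCount 𝒱 X + 3 ≤ 2 * X.card) {x y z : ι} (hxy : x ≠ y)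
    (hxz : x ≠ z) (hyz : y ≠ z)
    (h1 : ∀ X : Finset ι, x ∈ X → y ∈ X → bodyCount 𝒱 X + 4 ≤ 2 * X.card)
    (h2 : ∀ X : Finset ι, x ∈ X → z ∈ X → bodyCount 𝒱 X + 4 ≤ 2 * X.card)
    (h3 : ∀ X : Finset ι, x ∈ X → y ∈ X → z ∈ X → bodyCount 𝒱 X + 5 ≤ 2 * X.card) :
    AlgebraicIndependent (bodyField F p 𝒱) ![sdist p s(x, y), sdist p s(x, z)] := by
  obtain ⟨E, hE1, hE2, -, -, hE3⟩ := exists_fans 𝒱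
  have hnot : ∀ {u t : ι}, (∀ X : Finset ι, u ∈ X → t ∈ X → bodyCount 𝒱 X + 4 ≤ 2 * X.card) →
      s(u, t) ∉ E := by
    intro u t h hmem
    have h1 := h {u, t} (by simp) (by simp)
    have h2 : 0 < (E ∩ ({u, t} : Finset ι).sym2).card :=
      Finset.card_pos.2 ⟨s(u, t), by simp [hmem]⟩
    have h3 := Finset.card_le_two (a := u) (b := t)
    have := hE2 {u, t}
    omega
  have hE : EdgeSparse E := ⟨hE1, fun X hX => by have := hE2 X; have := hf X hX; omega⟩
  have hE' : EdgeSparse (insert s(x, y) E) :=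
    hE.insert_edge hxy fun X hx hy => by have := hE2 X; have := h1 X hx hy; omega
  have hE'' : EdgeSparse (insert s(x, z) (insert s(x, y) E)) := by
    refine hE'.insert_edge hxz fun X hx hz => ?_
    have := hE2 X
    by_cases hy : y ∈ X
    · have := h3 X hx hy hz
      rw [Finset.insert_inter_of_mem (by simp [hx, hy])]
      have := Finset.card_insert_le s(x, y) (E ∩ X.sym2)
      omega
    · have := h2 X hx hz
      rw [Finset.insert_inter_of_notMem (by simp [hy])]
      omega
  have hder : ∀ v : Fin 2 → L, ∃ Δ : Derivation (bodyField F p 𝒱) L L,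
      Δ (sdist p s(x, y)) = v 0 ∧ Δ (sdist p s(x, z)) = v 1 := by
    intro v
    obtain ⟨Δ, hΔ⟩ := exists_derivation_of_algebraicIndependent (hE''.algebraicIndependent hp)
      (fun e => if e.1 = s(x, y) then v 0 else if e.1 = s(x, z) then v 1 else 0)
    refine ⟨Δ.overAdjoin _ ?_, ?_, ?_⟩
    · intro t ht
      obtain ⟨j, hj⟩ := Set.mem_iUnion.1 ht
      refine hE3 F L p hp Δ (fun e he => ?_) j t hj
      rw [hΔ ⟨e, by simp [he]⟩, if_neg, if_neg]
      · rintro rfl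
        exact hnot h2 he
      · rintro rfl
        exact hnot h1 he
    · refine (hΔ ⟨s(x, y), by simp⟩).trans ?_
      simp
    · refine (hΔ ⟨s(x, z), by simp⟩).trans ?_
      rw [if_neg, if_pos rfl]
      rw [Sym2.eq_iff]
      rintro (⟨-, h⟩ | ⟨h, -⟩)
      · exact hyz h.symm
      · exact hxy h
  refine algebraicIndependent_of_derivations fun a ha => ?_
  obtain ⟨Δ, e1, e2⟩ := hder ![1, 0]
  obtain ⟨Δ', e1', e2'⟩ := hder ![0, 1]
  have h4 := ha Δ
  have h5 := ha Δ'
  rw [Fin.sum_univ_two] at h4 h5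
  simp only [Matrix.cons_val, e1, e2, e1', e2'] at h4 h5
  funext i
  fin_cases i
  · simpa using h4
  · simpa using h5

/-- Sparsity of a system of bodies. -/
def BodySparse (𝒱 : J → Finset ι) : Prop :=
  ∀ X : Finset ι, 2 ≤ X.card → bodyCount 𝒱 X + 3 ≤ 2 * X.card ∧
    ((∀ j, ¬ X ⊆ 𝒱 j) → bodyCount 𝒱 X + 4 ≤ 2 * X.card)

omit [Fintype J] in
theorem erase_inter_eq (𝒱 : J → Finset ι) (v : ι) (X : Finset ι) (j : J) :
    (𝒱 j).erase v ∩ X = 𝒱 j ∩ X.erase v := by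
  rw [Finset.erase_inter, Finset.inter_erase]

theorem bodyCount_erase (𝒱 : J → Finset ι) (v : ι) (X : Finset ι) :
    bodyCount (fun j => (𝒱 j).erase v) X = bodyCount 𝒱 (X.erase v) := by
  simp only [bodyCount, erase_inter_eq]

theorem bodyCount_mono (𝒱 : J → Finset ι) {X Y : Finset ι} (h : X ⊆ Y) :
    bodyCount 𝒱 X ≤ bodyCount 𝒱 Y := by
  refine Finset.sum_le_sum fun j _ => ?_
  have := Finset.card_le_card (Finset.inter_subset_inter (subset_refl (𝒱 j)) h)
  omega

theorem BodySparse.erase {𝒱 : J → Finset ι} (h𝒱 : BodySparse 𝒱) (v : ι) :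
    BodySparse fun j => (𝒱 j).erase v := by
  intro X hX
  rw [bodyCount_erase]
  have h1 := bodyCount_mono 𝒱 (Finset.erase_subset v X)
  refine ⟨by have := (h𝒱 X hX).1; omega, fun h => ?_⟩
  by_cases hv : v ∈ X
  · have h2 := Finset.card_erase_of_mem hv
    rcases Nat.lt_or_ge 1 (X.erase v).card with h3 | h3
    · have := (h𝒱 _ h3).1
      omega
    · rw [bodyCount_eq_zero h3]
      omega
  · rw [Finset.erase_eq_of_notMem hv]
    exact (h𝒱 X hX).2 fun j hj => h j (Finset.subset_erase.2 ⟨hj, hv⟩)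

/-- A vertex met by few bodies. -/
theorem BodySparse.exists_vertex {𝒱 : J → Finset ι} (h𝒱 : BodySparse 𝒱) {W : Finset ι}
    (hW : W.Nonempty) (hVW : ∀ j, 𝒱 j ⊆ W) : ∃ v ∈ W,
      (Finset.univ.filter fun j => v ∈ 𝒱 j ∧ (𝒱 j).card = 2).card +
        2 * (Finset.univ.filter fun j => v ∈ 𝒱 j ∧ 3 ≤ (𝒱 j).card).card ≤ 3 := by
  by_contra! hcon
  rcases Nat.lt_or_ge 1 W.card with h1 | h1
  · have h2 : ∑ v ∈ W, 4 ≤ ∑ v ∈ W, ((Finset.univ.filter fun j => v ∈ 𝒱 j ∧ (𝒱 j).card = 2).card +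
        2 * (Finset.univ.filter fun j => v ∈ 𝒱 j ∧ 3 ≤ (𝒱 j).card).card) :=
      Finset.sum_le_sum fun v hv => hcon v hv
    have h3 : ∑ v ∈ W, ((Finset.univ.filter fun j => v ∈ 𝒱 j ∧ (𝒱 j).card = 2).card +
        2 * (Finset.univ.filter fun j => v ∈ 𝒱 j ∧ 3 ≤ (𝒱 j).card).card) ≤
        ∑ j, 2 * (2 * (𝒱 j).card - 3) := by
      simp only [Finset.card_filter, Finset.mul_sum, ← Finset.sum_add_distrib]
      rw [Finset.sum_comm]
      refine Finset.sum_le_sum fun j _ => ?_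
      have h4 : ∀ v, ((if v ∈ 𝒱 j ∧ (𝒱 j).card = 2 then 1 else 0) +
          2 * (if v ∈ 𝒱 j ∧ 3 ≤ (𝒱 j).card then 1 else 0)) = if v ∈ 𝒱 j then
            ((if (𝒱 j).card = 2 then 1 else 0) + 2 * (if 3 ≤ (𝒱 j).card then 1 else 0)) else 0 := by
        intro v
        by_cases h : v ∈ 𝒱 j <;> simp [h]
      simp only [h4]
      rw [← Finset.sum_filter, Finset.filter_mem_eq_inter, Finset.inter_eq_right.2 (hVW j),
        Finset.sum_const, smul_eq_mul]
      split_ifs <;> omega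
    have h5 := (h𝒱 W h1).1
    have h6 : bodyCount 𝒱 W = ∑ j, (2 * (𝒱 j).card - 3) :=
      Finset.sum_congr rfl fun j _ => by rw [Finset.inter_eq_left.2 (hVW j)]
    rw [← Finset.mul_sum, ← h6] at h3
    simp only [Finset.sum_const, smul_eq_mul] at h2
    omega
  · obtain ⟨v, hv⟩ := hW
    have h2 : ∀ j, (𝒱 j).card ≤ 1 := fun j => (Finset.card_le_card (hVW j)).trans h1
    have h3 := hcon v hv
    rw [Finset.filter_false_of_mem fun j _ h => by have := h2 j; omega,
      Finset.filter_false_of_mem fun j _ h => by have := h2 j; omega] at h3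
    simp at h3

end Body

end

section

section VertexStep

variable {ι F L : Type*} [Field F] [Field L] [Algebra F L]

/-- The field generated by the coordinates away from the vertex `v`. -/
abbrev awayField (F : Type*) {L ι : Type*} [Field F] [Field L] [Algebra F L] (p : ι × Fin 2 → L)
    (v : ι) : IntermediateField F L := IntermediateField.adjoin F (p '' {q | q.1 ≠ v})

theorem mem_adjoin_vertex {p : ι × Fin 2 → L}
    (htop : IntermediateField.adjoin F (Set.range p) = ⊤) (v : ι)
    {K : IntermediateField (awayField F p v) L}
    (hK : ∀ i, p (v, i) ∈ K) (x : L) : x ∈ K := by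
  have h1 : IntermediateField.adjoin F (Set.range p) ≤ K.restrictScalars F := by
    refine IntermediateField.adjoin_le_iff.2 ?_
    rintro _ ⟨⟨u, i⟩, rfl⟩
    by_cases h : u = v
    · subst h
      exact hK i
    · exact K.algebraMap_mem (⟨p (u, i), IntermediateField.subset_adjoin _ _ ⟨(u, i), h, rfl⟩⟩ :
        awayField F p v)
  exact h1 (htop ▸ IntermediateField.mem_top)

variable [CharZero F] {p : ι × Fin 2 → L} (hp : AlgebraicIndependent F p)
  (htop : IntermediateField.adjoin F (Set.range p) = ⊤) {v : ι} {k : IntermediateField F L}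
  (hkB : k ≤ awayField F p v)
  (hk : ∀ x : L, IsAlgebraic k x → x ∈ k)

include hp htop hkB hk

theorem vertex_three_bars {n : Fin 3 → ι} (hn : Function.Injective n) (hv : ∀ i, n i ≠ v)
    (hd : AlgebraicIndependent k ![sdist p s(n 0, n 1), sdist p s(n 0, n 2)])
    (hd' : Transcendental k (sdist p s(n 1, n 2))) {x : L}
    (hx : IsAlgebraic (IntermediateField.adjoin k (Set.range fun i => sdist p s(v, n i))) x) :
    x ∈ IntermediateField.adjoin k (Set.range fun i => sdist p s(v, n i)) := by
  let _ : Algebra k (awayField F p v) :=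
    (IntermediateField.inclusion hkB).toAlgebra
  have : IsScalarTower k (awayField F p v) L :=
    IsScalarTower.of_algebraMap_eq fun _ => rfl
  let z : Fin 3 → awayField F p v :=
    fun i => coordsAway F p v (n i, 0)
  let w : Fin 3 → awayField F p v :=
    fun i => coordsAway F p v (n i, 1)
  have hz : ∀ i, algebraMap (awayField F p v) L (z i) = p (n i, 0) :=
    fun i => coe_coordsAway (hv i) 0
  have hw : ∀ i, algebraMap (awayField F p v) L (w i) = p (n i, 1) :=
    fun i => coe_coordsAway (hv i) 1
  have hdz : ∀ i j, algebraMap (awayField F p v) L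
      (isoDist (z i) (w i) (z j) (w j)) = sdist p s(n i, n j) := by
    intro i j
    simp only [isoDist, map_mul, map_sub, hz, hw, sdist_mk]
  have key : (Set.range fun i => sdist p s(v, n i)) = Set.range fun i =>
      isoDist (p (v, 0)) (p (v, 1)) (algebraMap (awayField F p v) L (z i))
        (algebraMap (awayField F p v) L (w i)) := by
    congr 1
    funext i
    rw [hz, hw]
    rfl
  rw [key] at hx ⊢
  refine three_bars (h := fun i => p (v, i)) ?_ (hp.vertex v) (fun x _ => ?_)
    (fun x hx => (⟨⟨x, hk x hx⟩, rfl⟩ : x ∈ Set.range (algebraMap k L))) ?_ ?_ hx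
  · intro h0
    refine hp.det_ne_zero (hn.ne (show (0 : Fin 3) ≠ 1 by decide))
      (hn.ne (show (0 : Fin 3) ≠ 2 by decide)) (hn.ne (show (1 : Fin 3) ≠ 2 by decide)) ?_
    have := congrArg (algebraMap (awayField F p v) L) h0
    simpa only [map_sub, map_mul, hz, hw, map_zero] using this
  · refine mem_adjoin_vertex htop v (fun i => ?_) x
    exact IntermediateField.subset_adjoin _ _ ⟨i, rfl⟩
  · rw [← AlgHom.algebraicIndependent_iff (IsScalarTower.toAlgHom k
      (awayField F p v) L) (IsScalarTower.toAlgHom k (awayField F p v) L).toRingHom.injective]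
    convert hd using 1
    funext i
    fin_cases i
    · exact hdz 0 1
    · exact hdz 0 2
  · have h := hdz 1 2
    rw [← h] at hd'
    exact (transcendental_algebraMap_iff (algebraMap (awayField F p v) L).injective).1 hd'

omit htop hkB hk in
theorem algebraicIndependent_vertex_body {a b : ι} (hab : a ≠ b) (ha : a ≠ v) (hb : b ≠ v) :
    AlgebraicIndependent (awayField F p v) ![(p (v, 0) - p (a, 0)) * (p (b, 1) - p (a, 1)),
        (p (v, 1) - p (a, 1)) * (p (b, 0) - p (a, 0))] := by
  have hc : ∀ (Δ : Derivation (awayField F p v) L L) (u : ι) (i : Fin 2), u ≠ v →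
      Δ (p (u, i)) = 0 := fun Δ u i hu =>
    Δ.map_algebraMap (⟨p (u, i), IntermediateField.subset_adjoin _ _ ⟨(u, i), hu, rfl⟩⟩ :
        awayField F p v)
  refine algebraicIndependent_of_derivations fun c hc' => ?_
  obtain ⟨D₁, h1⟩ := exists_derivation_of_algebraicIndependent (hp.vertex v) ![1, 0]
  obtain ⟨D₂, h2⟩ := exists_derivation_of_algebraicIndependent (hp.vertex v) ![0, 1]
  have e1 := hc' D₁
  have e2 := hc' D₂
  have h10 := h1 0
  have h11 := h1 1
  have h20 := h2 0
  have h21 := h2 1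
  simp only [Matrix.cons_val] at h10 h11 h20 h21
  simp [Fin.sum_univ_two, Derivation.leibniz, h10, h11, hc _ _ _ ha, hc _ _ _ hb,
    hp.coord_ne hab.symm] at e1
  simp [Fin.sum_univ_two, Derivation.leibniz, h20, h21, hc _ _ _ ha, hc _ _ _ hb,
    hp.coord_ne hab.symm] at e2
  funext i
  fin_cases i
  · exact e1
  · exact e2

omit hp [CharZero F] hkB hk in
theorem mem_adjoin_vertex_body {a b : ι} (hab : p (b, 0) - p (a, 0) ≠ 0)
    (hab' : p (b, 1) - p (a, 1) ≠ 0) (ha : a ≠ v) (hb : b ≠ v) (x : L) :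
    x ∈ IntermediateField.adjoin (awayField F p v) (Set.range
      ![(p (v, 0) - p (a, 0)) * (p (b, 1) - p (a, 1)),
        (p (v, 1) - p (a, 1)) * (p (b, 0) - p (a, 0))]) := by
  set K := IntermediateField.adjoin (awayField F p v) (Set.range
      ![(p (v, 0) - p (a, 0)) * (p (b, 1) - p (a, 1)),
        (p (v, 1) - p (a, 1)) * (p (b, 0) - p (a, 0))]) with hK
  have hc : ∀ (u : ι) (i : Fin 2), u ≠ v → p (u, i) ∈ K := fun u i hu =>
    K.algebraMap_mem (⟨p (u, i), IntermediateField.subset_adjoin _ _ ⟨(u, i), hu, rfl⟩⟩ :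
        awayField F p v)
  have h0 : (p (v, 0) - p (a, 0)) * (p (b, 1) - p (a, 1)) ∈ K :=
    IntermediateField.subset_adjoin _ _ ⟨0, rfl⟩
  have h1 : (p (v, 1) - p (a, 1)) * (p (b, 0) - p (a, 0)) ∈ K :=
    IntermediateField.subset_adjoin _ _ ⟨1, rfl⟩
  refine mem_adjoin_vertex htop v (fun i => ?_) x
  fin_cases i
  · have := add_mem (div_mem h0 (sub_mem (hc b 1 hb) (hc a 1 ha))) (hc a 0 ha)
    rwa [mul_div_cancel_right₀ _ hab', sub_add_cancel] at this
  · have := add_mem (div_mem h1 (sub_mem (hc b 0 hb) (hc a 0 ha))) (hc a 1 ha)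
    rwa [mul_div_cancel_right₀ _ hab, sub_add_cancel] at this

theorem vertex_one_body {a b : ι} (hab : a ≠ b) (ha : a ≠ v) (hb : b ≠ v) {x : L}
    (hx : IsAlgebraic (IntermediateField.adjoin k (Set.range
      ![(p (v, 0) - p (a, 0)) * (p (b, 1) - p (a, 1)),
        (p (v, 1) - p (a, 1)) * (p (b, 0) - p (a, 0))])) x) :
    x ∈ IntermediateField.adjoin k (Set.range
      ![(p (v, 0) - p (a, 0)) * (p (b, 1) - p (a, 1)),
        (p (v, 1) - p (a, 1)) * (p (b, 0) - p (a, 0))]) := by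
  let _ : Algebra k (awayField F p v) := (IntermediateField.inclusion hkB).toAlgebra
  have : IsScalarTower k (awayField F p v) L := IsScalarTower.of_algebraMap_eq fun _ => rfl
  exact one_body (algebraicIndependent_vertex_body hp hab ha hb)
    (fun x _ => mem_adjoin_vertex_body htop (hp.coord_ne hab.symm 0) (hp.coord_ne hab.symm 1)
      ha hb x)
    (fun x hx => (⟨⟨x, hk x hx⟩, rfl⟩ : x ∈ Set.range (algebraMap k L))) hx

theorem vertex_one_body_one_bar {a b : ι} (hab : a ≠ b) (ha : a ≠ v) (hb : b ≠ v) {g g' : L}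
    (hg : g ∈ awayField F p v) (hg' : g' ∈ awayField F p v)
    (hgg : AlgebraicIndependent k ![g, g']) {x : L}
    (hx : IsAlgebraic (IntermediateField.adjoin k (insert
      (((p (v, 0) - p (a, 0)) * (p (b, 1) - p (a, 1)) - g) *
        ((p (v, 1) - p (a, 1)) * (p (b, 0) - p (a, 0)) - g')) (Set.range
      ![(p (v, 0) - p (a, 0)) * (p (b, 1) - p (a, 1)),
        (p (v, 1) - p (a, 1)) * (p (b, 0) - p (a, 0))]))) x) :
    x ∈ IntermediateField.adjoin k (insert
      (((p (v, 0) - p (a, 0)) * (p (b, 1) - p (a, 1)) - g) *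
        ((p (v, 1) - p (a, 1)) * (p (b, 0) - p (a, 0)) - g')) (Set.range
      ![(p (v, 0) - p (a, 0)) * (p (b, 1) - p (a, 1)),
        (p (v, 1) - p (a, 1)) * (p (b, 0) - p (a, 0))])) := by
  let _ : Algebra k (awayField F p v) := (IntermediateField.inclusion hkB).toAlgebra
  have : IsScalarTower k (awayField F p v) L := IsScalarTower.of_algebraMap_eq fun _ => rfl
  refine one_body_one_bar (b := (⟨g, hg⟩ : awayField F p v)) (b' := (⟨g', hg'⟩ : awayField F p v))
    (algebraicIndependent_vertex_body hp hab ha hb)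
    (fun x _ => mem_adjoin_vertex_body htop (hp.coord_ne hab.symm 0) (hp.coord_ne hab.symm 1)
      ha hb x)
    (fun x hx => (⟨⟨x, hk x hx⟩, rfl⟩ : x ∈ Set.range (algebraMap k L))) ?_ hx
  rw [← AlgHom.algebraicIndependent_iff (IsScalarTower.toAlgHom k
    (awayField F p v) L) (IsScalarTower.toAlgHom k (awayField F p v) L).toRingHom.injective]
  convert hgg using 1
  funext i
  fin_cases i <;> rfl

omit hp htop hkB hk in
theorem algebraicIndependent_relative_coordinates {P Q R S : L} (hR : R ≠ 0) (hS : S ≠ 0)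
    (hRS : R * S ∈ k)
    (hd : AlgebraicIndependent k ![P * Q, (P - R) * (Q - S)]) :
    AlgebraicIndependent k ![P * S, Q * R] := by
  refine algebraicIndependent_of_derivations fun c hc => ?_
  have key : ∀ Δ : Derivation k L L, Δ (R * S) = 0 ∧
      Δ (P * Q) * (R * S) = Δ (P * S) * (Q * R) + P * S * Δ (Q * R) ∧
      Δ ((P - R) * (Q - S)) = Δ (P * Q) - Δ (P * S) - Δ (Q * R) := by
    intro Δ
    have h1 : Δ (R * S) = 0 := Δ.map_algebraMap (⟨R * S, hRS⟩ : k)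
    refine ⟨h1, ?_, ?_⟩
    · have h2 : P * Q * (R * S) = P * S * (Q * R) := by ring
      have h3 := congrArg Δ h2
      rw [Δ.leibniz (P * Q) (R * S), h1, Δ.leibniz (P * S) (Q * R)] at h3
      simp only [smul_eq_mul, mul_zero, zero_add] at h3
      linear_combination h3
    · have h2 : (P - R) * (Q - S) = P * Q - P * S - Q * R + R * S := by ring
      rw [h2, map_add, map_sub, map_sub, h1, add_zero]
  obtain ⟨D₁, h1⟩ := exists_derivation_of_algebraicIndependent hd ![1, 1]
  obtain ⟨D₂, h2⟩ := exists_derivation_of_algebraicIndependent hd ![0, -1]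
  have h10 := h1 0
  have h11 := h1 1
  have h20 := h2 0
  have h21 := h2 1
  simp only [Matrix.cons_val] at h10 h11 h20 h21
  obtain ⟨-, e1, e2⟩ := key D₁
  obtain ⟨-, e3, e4⟩ := key D₂
  have c1 := hc D₁
  have c2 := hc D₂
  simp only [Fin.sum_univ_two, Matrix.cons_val] at c1 c2
  rw [h10, h11] at e2
  rw [h20, h21] at e4
  rw [h10] at e1
  have hne : D₁ (P * S) ≠ 0 := by
    intro h0
    have h5 : D₁ (Q * R) = 0 := by linear_combination e2 - h0
    rw [h0, h5] at e1
    simp [hR, hS] at e1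
  have h6 : (c 0 - c 1) * D₁ (P * S) = 0 := by
    linear_combination c1 - c 1 * e2
  have h7 := (mul_eq_zero.1 h6).resolve_right hne
  have h8 : c 1 = 0 := by linear_combination c2 - D₂ (P * S) * h7 - c 1 * e4
  have h9 : c 0 = 0 := by linear_combination h7 + h8
  funext i
  fin_cases i
  · exact h9
  · exact h8

end VertexStep

end

section

section Slack

variable {ι J : Type*} [Fintype J] {𝒱 : J → Finset ι}

theorem bodyCount_insert_ge {v : ι} {M Y : Finset ι} (hv : v ∉ M) (hvY : v ∉ Y)
    (hM : ∀ a ∈ M, ∃ j, 𝒱 j = {v, a}) :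
    bodyCount 𝒱 Y + (M ∩ Y).card ≤ bodyCount 𝒱 (insert v Y) := by
  rcases isEmpty_or_nonempty J with hJ | hJ
  · rw [Finset.eq_empty_of_forall_notMem fun a ha => hJ.elim (hM a ha).choose]
    simp [bodyCount]
  choose! f hf using hM
  have hinj : Set.InjOn f (M ∩ Y : Finset ι) := by
    intro a ha b hb hab
    have ha := (Finset.mem_inter.1 ha).1
    have hb := (Finset.mem_inter.1 hb).1
    have h1 := hf a ha
    rw [hab, hf b hb] at h1
    have h2 : a ∈ ({v, b} : Finset ι) := by rw [h1]; simp
    rcases Finset.mem_insert.1 h2 with rfl | h2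
    · exact absurd ha hv
    · exact Finset.mem_singleton.1 h2
  have h1 : (M ∩ Y).card = ∑ j, if j ∈ (M ∩ Y).image f then 1 else 0 := by
    rw [← Finset.card_image_of_injOn hinj, Finset.sum_boole, Nat.cast_id,
      Finset.filter_mem_eq_inter, Finset.univ_inter]
  rw [h1, bodyCount, bodyCount, ← Finset.sum_add_distrib]
  refine Finset.sum_le_sum fun j _ => ?_
  split_ifs with hj
  · obtain ⟨a, ha, rfl⟩ := Finset.mem_image.1 hj
    obtain ⟨ha, haY⟩ := Finset.mem_inter.1 ha
    have hva : v ≠ a := fun h => hv (h ▸ ha)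
    have e1 : ({v, a} : Finset ι) ∩ Y = {a} := by
      rw [Finset.insert_inter_of_notMem hvY, Finset.singleton_inter_of_mem haY]
    have e2 : ({v, a} : Finset ι) ∩ insert v Y = {v, a} := by
      rw [Finset.inter_eq_left]
      intro b hb
      simp only [Finset.mem_insert, Finset.mem_singleton] at hb ⊢
      rcases hb with rfl | rfl
      exacts [Or.inl rfl, Or.inr haY]
    rw [hf a ha, e1, e2, Finset.card_pair hva, Finset.card_singleton]
  · have := Finset.card_le_card (Finset.inter_subset_inter (subset_refl (𝒱 j))
      (Finset.subset_insert v Y))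
    omega

theorem BodySparse.bars_slack (h𝒱 : BodySparse 𝒱) {v : ι} (hbig : ∀ j, v ∈ 𝒱 j → (𝒱 j).card ≤ 2)
    {M N W : Finset ι} (hM : ∀ a ∈ M, ∃ j, 𝒱 j = {v, a}) (hVW : ∀ j, 𝒱 j ⊆ W)
    (hNW : N ∩ W = M) (hv : v ∉ N) {X : Finset ι} (hX : 2 ≤ (N ∩ X).card) :
    bodyCount (fun j => (𝒱 j).erase v) X + 2 + (N ∩ X).card ≤ 2 * X.card := by
  rw [bodyCount_erase]
  have hvM : v ∉ M := fun h => hv (Finset.mem_inter.1 (hNW.symm ▸ h)).1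
  set Y := X.erase v ∩ W with hY
  have hvY : v ∉ Y := by simp [hY]
  have hXc := Finset.card_erase_le (s := X) (a := v)
  have h1 : bodyCount 𝒱 (X.erase v) = bodyCount 𝒱 Y := by
    refine Finset.sum_congr rfl fun j _ => ?_
    rw [hY, Finset.inter_comm _ W, ← Finset.inter_assoc, Finset.inter_eq_left.2 (hVW j)]
  have hNX : N ∩ X = (M ∩ Y) ∪ ((N ∩ X) \ W) := by
    ext a
    have : a ∈ M ↔ a ∈ N ∧ a ∈ W := by rw [← hNW, Finset.mem_inter]
    simp only [hY, Finset.mem_union, Finset.mem_inter, Finset.mem_sdiff, Finset.mem_erase, this]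
    have : a ∈ N → a ≠ v := fun h h' => hv (h' ▸ h)
    tauto
  have hd1 : Disjoint (M ∩ Y) ((N ∩ X) \ W) := by
    refine Finset.disjoint_left.2 fun a ha hb => (Finset.mem_sdiff.1 hb).2 ?_
    exact (Finset.mem_inter.1 (Finset.mem_inter.1 ha).2).2
  have hd2 : Disjoint Y ((N ∩ X) \ W) :=
    Finset.disjoint_left.2 fun a ha hb => (Finset.mem_sdiff.1 hb).2 (Finset.mem_inter.1 ha).2
  have hsub : Y ∪ ((N ∩ X) \ W) ⊆ X.erase v := by
    intro a
    simp only [hY, Finset.mem_union, Finset.mem_inter, Finset.mem_sdiff, Finset.mem_erase]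
    have : a ∈ N → a ≠ v := fun h h' => hv (h' ▸ h)
    tauto
  have hc := Finset.card_le_card hsub
  rw [Finset.card_union_of_disjoint hd2] at hc
  have hc2 : (N ∩ X).card = (M ∩ Y).card + ((N ∩ X) \ W).card := by
    rw [← Finset.card_union_of_disjoint hd1, ← hNX]
  have hg := bodyCount_insert_ge hvM hvY hM
  have hMY := Finset.card_le_card (Finset.inter_subset_right (s₁ := M) (s₂ := Y))
  have hi := Finset.card_insert_of_notMem hvY
  rw [h1]
  rcases Nat.eq_zero_or_pos (M ∩ Y).card with hr | hr
  · rcases Nat.lt_or_ge 1 Y.card with h2 | h2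
    · have := (h𝒱 Y h2).1
      omega
    · rw [bodyCount_eq_zero h2]
      omega
  · by_cases hj : ∃ j, insert v Y ⊆ 𝒱 j
    · obtain ⟨j, hj⟩ := hj
      have := Finset.card_le_card hj
      have := hbig j (hj (Finset.mem_insert_self _ _))
      have h2 : Y.card ≤ 1 := by omega
      rw [bodyCount_eq_zero h2]
      omega
    · have := (h𝒱 (insert v Y) (by omega)).2 (by simpa using hj)
      omega

end Slack

section BodyField

variable {ι F L : Type*} [Field F] [Field L] [Algebra F L]

theorem mem_of_mem_adjoin {k K : IntermediateField F L} (hkK : k ≤ K) {S : Set L}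
    (hS : ∀ x ∈ S, x ∈ K) {x : L} (hx : x ∈ IntermediateField.adjoin k S) : x ∈ K := by
  have h : IntermediateField.adjoin k S ≤ IntermediateField.extendScalars hkK :=
    IntermediateField.adjoin_le_iff.2 fun y hy => hS y hy
  exact h hx

theorem mem_adjoin_of_mem_adjoin {k K : IntermediateField F L} (hkK : k ≤ K) {S T : Set L}
    (hS : ∀ x ∈ S, x ∈ IntermediateField.adjoin K T) {x : L}
    (hx : x ∈ IntermediateField.adjoin k S) : x ∈ IntermediateField.adjoin K T := by
  have h : k ≤ (IntermediateField.adjoin K T).restrictScalars F := fun y hy =>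
    IntermediateField.algebraMap_mem _ (⟨y, hkK hy⟩ : K)
  exact mem_of_mem_adjoin h hS hx

theorem mem_adjoin_of_mem_bodyField {J : Type*} {p : ι × Fin 2 → L} {𝒱 : J → Finset ι}
    {k : IntermediateField F L} {K : IntermediateField k L}
    (h : ∀ j, ∀ x ∈ bodyGen p (𝒱 j), x ∈ K) {x : L} (hx : x ∈ bodyField F p 𝒱) : x ∈ K := by
  have h1 : bodyField F p 𝒱 ≤ K.restrictScalars F := bodyField_le h
  exact h1 hx

theorem bodyField_erase_le {J : Type*} (p : ι × Fin 2 → L) (𝒱 : J → Finset ι) (v : ι) :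
    bodyField F p (fun j => (𝒱 j).erase v) ≤ bodyField F p 𝒱 :=
  bodyField_le fun j _ hx => mem_bodyField p j (bodyGen_mono p (Finset.erase_subset _ _) hx)

theorem bodyField_erase_le_awayField {J : Type*} (p : ι × Fin 2 → L) (𝒱 : J → Finset ι) (v : ι) :
    bodyField F p (fun j => (𝒱 j).erase v) ≤ awayField F p v := by
  refine bodyField_le fun j => ?_
  have h : ∀ u ∈ (𝒱 j).erase v, ∀ i, p (u, i) ∈ awayField F p v := fun u hu i =>
    IntermediateField.subset_adjoin _ _ ⟨(u, i), (Finset.mem_erase.1 hu).1, rfl⟩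
  rintro _ ⟨u, hu, t, ht, u', hu', t', ht', rfl⟩
  exact mul_mem (sub_mem (h u hu 0) (h t ht 0)) (sub_mem (h u' hu' 1) (h t' ht' 1))

theorem bodyGen_pair {p : ι × Fin 2 → L} {a b : ι} {x : L}
    (hx : x ∈ bodyGen p {a, b}) : x = 0 ∨ x = sdist p s(a, b) ∨ x = -sdist p s(a, b) := by
  obtain ⟨u, hu, t, ht, u', hu', t', ht', rfl⟩ := hx
  simp only [Finset.mem_insert, Finset.mem_singleton] at hu ht hu' ht'
  simp only [sdist_mk]
  rcases hu with rfl | rfl <;> rcases ht with rfl | rfl <;> rcases hu' with rfl | rfl <;>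
    rcases ht' with rfl | rfl <;> first
      | exact Or.inl (by ring1)
      | exact Or.inr (Or.inl (by ring1))
      | exact Or.inr (Or.inr (by ring1))

variable [CharZero F] {p : ι × Fin 2 → L} (hp : AlgebraicIndependent F p)
include hp

/-- Distances from a vertex to points outside the bodies are independent of the bodies. -/
theorem algebraicIndependent_sdist_fresh {J κ : Type*} [Fintype κ] {𝒱 : J → Finset ι} {v : ι}
    {n : κ → ι} (hn : Function.Injective n) (hv : ∀ i, n i ≠ v) (hfresh : ∀ i j, n i ∉ 𝒱 j) :
    AlgebraicIndependent (bodyField F p 𝒱) fun i => sdist p s(v, n i) := by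
  refine algebraicIndependent_of_derivations fun a ha => ?_
  funext i
  obtain ⟨Δ, hΔ⟩ := exists_derivation_of_algebraicIndependent hp (Pi.single (n i, 0) 1)
  have hΔ' : ∀ x ∈ ⋃ j, bodyGen p (𝒱 j), Δ x = 0 := by
    intro x hx
    obtain ⟨j, u, hu, t, ht, u', hu', t', ht', rfl⟩ := Set.mem_iUnion.1 hx
    have h1 : u ≠ n i := fun h => hfresh i j (h ▸ hu)
    have h2 : t ≠ n i := fun h => hfresh i j (h ▸ ht)
    simp [Derivation.leibniz, hΔ, h1, h2]
  have h2 : ∀ j, (Δ.overAdjoin _ hΔ') (sdist p s(v, n j)) =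
      if j = i then -(p (v, 1) - p (n i, 1)) else 0 := by
    intro j
    change Δ _ = _
    rw [sdist_mk, Derivation.leibniz]
    by_cases h : j = i
    · subst h
      simp [hΔ, (hv j).symm]
    · simp [hΔ, h, (hv i).symm, hn.ne h]
  have h1 : ∑ j, a j * (if j = i then -(p (v, 1) - p (n i, 1)) else 0) = 0 :=
    (Finset.sum_congr rfl fun j _ => congrArg (a j * ·) (h2 j).symm).trans (ha (Δ.overAdjoin _ hΔ'))
  simp only [mul_ite, mul_zero, Finset.sum_ite_eq', Finset.mem_univ, if_true] at h1
  exact (mul_eq_zero.1 h1).resolve_right (neg_ne_zero.2 (hp.coord_ne (hv i).symm 1))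

variable {J : Type*} [Fintype J] {𝒱 : J → Finset ι} (h𝒱 : BodySparse 𝒱)
  (htop : IntermediateField.adjoin F (Set.range p) = ⊤) {v : ι}
  (hk : ∀ x : L, IsAlgebraic (bodyField F p fun j => (𝒱 j).erase v) x →
    x ∈ bodyField F p fun j => (𝒱 j).erase v)
include h𝒱 htop hk

/-- The inductive step at a vertex that is met by bars only. -/
theorem bodyField_step_bars [Infinite ι] (hbig : ∀ j, v ∈ 𝒱 j → (𝒱 j).card ≤ 2)
    (hbars : (Finset.univ.filter fun j => v ∈ 𝒱 j ∧ (𝒱 j).card = 2).card ≤ 3) {x : L}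
    (hx : IsAlgebraic (bodyField F p 𝒱) x) : x ∈ bodyField F p 𝒱 := by
  have hm : ∀ j ∈ Finset.univ.filter fun j => v ∈ 𝒱 j ∧ (𝒱 j).card = 2,
      ∃ m, m ≠ v ∧ 𝒱 j = {v, m} := by
    intro j hj
    obtain ⟨h1, h2⟩ := (Finset.mem_filter.1 hj).2
    obtain ⟨a, b, hab, h⟩ := Finset.card_eq_two.1 h2
    rw [h] at h1 ⊢
    rcases Finset.mem_insert.1 h1 with rfl | h1
    · exact ⟨b, hab.symm, rfl⟩
    · rw [Finset.mem_singleton.1 h1]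
      exact ⟨a, hab, Finset.pair_comm _ _⟩
  choose! m hmv hm using hm
  set S := Finset.univ.filter fun j => v ∈ 𝒱 j ∧ (𝒱 j).card = 2 with hS
  set M := S.image m with hM
  have hMv : v ∉ M := by
    intro h
    obtain ⟨j, hj, hjv⟩ := Finset.mem_image.1 h
    exact hmv j hj hjv
  set W := insert v (Finset.univ.biUnion 𝒱) with hW
  have hVW : ∀ j, 𝒱 j ⊆ W := fun j a ha =>
    Finset.mem_insert_of_mem (Finset.mem_biUnion.2 ⟨j, Finset.mem_univ _, ha⟩)
  have hMW : M ⊆ W := by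
    intro a ha
    obtain ⟨j, hj, rfl⟩ := Finset.mem_image.1 ha
    exact hVW j (by rw [hm j hj]; simp)
  obtain ⟨N, hMN, hN, hNW⟩ : ∃ N : Finset ι, M ⊆ N ∧ N.card = 3 ∧ N ∩ W = M := by
    obtain ⟨W', hW', hc⟩ := Infinite.exists_superset_card_eq W (W.card + 3) (by omega)
    have hc' : (W' \ W).card = 3 := by rw [Finset.card_sdiff_of_subset hW']; omega
    have hM3 : M.card ≤ 3 := Finset.card_image_le.trans hbars
    obtain ⟨U, hU, hUc⟩ := Finset.exists_subset_card_eq (s := W' \ W) (n := 3 - M.card) (by omega)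
    have hd : Disjoint U W := Finset.disjoint_of_subset_left hU Finset.sdiff_disjoint
    refine ⟨M ∪ U, Finset.subset_union_left, ?_, ?_⟩
    · rw [Finset.card_union_of_disjoint (Finset.disjoint_of_subset_left hMW hd.symm)]
      omega
    · rw [Finset.union_inter_distrib_right, Finset.disjoint_iff_inter_eq_empty.1 hd,
        Finset.inter_eq_left.2 hMW, Finset.union_empty]
  have hNv : v ∉ N := fun h => hMv (hNW ▸ Finset.mem_inter.2 ⟨h, by simp [hW]⟩)
  obtain ⟨n, hninj, hnN⟩ : ∃ n : Fin 3 → ι, Function.Injective n ∧ Set.range n = N := by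
    have e := (Finset.equivFinOfCardEq hN).symm
    exact ⟨fun i => (e i : ι), Subtype.val_injective.comp e.injective, by
      rw [Set.range_comp' Subtype.val e, e.range_eq_univ, Set.image_univ, Subtype.range_coe]⟩
  have hnN' : ∀ i, n i ∈ N := fun i => by
    rw [← Finset.mem_coe, ← hnN]; exact ⟨i, rfl⟩
  have hnv : ∀ i, n i ≠ v := fun i h => hNv (h ▸ hnN' i)
  have slack := fun X => h𝒱.bars_slack (X := X) hbig (fun a ha => by
    obtain ⟨j, hj, rfl⟩ := Finset.mem_image.1 ha
    exact ⟨j, hm j hj⟩) hVW hNW hNv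
  have hX2 : ∀ i j, i ≠ j → ∀ X : Finset ι, n i ∈ X → n j ∈ X →
      bodyCount (fun j => (𝒱 j).erase v) X + 4 ≤ 2 * X.card := by
    intro i j hij X hi hj
    have h1 : ({n i, n j} : Finset ι) ⊆ N ∩ X := by
      intro a ha
      simp only [Finset.mem_insert, Finset.mem_singleton] at ha
      rcases ha with rfl | rfl <;> simp [*]
    have h2 := Finset.card_le_card h1
    rw [Finset.card_pair (hninj.ne hij)] at h2
    have := slack X h2
    omega
  have hX3 : ∀ X : Finset ι, n 0 ∈ X → n 1 ∈ X → n 2 ∈ X →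
      bodyCount (fun j => (𝒱 j).erase v) X + 5 ≤ 2 * X.card := by
    intro X h0 h1 h2
    have h3 : N ⊆ N ∩ X := by
      intro a ha
      rw [← Finset.mem_coe, ← hnN] at ha
      obtain ⟨i, rfl⟩ := ha
      refine Finset.mem_inter.2 ⟨hnN' i, ?_⟩
      fin_cases i <;> assumption
    have h4 := Finset.card_le_card h3
    have := slack X (by omega)
    omega
  have hpair := algebraicIndependent_sdist_pair hp (fun X hX => (h𝒱.erase v X hX).1)
    (hninj.ne (show (0 : Fin 3) ≠ 1 by decide)) (hninj.ne (show (0 : Fin 3) ≠ 2 by decide))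
    (hninj.ne (show (1 : Fin 3) ≠ 2 by decide)) (hX2 0 1 (by decide)) (hX2 0 2 (by decide)) hX3
  have hpair' := algebraicIndependent_sdist_pair hp (fun X hX => (h𝒱.erase v X hX).1)
    (hninj.ne (show (1 : Fin 3) ≠ 2 by decide)) (hninj.ne (show (1 : Fin 3) ≠ 0 by decide))
    (hninj.ne (show (2 : Fin 3) ≠ 0 by decide)) (hX2 1 2 (by decide)) (hX2 1 0 (by decide))
    (fun X h1 h2 h0 => hX3 X h0 h1 h2)
  have hle := bodyField_erase_le (F := F) p 𝒱 v
  have hsub : ∀ y ∈ bodyField F p 𝒱, y ∈ IntermediateField.adjoin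
      (bodyField F p fun j => (𝒱 j).erase v) (Set.range fun i => sdist p s(v, n i)) := by
    intro y hy
    refine mem_adjoin_of_mem_bodyField (fun j z hz => ?_) hy
    by_cases hvj : v ∈ 𝒱 j
    · have h2 := hbig j hvj
      rcases Nat.lt_or_ge 1 (𝒱 j).card with h3 | h3
      · have hjS : j ∈ S := Finset.mem_filter.2 ⟨Finset.mem_univ _, hvj, by omega⟩
        obtain ⟨i, hi⟩ : m j ∈ Set.range n := by
          rw [hnN]; exact hMN (Finset.mem_image_of_mem _ hjS)
        have h4 : sdist p s(v, m j) ∈ IntermediateField.adjoin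
            (bodyField F p fun j => (𝒱 j).erase v) (Set.range fun i => sdist p s(v, n i)) :=
          IntermediateField.subset_adjoin _ _ ⟨i, by simp only [hi]⟩
        rw [hm j hjS] at hz
        rcases bodyGen_pair hz with rfl | rfl | rfl
        exacts [zero_mem _, h4, neg_mem h4]
      · rw [bodyGen_eq_zero_of_card_le_one p h3 hz]
        exact zero_mem _
    · rw [← Finset.erase_eq_of_notMem hvj] at hz
      exact IntermediateField.algebraMap_mem _
        (⟨z, mem_bodyField p (𝒱 := fun j => (𝒱 j).erase v) j hz⟩ :
          bodyField F p fun j => (𝒱 j).erase v)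
  have hmem := vertex_three_bars hp htop (bodyField_erase_le_awayField p 𝒱 v) hk hninj hnv hpair
    (by simpa using hpair'.transcendental 0) (isAlgebraic_of_forall_mem hsub hx)
  have hfresh : AlgebraicIndependent (bodyField F p 𝒱)
      fun i : {i : Fin 3 // n i ∉ W} => sdist p s(v, n i) :=
    algebraicIndependent_sdist_fresh hp (n := fun i : {i : Fin 3 // n i ∉ W} => n i)
      (hninj.comp Subtype.val_injective) (fun i => hnv i) fun i j h => i.2 (hVW j h)
  have hmem' : x ∈ IntermediateField.adjoin (bodyField F p 𝒱)
      (Set.range fun i : {i : Fin 3 // n i ∉ W} => sdist p s(v, n i)) := by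
    refine mem_adjoin_of_mem_adjoin hle ?_ hmem
    · rintro _ ⟨i, rfl⟩
      by_cases hi : n i ∈ W
      · have : n i ∈ M := hNW ▸ Finset.mem_inter.2 ⟨hnN' i, hi⟩
        obtain ⟨j, hj, hji⟩ := Finset.mem_image.1 this
        refine IntermediateField.algebraMap_mem _ (⟨sdist p s(v, n i), mem_bodyField p j
          (sdist_mem_bodyGen p ?_ ?_)⟩ : bodyField F p 𝒱)
        · rw [hm j hj]; simp
        · rw [hm j hj, hji]; simp
      · exact IntermediateField.subset_adjoin _ _ ⟨⟨i, hi⟩, rfl⟩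
  obtain ⟨y, hy⟩ := mem_range_of_isAlgebraic_adjoin hfresh hmem' hx
  exact hy ▸ y.2

omit h𝒱 htop hk [CharZero F] [Fintype J] in
/-- The invariants of a body in terms of those away from the vertex `v`. -/
theorem bodyGen_subset_adjoin_base {V : Finset ι} {a b : ι} (hab : a ≠ b) (ha : a ∈ V)
    (hb : b ∈ V) (hav : a ≠ v) (hbv : b ≠ v) {k : IntermediateField F L}
    (hV : ∀ x ∈ bodyGen p (V.erase v), x ∈ k) {S : Set L}
    (h0 : (p (v, 0) - p (a, 0)) * (p (b, 1) - p (a, 1)) ∈ IntermediateField.adjoin k S)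
    (h1 : (p (v, 1) - p (a, 1)) * (p (b, 0) - p (a, 0)) ∈ IntermediateField.adjoin k S) :
    ∀ x ∈ bodyGen p V, x ∈ IntermediateField.adjoin k S := by
  have ha' : a ∈ V.erase v := Finset.mem_erase.2 ⟨hav, ha⟩
  have hb' : b ∈ V.erase v := Finset.mem_erase.2 ⟨hbv, hb⟩
  have hk : ∀ x ∈ bodyGen p (V.erase v), x ∈ IntermediateField.adjoin k S := fun x hx =>
    IntermediateField.algebraMap_mem _ (⟨x, hV x hx⟩ : k)
  have hu0 : ∀ u ∈ V, (p (u, 0) - p (a, 0)) * (p (b, 1) - p (a, 1)) ∈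
      IntermediateField.adjoin k S := by
    intro u hu
    by_cases huv : u = v
    · rwa [huv]
    · exact hk _ ⟨u, Finset.mem_erase.2 ⟨huv, hu⟩, a, ha', b, hb', a, ha', rfl⟩
  have hu1 : ∀ u ∈ V, (p (u, 1) - p (a, 1)) * (p (b, 0) - p (a, 0)) ∈
      IntermediateField.adjoin k S := by
    intro u hu
    by_cases huv : u = v
    · rwa [huv]
    · exact hk _ ⟨b, hb', a, ha', u, Finset.mem_erase.2 ⟨huv, hu⟩, a, ha', mul_comm _ _⟩
  have hd : sdist p s(b, a) ≠ 0 := mul_ne_zero (hp.coord_ne hab.symm 0) (hp.coord_ne hab.symm 1)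
  rintro _ ⟨u, hu, t, ht, u', hu', t', ht', rfl⟩
  rw [eq_div_of_mul_eq hd (bodyGen_mul_base p a b u t u' t')]
  exact div_mem (mul_mem (sub_mem (hu0 u hu) (hu0 t ht)) (sub_mem (hu1 u' hu') (hu1 t' ht')))
    (hk _ (sdist_mem_bodyGen p hb' ha'))

/-- The inductive step at a vertex that is met by a big body. -/
theorem bodyField_step_body {j₀ : J} (hj₀ : v ∈ 𝒱 j₀) (hj₀' : 3 ≤ (𝒱 j₀).card)
    (hbig : ∀ j, v ∈ 𝒱 j → 3 ≤ (𝒱 j).card → j = j₀)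
    (hbars : ∀ j j', v ∈ 𝒱 j → (𝒱 j).card = 2 → v ∈ 𝒱 j' → (𝒱 j').card = 2 → j = j') {x : L}
    (hx : IsAlgebraic (bodyField F p 𝒱) x) : x ∈ bodyField F p 𝒱 := by
  obtain ⟨a, ha, b, hb, hab⟩ := Finset.one_lt_card.1
    (show 1 < ((𝒱 j₀).erase v).card by rw [Finset.card_erase_of_mem hj₀]; omega)
  obtain ⟨hav, ha⟩ := Finset.mem_erase.1 ha
  obtain ⟨hbv, hb⟩ := Finset.mem_erase.1 hb
  have hle := bodyField_erase_le (F := F) p 𝒱 v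
  have hle' := bodyField_erase_le_awayField (F := F) p 𝒱 v
  have hgen : ∀ j, ∀ x ∈ bodyGen p ((𝒱 j).erase v), x ∈ bodyField F p fun j => (𝒱 j).erase v :=
    fun j x hx => mem_bodyField p (𝒱 := fun j => (𝒱 j).erase v) j hx
  set X := (p (v, 0) - p (a, 0)) * (p (b, 1) - p (a, 1)) with hX
  set Y := (p (v, 1) - p (a, 1)) * (p (b, 0) - p (a, 0)) with hY
  have hXK : X ∈ bodyField F p 𝒱 := mem_bodyField p j₀ ⟨v, hj₀, a, ha, b, hb, a, ha, rfl⟩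
  have hYK : Y ∈ bodyField F p 𝒱 :=
    mem_bodyField p j₀ ⟨b, hb, a, ha, v, hj₀, a, ha, mul_comm _ _⟩
  have hXYK : ∀ y ∈ Set.range ![X, Y], y ∈ bodyField F p 𝒱 := by
    rintro _ ⟨i, rfl⟩
    fin_cases i
    exacts [hXK, hYK]
  by_cases hbar : ∃ j, v ∈ 𝒱 j ∧ (𝒱 j).card = 2
  · obtain ⟨j₁, hj₁, hj₁'⟩ := hbar
    obtain ⟨c, hcv, hc⟩ : ∃ c, c ≠ v ∧ 𝒱 j₁ = {v, c} := by
      obtain ⟨s, t, hst, h⟩ := Finset.card_eq_two.1 hj₁'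
      rw [h] at hj₁ ⊢
      rcases Finset.mem_insert.1 hj₁ with rfl | h1
      · exact ⟨t, hst.symm, rfl⟩
      · rw [Finset.mem_singleton.1 h1]
        exact ⟨s, hst, Finset.pair_comm _ _⟩
    have hj₀₁ : j₀ ≠ j₁ := fun h => by rw [h] at hj₀'; omega
    have hcount : ∀ (Z Z' : Finset ι) (e : ℕ), Z ⊆ Z' →
        2 * (𝒱 j₁ ∩ Z).card - 3 + 1 ≤ 2 * (𝒱 j₁ ∩ Z').card - 3 →
        2 * (𝒱 j₀ ∩ Z).card - 3 + e ≤ 2 * (𝒱 j₀ ∩ Z').card - 3 →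
        bodyCount 𝒱 Z + (e + 1) ≤ bodyCount 𝒱 Z' := by
      intro Z Z' e hZ h1 h0
      have h2 : e + 1 = ∑ j, ((if j = j₀ then e else 0) + if j = j₁ then 1 else 0) := by
        simp [Finset.sum_add_distrib]
      rw [h2, bodyCount, bodyCount, ← Finset.sum_add_distrib]
      refine Finset.sum_le_sum fun j _ => ?_
      by_cases e0 : j = j₀
      · subst e0
        simpa [hj₀₁] using h0
      · by_cases e1 : j = j₁
        · subst e1
          simpa [e0] using h1
        · have := Finset.card_le_card (Finset.inter_subset_inter (subset_refl (𝒱 j)) hZ)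
          simp only [e0, e1, if_false]
          omega
    have hc₁ : ∀ {Z : Finset ι}, v ∈ Z → c ∈ Z → (𝒱 j₁ ∩ Z).card = 2 := by
      intro Z hv hcZ
      rw [Finset.inter_eq_left.2 (by rw [hc]; simp [Finset.insert_subset_iff, hv, hcZ]), hj₁']
    have hc₀ : c ∉ 𝒱 j₀ := by
      intro hc₀
      have h1 := hcount ∅ {v, c} 1 (by simp) (by rw [hc₁ (Z := {v, c}) (by simp) (by simp)]; simp) (by
        rw [Finset.inter_eq_right.2
          (show {v, c} ⊆ 𝒱 j₀ by simp [Finset.insert_subset_iff, hj₀, hc₀]),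
          Finset.card_pair hcv.symm]
        simp)
      have h2 := (h𝒱 {v, c} (by rw [Finset.card_pair hcv.symm])).1
      rw [Finset.card_pair hcv.symm] at h2
      omega
    have hca : c ≠ a := fun h => hc₀ (h ▸ ha)
    have hcb : c ≠ b := fun h => hc₀ (h ▸ hb)
    -- slack
    have slack : ∀ (Z : Finset ι) (d : ι) (e : ℕ), c ∈ Z → d ∈ Z → d ∈ 𝒱 j₀ → d ≠ v →
        (2 * (𝒱 j₀ ∩ Z.erase v).card - 3 + e ≤ 2 * (𝒱 j₀ ∩ insert v (Z.erase v)).card - 3) →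
        bodyCount (fun j => (𝒱 j).erase v) Z + 3 + e ≤ 2 * Z.card := by
      intro Z d e hcZ hdZ hd hdv hZ
      rw [bodyCount_erase]
      have h1 := hcount (Z.erase v) (insert v (Z.erase v)) e (Finset.subset_insert _ _) (by
        rw [hc₁ (Z := insert v (Z.erase v)) (by simp) (by simp [hcv, hcZ])]
        have : 𝒱 j₁ ∩ Z.erase v = {c} := by
          rw [hc, Finset.insert_inter_of_notMem (by simp),
            Finset.singleton_inter_of_mem (by simp [hcv, hcZ])]
        rw [this]
        simp) hZ
      have hi := Finset.card_insert_of_notMem (Finset.notMem_erase v Z)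
      have hdc : d ≠ c := fun h => hc₀ (h ▸ hd)
      have h3 : ({d, c} : Finset ι) ⊆ Z.erase v := by
        simp [Finset.insert_subset_iff, *]
      have h4 := Finset.card_le_card h3
      rw [Finset.card_pair hdc] at h4
      have h2 := (h𝒱 (insert v (Z.erase v)) (by omega)).2 fun j hj => by
        have h5 := Finset.card_le_card hj
        have h6 := hbig j (hj (Finset.mem_insert_self _ _)) (by omega)
        exact hc₀ (h6 ▸ hj (by simp [hcv, hcZ]))
      have := Finset.card_erase_le (s := Z) (a := v)
      omega
    have hins : ∀ Z : Finset ι, (𝒱 j₀ ∩ insert v (Z.erase v)).card =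
        (𝒱 j₀ ∩ Z.erase v).card + 1 := by
      intro Z
      rw [Finset.inter_insert_of_mem hj₀, Finset.card_insert_of_notMem (by simp)]
    have hpos : ∀ {Z : Finset ι} {d : ι}, d ∈ Z → d ∈ 𝒱 j₀ → d ≠ v →
        1 ≤ (𝒱 j₀ ∩ Z.erase v).card := fun h1 h2 h3 =>
      Finset.card_pos.2 ⟨_, Finset.mem_inter.2 ⟨h2, Finset.mem_erase.2 ⟨h3, h1⟩⟩⟩
    have hpair := algebraicIndependent_sdist_pair hp (fun X hX => (h𝒱.erase v X hX).1)
      hca hcb hab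
      (fun Z h1 h2 => by
        have := slack Z a 1 h1 h2 ha hav (by have := hpos h2 ha hav; rw [hins]; omega)
        omega)
      (fun Z h1 h2 => by
        have := slack Z b 1 h1 h2 hb hbv (by have := hpos h2 hb hbv; rw [hins]; omega)
        omega)
      (fun Z h1 h2 h3 => by
        have h4 : ({a, b} : Finset ι) ⊆ 𝒱 j₀ ∩ Z.erase v := by
          simp [Finset.insert_subset_iff, *]
        have h5 := Finset.card_le_card h4
        rw [Finset.card_pair hab] at h5
        have := slack Z a 2 h1 h2 ha hav (by rw [hins]; omega)
        omega)
    have hgg := algebraicIndependent_relative_coordinates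
      (k := bodyField F p fun j => (𝒱 j).erase v)
      (P := p (c, 0) - p (a, 0)) (Q := p (c, 1) - p (a, 1)) (R := p (b, 0) - p (a, 0))
      (S := p (b, 1) - p (a, 1)) (hp.coord_ne hab.symm 0) (hp.coord_ne hab.symm 1)
      (hgen j₀ _ (sdist_mem_bodyGen p (by simp [*]) (by simp [*])))
      (by simpa only [sdist_mk, sub_sub_sub_cancel_right] using hpair)
    have hmemB : ∀ u i, u ≠ v → p (u, i) ∈ awayField F p v := fun u i hu =>
      IntermediateField.subset_adjoin _ _ ⟨(u, i), hu, rfl⟩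
    have hbar : (X - (p (c, 0) - p (a, 0)) * (p (b, 1) - p (a, 1))) *
        (Y - (p (c, 1) - p (a, 1)) * (p (b, 0) - p (a, 0))) =
        sdist p s(v, c) * sdist p s(b, a) := by
      simp only [hX, hY, sdist_mk]
      ring
    have hdab : sdist p s(b, a) ≠ 0 :=
      mul_ne_zero (hp.coord_ne hab.symm 0) (hp.coord_ne hab.symm 1)
    have hdabk : sdist p s(b, a) ∈ bodyField F p fun j => (𝒱 j).erase v :=
      hgen j₀ _ (sdist_mem_bodyGen p (by simp [*]) (by simp [*]))
    refine mem_of_mem_adjoin hle ?_ (vertex_one_body_one_bar hp htop hle' hk hab hav hbv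
      (mul_mem (sub_mem (hmemB c 0 hcv) (hmemB a 0 hav)) (sub_mem (hmemB b 1 hbv) (hmemB a 1 hav)))
      (mul_mem (sub_mem (hmemB c 1 hcv) (hmemB a 1 hav)) (sub_mem (hmemB b 0 hbv) (hmemB a 0 hav)))
      hgg (isAlgebraic_of_forall_mem (fun y hy => mem_adjoin_of_mem_bodyField
        (fun j z hz => ?_) hy) hx))
    · rintro y (rfl | hy)
      · rw [hbar]
        exact mul_mem (mem_bodyField p j₁ (sdist_mem_bodyGen p hj₁ (by rw [hc]; simp)))
          (hle hdabk)
      · exact hXYK y hy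
    · by_cases hvj : v ∈ 𝒱 j
      · rcases Nat.lt_or_ge (𝒱 j).card 3 with h3 | h3
        · rcases Nat.lt_or_ge (𝒱 j).card 2 with h2 | h2
          · rw [bodyGen_eq_zero_of_card_le_one p (by omega) hz]
            exact zero_mem _
          · obtain rfl := hbars j j₁ hvj (by omega) hj₁ hj₁'
            have h4 : sdist p s(v, c) ∈ IntermediateField.adjoin
                (bodyField F p fun j => (𝒱 j).erase v) (insert
                ((X - (p (c, 0) - p (a, 0)) * (p (b, 1) - p (a, 1))) *
                (Y - (p (c, 1) - p (a, 1)) * (p (b, 0) - p (a, 0)))) (Set.range ![X, Y])) := by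
              rw [← mul_div_cancel_right₀ (sdist p s(v, c)) hdab, ← hbar]
              exact div_mem (IntermediateField.subset_adjoin _ _ (Set.mem_insert _ _))
                (IntermediateField.algebraMap_mem _ (⟨_, hdabk⟩ :
                  bodyField F p fun j => (𝒱 j).erase v))
            rw [hc] at hz
            rcases bodyGen_pair hz with rfl | rfl | rfl
            exacts [zero_mem _, h4, neg_mem h4]
        · obtain rfl := hbig j hvj h3
          exact bodyGen_subset_adjoin_base hp hab ha hb hav hbv (hgen j)
            (by exact IntermediateField.subset_adjoin _ _ (Set.mem_insert_of_mem _ ⟨0, rfl⟩))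
            (by exact IntermediateField.subset_adjoin _ _ (Set.mem_insert_of_mem _ ⟨1, rfl⟩)) z hz
      · rw [← Finset.erase_eq_of_notMem hvj] at hz
        exact IntermediateField.algebraMap_mem _
          (⟨z, hgen j z hz⟩ : bodyField F p fun j => (𝒱 j).erase v)
  · refine mem_of_mem_adjoin hle hXYK (vertex_one_body hp htop hle' hk hab hav hbv
      (isAlgebraic_of_forall_mem (fun y hy => mem_adjoin_of_mem_bodyField
        (fun j z hz => ?_) hy) hx))
    by_cases hvj : v ∈ 𝒱 j
    · rcases Nat.lt_or_ge (𝒱 j).card 3 with h3 | h3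
      · have h2 : (𝒱 j).card ≠ 2 := fun h => hbar ⟨j, hvj, h⟩
        rw [bodyGen_eq_zero_of_card_le_one p (by omega) hz]
        exact zero_mem _
      · obtain rfl := hbig j hvj h3
        exact bodyGen_subset_adjoin_base hp hab ha hb hav hbv (hgen j)
          (by exact IntermediateField.subset_adjoin _ _ ⟨0, rfl⟩)
          (by exact IntermediateField.subset_adjoin _ _ ⟨1, rfl⟩) z hz
    · rw [← Finset.erase_eq_of_notMem hvj] at hz
      exact IntermediateField.algebraMap_mem _
        (⟨z, hgen j z hz⟩ : bodyField F p fun j => (𝒱 j).erase v)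

omit h𝒱 hk in
/-- The field of invariants of a sparse system of bodies is relatively algebraically closed. -/
theorem BodySparse.mem_bodyField_of_isAlgebraic [Infinite ι] (h𝒱 : BodySparse 𝒱) {x : L}
    (hx : IsAlgebraic (bodyField F p 𝒱) x) : x ∈ bodyField F p 𝒱 := by
  suffices h : ∀ (m : ℕ) (𝒱 : J → Finset ι) (W : Finset ι), W.card = m → (∀ j, 𝒱 j ⊆ W) →
      BodySparse 𝒱 → ∀ x : L, IsAlgebraic (bodyField F p 𝒱) x → x ∈ bodyField F p 𝒱 from
    h _ 𝒱 (Finset.univ.biUnion 𝒱) rfl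
      (fun j a ha => Finset.mem_biUnion.2 ⟨j, Finset.mem_univ _, ha⟩) h𝒱 x hx
  clear hx h𝒱 x
  intro m
  induction m with
  | zero =>
    intro 𝒱 W hW hVW _ x hx
    have h1 : ∀ y ∈ bodyField F p 𝒱, y ∈ (⊥ : IntermediateField F L) := by
      intro y hy
      refine bodyField_le (K := ⊥) (fun j z hz => ?_) hy
      rw [bodyGen_eq_zero_of_card_le_one p ((Finset.card_le_card (hVW j)).trans (by omega)) hz]
      exact zero_mem _
    have h2 : IsAlgebraic F x := by
      have := isAlgebraic_of_forall_mem h1 hx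
      exact this.restrictScalars F
    obtain ⟨y, rfl⟩ := mem_range_of_isAlgebraic_adjoin hp (x := x) (htop ▸ trivial) h2
    exact IntermediateField.algebraMap_mem _ y
  | succ m ih =>
    intro 𝒱 W hW hVW h𝒱 x hx
    obtain ⟨v, hvW, hv⟩ := h𝒱.exists_vertex (Finset.card_pos.1 (by omega)) hVW
    have hk := ih (fun j => (𝒱 j).erase v) (W.erase v)
      (by rw [Finset.card_erase_of_mem hvW]; omega)
      (fun j => Finset.erase_subset_erase v (hVW j)) (h𝒱.erase v)
    by_cases hbig : ∃ j, v ∈ 𝒱 j ∧ 3 ≤ (𝒱 j).card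
    · obtain ⟨j₀, hj₀⟩ := hbig
      have h0 : 0 < (Finset.univ.filter fun j => v ∈ 𝒱 j ∧ 3 ≤ (𝒱 j).card).card :=
        Finset.card_pos.2 ⟨j₀, by simp [hj₀]⟩
      refine bodyField_step_body hp h𝒱 htop hk hj₀.1 hj₀.2 (fun j h1 h2 => ?_)
        (fun j j' h1 h2 h3 h4 => ?_) hx
      · exact Finset.card_le_one.1 (show (Finset.univ.filter
          fun j => v ∈ 𝒱 j ∧ 3 ≤ (𝒱 j).card).card ≤ 1 by omega) j (by simp [h1, h2]) j₀
          (by simp [hj₀])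
      · exact Finset.card_le_one.1 (show (Finset.univ.filter
          fun j => v ∈ 𝒱 j ∧ (𝒱 j).card = 2).card ≤ 1 by omega) j (by simp [h1, h2]) j'
          (by simp [h3, h4])
    · push Not at hbig
      exact bodyField_step_bars hp h𝒱 htop hk (fun j hj => by have := hbig j hj; omega)
        (by omega) hx

end BodyField

end

section

theorem IsSubgraph.trans {α : Type*} [DecidableEq α] {V V' V'' : Finset α}
    {E E' E'' : Finset (Sym2 α)} (h : IsSubgraph V'' E'' V' E') (h' : IsSubgraph V' E' V E) :
    IsSubgraph V'' E'' V E :=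
  ⟨h.1, h.2.1.trans h'.2.1, h.2.2.trans h'.2.2⟩

theorem IsSparse.of_isSubgraph {α : Type*} [DecidableEq α] {V V' : Finset α}
    {E E' : Finset (Sym2 α)} (h : IsSparse V E) (h' : IsSubgraph V' E' V E) : IsSparse V' E' :=
  ⟨h'.1, fun V'' E'' h'' => h.2 V'' E'' (h''.trans h')⟩

theorem IsSparse.edgeSparse {α : Type*} [_inst : DecidableEq α] {V : Finset α}
    {E : Finset (Sym2 α)} (h : IsSparse V E) : EdgeSparse E := by
  obtain rfl : _inst = fun a b => Classical.propDecidable (a = b) := Subsingleton.elim _ _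
  refine ⟨fun e he => (h.1 e he).1, fun X hX => ?_⟩
  by_cases hX' : 2 ≤ (X ∩ V).card
  · have h1 := h.2 (X ∩ V) (E ∩ X.sym2) ⟨fun e he => ⟨(h.1 e (Finset.mem_inter.1 he).1).1,
      fun v hv => Finset.mem_inter.2 ⟨Finset.mem_sym2_iff.1 (Finset.mem_inter.1 he).2 v hv,
        (h.1 e (Finset.mem_inter.1 he).1).2 v hv⟩⟩,
      Finset.inter_subset_right, Finset.inter_subset_left⟩ hX'
    have h2 : (X ∩ V).card ≤ X.card := Finset.card_le_card Finset.inter_subset_left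
    have h3 : ((E ∩ X.sym2).card : ℤ) ≤ 2 * (X ∩ V).card - 3 := by convert h1
    omega
  · have h1 : E ∩ X.sym2 ⊆ E ∩ (X ∩ V).sym2 := by
      intro e he
      rw [Finset.mem_inter] at he ⊢
      exact ⟨he.1, Finset.mem_sym2_iff.2 fun v hv => Finset.mem_inter.2
        ⟨Finset.mem_sym2_iff.1 he.2 v hv, (h.1 e he.1).2 v hv⟩⟩
    rw [inter_sym2_eq_empty (fun e he => (h.1 e he).1) (X := X ∩ V) (by omega),
      Finset.subset_empty] at h1
    rw [h1, Finset.card_empty]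
    omega

theorem bodyCount_inter {ι J : Type*} [Fintype J] {𝒱 : J → Finset ι} {V : Finset ι}
    (h : ∀ j, 𝒱 j ⊆ V) (X : Finset ι) : bodyCount 𝒱 (X ∩ V) = bodyCount 𝒱 X := by
  refine Finset.sum_congr rfl fun j _ => ?_
  congr 3
  ext a
  simp only [Finset.mem_inter]
  exact ⟨fun h' => ⟨h'.1, h'.2.1⟩, fun h' => ⟨h'.1, h'.2, h j h'.1⟩⟩

theorem IsMaxTight.edge_card {α : Type*} [DecidableEq α] {V V' : Finset α}
    {E E' : Finset (Sym2 α)} (h : IsMaxTight V' E' V E) : E'.card = 2 * V'.card - 3 := by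
  obtain h1 | h1 := h.2.1.2
  · rw [h1, Finset.card_eq_zero, Finset.eq_empty_iff_forall_notMem]
    intro e he
    obtain ⟨a, ha⟩ := Finset.card_eq_one.1 h1
    have h2 := h.1.1 e he
    induction e using Sym2.ind with
    | _ x y =>
      have hx := h2.2 x (by simp)
      have hy := h2.2 y (by simp)
      rw [ha, Finset.mem_singleton] at hx hy
      exact h2.1 (by simp [hx, hy])
  · omega

/-- The vertex sets of a max-tight decomposition of a sparse graph form a sparse system of
bodies. -/
theorem IsMaxTightDecomp.bodySparse {α I : Type*} [_inst : DecidableEq α] [Fintype I] {V : Finset α}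
    {E : Finset (Sym2 α)} {Vi : I → Finset α} {Ei : I → Finset (Sym2 α)}
    (hS : IsSparse V E) (hD : IsMaxTightDecomp V E Vi Ei) : BodySparse Vi := by
  obtain rfl : _inst = fun a b => Classical.propDecidable (a = b) := Subsingleton.elim _ _
  have hsub : ∀ i, IsSubgraph (Vi i) (Ei i) V E := fun i => (hD.1 i).1
  have key : ∀ X ⊆ V, 2 ≤ X.card → bodyCount Vi X + 3 ≤ 2 * X.card ∧
      ((∀ j, ¬ X ⊆ Vi j) → bodyCount Vi X + 4 ≤ 2 * X.card) := by
    intro X hXV hX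
    let T : Finset I := Finset.univ.filter fun i => 2 ≤ (Vi i ∩ X).card
    let W : Finset α := X ∪ T.biUnion Vi
    let E'' : Finset (Sym2 α) := T.biUnion Ei
    have hWsub : IsSubgraph W E'' V E := by
      refine ⟨fun e he => ?_, ?_, ?_⟩
      · obtain ⟨i, hi, he⟩ := Finset.mem_biUnion.1 he
        refine ⟨((hsub i).1 e he).1, fun v hv => Finset.mem_union_right _ ?_⟩
        exact Finset.mem_biUnion.2 ⟨i, hi, ((hsub i).1 e he).2 v hv⟩
      · exact Finset.union_subset hXV (Finset.biUnion_subset.2 fun i _ => (hsub i).2.1)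
      · exact Finset.biUnion_subset.2 fun i _ => (hsub i).2.2
    have hWX : X.card ≤ W.card := Finset.card_le_card Finset.subset_union_left
    have hWcard : W.card ≤ X.card + ∑ i ∈ T, (Vi i \ X).card := by
      have h1 : W ⊆ X ∪ T.biUnion fun i => Vi i \ X := by
        intro a ha
        by_cases haX : a ∈ X
        · exact Finset.mem_union_left _ haX
        · obtain ha | ha := Finset.mem_union.1 ha
          · exact absurd ha haX
          · obtain ⟨i, hi, ha⟩ := Finset.mem_biUnion.1 ha
            exact Finset.mem_union_right _
              (Finset.mem_biUnion.2 ⟨i, hi, Finset.mem_sdiff.2 ⟨ha, haX⟩⟩)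
      exact (Finset.card_le_card h1).trans ((Finset.card_union_le _ _).trans
        (Nat.add_le_add_left Finset.card_biUnion_le _))
    have hEcard : E''.card = ∑ i ∈ T, (2 * (Vi i).card - 3) := by
      have h1 : E''.card = ∑ i ∈ T, (Ei i).card := by
        refine Finset.card_biUnion fun i _ j _ hij => Finset.disjoint_left.2 fun e hi hj => ?_
        exact hD.2.2.2 i j hij e ⟨hi, hj⟩
      rw [h1]
      exact Finset.sum_congr rfl fun i _ => (hD.1 i).edge_card
    have hcount : bodyCount Vi X = ∑ i ∈ T, (2 * (Vi i ∩ X).card - 3) := by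
      refine (Finset.sum_subset (Finset.subset_univ T) fun i _ hi => ?_).symm.trans
        (Finset.sum_congr rfl fun i _ => by congr)
      have : ¬ 2 ≤ (Vi i ∩ X).card := fun h => hi (Finset.mem_filter.2 ⟨Finset.mem_univ _, h⟩)
      have h2 : (2 * (Vi i ∩ X).card - 3) = 0 := by omega
      convert h2
    have hrel : E''.card = bodyCount Vi X + 2 * ∑ i ∈ T, (Vi i \ X).card := by
      rw [hEcard, hcount, Finset.mul_sum, ← Finset.sum_add_distrib]
      refine Finset.sum_congr rfl fun i hi => ?_
      have h1 := (Finset.mem_filter.1 hi).2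
      have h2 := Finset.card_sdiff_add_card_inter (Vi i) X
      omega
    have hle := hS.2 W E'' hWsub (hX.trans hWX)
    refine ⟨by omega, fun hno => ?_⟩
    by_contra hlt
    have htight : IsTight W E'' := ⟨hS.of_isSubgraph hWsub, Or.inr (by omega)⟩
    have hpos : 0 < bodyCount Vi X := by omega
    rw [hcount] at hpos
    obtain ⟨i, hi⟩ : T.Nonempty := by
      by_contra h
      rw [Finset.not_nonempty_iff_eq_empty.1 h] at hpos
      simp at hpos
    have := ((hD.1 i).2.2 W E'' hWsub htight
      (fun a ha => Finset.mem_union_right _ (Finset.mem_biUnion.2 ⟨i, hi, ha⟩))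
      (fun a ha => Finset.mem_biUnion.2 ⟨i, hi, ha⟩)).1
    exact hno i (this ▸ Finset.subset_union_left)
  intro X hX
  have hcap := bodyCount_inter (fun j => (hsub j).2.1) X
  by_cases hXV : X ⊆ V
  · exact key X hXV hX
  have hlt : (X ∩ V).card + 1 ≤ X.card := Finset.card_lt_card
    ⟨Finset.inter_subset_left, fun h => hXV (h.trans Finset.inter_subset_right)⟩
  by_cases h2 : 2 ≤ (X ∩ V).card
  · have h3 : bodyCount Vi (X ∩ V) + 3 ≤ 2 * (X ∩ V).card := by
      convert (key (X ∩ V) Finset.inter_subset_right (by convert h2)).1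
    constructor <;> intros <;> omega
  · have h3 : bodyCount Vi (X ∩ V) = 0 := bodyCount_eq_zero (by omega)
    constructor <;> intros <;> omega

/-- Adding isolated vertices to the ground set preserves sparsity. -/
theorem BodySparse.map {ι κ J : Type*} [Fintype J] {𝒱 : J → Finset ι} (h : BodySparse 𝒱)
    (f : ι ↪ κ) : BodySparse fun j => (𝒱 j).map f := by
  intro X hX
  obtain ⟨Y, hY, hYX⟩ : ∃ Y : Finset ι, Y.map f ⊆ X ∧ ∀ a, f a ∈ X → a ∈ Y := by
    refine ⟨X.preimage f f.injective.injOn, ?_, fun a ha => by simpa using ha⟩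
    rw [Finset.map_subset_iff_subset_preimage]
  have hcount : bodyCount (fun j => (𝒱 j).map f) X = bodyCount 𝒱 Y := by
    refine Finset.sum_congr rfl fun j _ => ?_
    congr 2
    rw [← Finset.card_map f]
    congr 1
    ext b
    simp only [Finset.mem_inter, Finset.mem_map]
    constructor
    · rintro ⟨⟨a, ha, rfl⟩, hb⟩
      exact ⟨a, ⟨ha, hYX a hb⟩, rfl⟩
    · rintro ⟨a, ⟨ha, haY⟩, rfl⟩
      exact ⟨⟨a, ha, rfl⟩, hY (Finset.mem_map_of_mem f haY)⟩
  have hcard : Y.card ≤ X.card := by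
    rw [← Finset.card_map f]; exact Finset.card_le_card hY
  rw [hcount]
  by_cases h2 : 2 ≤ Y.card
  · refine ⟨by have := (h Y h2).1; omega, fun hno => ?_⟩
    by_cases hE : Y.map f = X
    · have := (h Y h2).2 fun j hj => hno j (hE ▸ Finset.map_subset_map.2 hj)
      omega
    · have h3 : (Y.map f).card < X.card := Finset.card_lt_card (hY.ssubset_of_ne hE)
      rw [Finset.card_map] at h3
      have := (h Y h2).1
      omega
  · have h3 : bodyCount 𝒱 Y = 0 := bodyCount_eq_zero (by omega)
    constructor <;> intros <;> omega

end

section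

/-- If a system of polynomial equations over a domain has no solution in an algebraically closed
extension of the fraction field, then there is a nonzero element that every homomorphism into a
field admitting a solution must kill. -/
theorem exists_ne_zero_forall_eq_zero_of_common_zero {C K Ω τ : Type*} [CommRing C] [IsDomain C]
    [Field K] [Algebra C K] [IsFractionRing C K] [Field Ω] [IsAlgClosed Ω] [Algebra K Ω]
    [Finite τ] (S : Set (MvPolynomial τ C))
    (h : ∀ x : τ → Ω, ∃ f ∈ S, MvPolynomial.eval₂ ((algebraMap K Ω).comp (algebraMap C K)) x f ≠ 0) :
    ∃ g : C, g ≠ 0 ∧ ∀ (F : Type*) [Field F] (c : C →+* F) (y : τ → F),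
      (∀ f ∈ S, MvPolynomial.eval₂ c y f = 0) → c g = 0 := by
  let _ : Algebra (MvPolynomial τ C) (MvPolynomial τ K) := MvPolynomial.algebraMvPolynomial
  let φ : MvPolynomial τ C →+* MvPolynomial τ K := algebraMap _ _
  have htop : (Ideal.span S).map φ = ⊤ := by
    rw [← Ideal.radical_eq_top, ← MvPolynomial.vanishingIdeal_zeroLocus_eq_radical (K := Ω)]
    convert MvPolynomial.vanishingIdeal_empty
    rw [Set.eq_empty_iff_forall_notMem]
    intro x hx
    obtain ⟨f, hf, hne⟩ := h x
    refine hne ?_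
    have := hx (φ f) (Ideal.mem_map_of_mem _ (Ideal.subset_span hf))
    simp only [φ] at this
    rw [MvPolynomial.algebraMap_def, MvPolynomial.aeval_def, MvPolynomial.eval₂_map] at this
    exact this
  have h1 : (1 : MvPolynomial τ K) ∈ (Ideal.span S).map φ := htop ▸ Submodule.mem_top
  have _ : IsLocalization ((nonZeroDivisors C).map (MvPolynomial.C : C →+* MvPolynomial τ C)) (MvPolynomial τ K) :=
    MvPolynomial.isLocalization _ _
  rw [IsLocalization.mem_map_algebraMap_iff ((nonZeroDivisors C).map (MvPolynomial.C : C →+* MvPolynomial τ C))] at h1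
  obtain ⟨⟨⟨a, ha⟩, ⟨_, ⟨g, hg, rfl⟩⟩⟩, hag⟩ := h1
  rw [one_mul] at hag
  have hinj : Function.Injective (algebraMap (MvPolynomial τ C) (MvPolynomial τ K)) :=
    MvPolynomial.map_injective _ (IsFractionRing.injective C K)
  have hga : MvPolynomial.C g = a := hinj hag
  refine ⟨g, nonZeroDivisors.ne_zero hg, fun F _ c y hy => ?_⟩
  have h2 : a ∈ RingHom.ker (MvPolynomial.eval₂Hom c y) := by
    refine (Ideal.span_le (I := RingHom.ker (MvPolynomial.eval₂Hom c y))).2 (fun f hf => ?_) ha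
    exact hy f hf
  rw [← hga, RingHom.mem_ker] at h2
  simpa using h2

end

section

open Polynomial in
/-- The monic polynomial of degree `a` in one variable whose lower coefficients are polynomials
with monomials in `S` and coefficients given by `u`. -/
noncomputable def genMonic {d : ℕ} {A : Type*} [CommRing A] (S : Finset (Fin d →₀ ℕ)) (a : ℕ)
    (u : Fin a × S → A) : (MvPolynomial (Fin d) A)[X] :=
  X ^ a + ∑ j : Fin a, C (∑ m : S, MvPolynomial.monomial m.1 (u (j, m))) * X ^ (j : ℕ)

open Polynomial in
theorem genMonic_map {d : ℕ} {A B : Type*} [CommRing A] [CommRing B] (φ : A →+* B)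
    (S : Finset (Fin d →₀ ℕ)) (a : ℕ) (u : Fin a × S → A) :
    (genMonic S a u).map (MvPolynomial.map φ) = genMonic S a (φ ∘ u) := by
  simp [genMonic, Polynomial.map_add, Polynomial.map_sum, MvPolynomial.map_monomial]

open Polynomial in
theorem genMonic_monic {d : ℕ} {A : Type*} [CommRing A] (S : Finset (Fin d →₀ ℕ)) (a : ℕ)
    (u : Fin a × S → A) : (genMonic S a u).Monic :=
  monic_X_pow_add (degree_sum_fin_lt _)

open Polynomial in
theorem genMonic_natDegree {d : ℕ} {A : Type*} [CommRing A] [Nontrivial A]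
    (S : Finset (Fin d →₀ ℕ)) (a : ℕ) (u : Fin a × S → A) : (genMonic S a u).natDegree = a := by
  apply natDegree_eq_of_degree_eq_some
  rw [genMonic, degree_add_eq_left_of_degree_lt] <;> rw [degree_X_pow]
  exact degree_sum_fin_lt _

open Polynomial in
theorem exists_eq_genMonic {d : ℕ} {A : Type*} [CommRing A] (S : Finset (Fin d →₀ ℕ))
    {Q : (MvPolynomial (Fin d) A)[X]} (hQ : Q.Monic) (hS : ∀ j, (Q.coeff j).support ⊆ S)
    {a : ℕ} (ha : Q.natDegree = a) : ∃ u, Q = genMonic S a u := by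
  subst ha
  refine ⟨fun x => (Q.coeff x.1).coeff x.2.1, ?_⟩
  conv_lhs => rw [hQ.as_sum]
  rw [genMonic, Finset.sum_range]
  congr 1
  refine Finset.sum_congr rfl fun j _ => ?_
  congr 2
  conv_lhs => rw [MvPolynomial.as_sum (Q.coeff j)]
  rw [Finset.sum_coe_sort S fun m => MvPolynomial.monomial m ((Q.coeff j).coeff m)]
  refine Finset.sum_subset (hS j) fun m _ hm => ?_
  rw [MvPolynomial.notMem_support_iff.1 hm, MvPolynomial.monomial_zero]

open Polynomial in
/-- In a factorization over a domain, the coefficients of the factors have bounded degree. -/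
theorem totalDegree_coeff_le_of_dvd {σ A : Type*} [CommRing A] [IsDomain A]
    {P Q : (MvPolynomial σ A)[X]} (hP : P ≠ 0) (h : Q ∣ P) (j : ℕ) :
    (Q.coeff j).totalDegree ≤ ((MvPolynomial.optionEquivLeft A σ).symm P).totalDegree := by
  obtain ⟨R, rfl⟩ := h
  have hQ : Q ≠ 0 := left_ne_zero_of_mul hP
  have hR : R ≠ 0 := right_ne_zero_of_mul hP
  have h1 := MvPolynomial.totalDegree_coeff_optionEquivLeft_le A σ
    ((MvPolynomial.optionEquivLeft A σ).symm Q) j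
  rw [AlgEquiv.apply_symm_apply] at h1
  refine h1.trans ?_
  rw [map_mul, MvPolynomial.totalDegree_mul_of_isDomain]
  · exact Nat.le_add_right _ _
  · simpa using hQ
  · simpa using hR

open Polynomial in
theorem optionEquivLeft_symm_map {σ A B : Type*} [CommRing A] [CommRing B] (φ : A →+* B)
    (P : (MvPolynomial σ A)[X]) :
    (MvPolynomial.optionEquivLeft B σ).symm (P.map (MvPolynomial.map φ)) =
      MvPolynomial.map φ ((MvPolynomial.optionEquivLeft A σ).symm P) := by
  rw [AlgEquiv.symm_apply_eq]
  obtain ⟨p, rfl⟩ := (MvPolynomial.optionEquivLeft A σ).surjective P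
  rw [AlgEquiv.symm_apply_apply]
  induction p using MvPolynomial.induction_on with
  | C a => simp [MvPolynomial.optionEquivLeft_apply, MvPolynomial.algebraMap_eq]
  | add p q hp hq => simp only [map_add, Polynomial.map_add, hp, hq]
  | mul_X p i hp =>
    simp only [map_mul, Polynomial.map_mul, hp, MvPolynomial.map_X]
    cases i <;> simp [MvPolynomial.optionEquivLeft_apply]

theorem totalDegree_map_le {σ A B : Type*} [CommRing A] [CommRing B] (φ : A →+* B)
    (p : MvPolynomial σ A) : (MvPolynomial.map φ p).totalDegree ≤ p.totalDegree :=
  Finset.sup_mono (MvPolynomial.support_map_subset φ p)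

open Polynomial in
/-- The generic product of two monic polynomials of degrees `a` and `b`, minus `P`. -/
noncomputable def factorDefect {C : Type*} [CommRing C] {d : ℕ} (S : Finset (Fin d →₀ ℕ)) (a b : ℕ)
    (P : (MvPolynomial (Fin d) C)[X]) :
    (MvPolynomial (Fin d) (MvPolynomial ((Fin a × S) ⊕ (Fin b × S)) C))[X] :=
  genMonic S a (fun i => MvPolynomial.X (Sum.inl i)) *
    genMonic S b (fun i => MvPolynomial.X (Sum.inr i)) - P.map (MvPolynomial.map MvPolynomial.C)

open Polynomial in
theorem factorDefect_map {C F : Type*} [CommRing C] [CommRing F] {d : ℕ} (S : Finset (Fin d →₀ ℕ))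
    (a b : ℕ) (P : (MvPolynomial (Fin d) C)[X]) (c : C →+* F)
    (y : (Fin a × S) ⊕ (Fin b × S) → F) :
    (factorDefect S a b P).map (MvPolynomial.map (MvPolynomial.eval₂Hom c y)) =
      genMonic S a (y ∘ Sum.inl) * genMonic S b (y ∘ Sum.inr) - P.map (MvPolynomial.map c) := by
  rw [factorDefect, Polynomial.map_sub, Polynomial.map_mul, genMonic_map, genMonic_map,
    Polynomial.map_map]
  have h1 : (MvPolynomial.eval₂Hom c y) ∘ (fun i => MvPolynomial.X (Sum.inl i)) = y ∘ Sum.inl := by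
    funext i; simp
  have h2 : (MvPolynomial.eval₂Hom c y) ∘ (fun i => MvPolynomial.X (Sum.inr i)) = y ∘ Sum.inr := by
    funext i; simp
  have h3 : (MvPolynomial.map (MvPolynomial.eval₂Hom c y)).comp
      (MvPolynomial.map (σ := Fin d) MvPolynomial.C) = MvPolynomial.map c := by
    refine RingHom.ext fun x => ?_
    rw [RingHom.comp_apply, MvPolynomial.map_map]
    congr 1
    refine congrArg _ (RingHom.ext fun a => ?_)
    simp
  rw [h1, h2, h3]

open Polynomial in
theorem eval₂_coeff_factorDefect_eq_zero_iff {C F : Type*} [CommRing C] [CommRing F] {d : ℕ}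
    (S : Finset (Fin d →₀ ℕ)) (a b : ℕ) (P : (MvPolynomial (Fin d) C)[X]) (c : C →+* F)
    (y : (Fin a × S) ⊕ (Fin b × S) → F) :
    (∀ i m, MvPolynomial.eval₂ c y (((factorDefect S a b P).coeff i).coeff m) = 0) ↔
      genMonic S a (y ∘ Sum.inl) * genMonic S b (y ∘ Sum.inr) = P.map (MvPolynomial.map c) := by
  rw [← sub_eq_zero, ← factorDefect_map, Polynomial.ext_iff]
  refine forall_congr' fun i => ?_
  rw [Polynomial.coeff_map, MvPolynomial.ext_iff]
  refine forall_congr' fun m => ?_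
  rw [MvPolynomial.coeff_map, Polynomial.coeff_zero, MvPolynomial.coeff_zero]
  rfl

open Polynomial in
theorem exists_ne_zero_forall_no_factorization {C K Ω : Type*} [CommRing C] [IsDomain C] [Field K]
    [Algebra C K] [IsFractionRing C K] [Field Ω] [IsAlgClosed Ω] [Algebra K Ω] {d : ℕ}
    (S : Finset (Fin d →₀ ℕ)) (a b : ℕ) (P : (MvPolynomial (Fin d) C)[X])
    (h : ∀ u v, genMonic S a u * genMonic S b v ≠
      P.map (MvPolynomial.map ((algebraMap K Ω).comp (algebraMap C K)))) :
    ∃ g : C, g ≠ 0 ∧ ∀ (F : Type*) [Field F] (c : C →+* F),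
      (∃ u v, genMonic S a u * genMonic S b v = P.map (MvPolynomial.map c)) → c g = 0 := by
  obtain ⟨g, hg, hgc⟩ := exists_ne_zero_forall_eq_zero_of_common_zero (K := K) (Ω := Ω)
    {f | ∃ i m, f = ((factorDefect S a b P).coeff i).coeff m} (fun x => by
      by_contra! hx
      exact h _ _ ((eval₂_coeff_factorDefect_eq_zero_iff S a b P _ x).1
        fun i m => hx _ ⟨i, m, rfl⟩))
  refine ⟨g, hg, fun F _ c ⟨u, v, huv⟩ => hgc F c (Sum.elim u v) ?_⟩
  rintro _ ⟨i, m, rfl⟩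
  exact (eval₂_coeff_factorDefect_eq_zero_iff S a b P c (Sum.elim u v)).2 huv i m

open Polynomial in
/-- **Bertini–Noether**: a monic polynomial over a domain that is irreducible over an
algebraically closed extension remains irreducible after a general specialization. -/
theorem exists_ne_zero_forall_irreducible {C K Ω : Type*} [CommRing C] [IsDomain C] [Field K]
    [Algebra C K] [IsFractionRing C K] [Field Ω] [IsAlgClosed Ω] [Algebra K Ω] {d : ℕ}
    {P : (MvPolynomial (Fin d) C)[X]} (hP : P.Monic)
    (h : Irreducible (P.map (MvPolynomial.map ((algebraMap K Ω).comp (algebraMap C K))))) :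
    ∃ g : C, g ≠ 0 ∧ ∀ (F : Type*) [Field F] (c : C →+* F), c g ≠ 0 →
      Irreducible (P.map (MvPolynomial.map c)) := by
  let N := ((MvPolynomial.optionEquivLeft C (Fin d)).symm P).totalDegree
  let S : Finset (Fin d →₀ ℕ) := (Finsupp.finite_of_degree_le (σ := Fin d) N).toFinset
  let n := P.natDegree
  have h' := ((hP.map _).irreducible_iff_natDegree').1 h
  rw [hP.natDegree_map] at h'
  have key : ∀ b : ℕ, ∃ g : C, g ≠ 0 ∧ (b ∈ Finset.Ioc 0 (n / 2) → ∀ (F : Type _) [Field F]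
      (c : C →+* F), (∃ u v, genMonic S (n - b) u * genMonic S b v = P.map (MvPolynomial.map c)) →
        c g = 0) := by
    intro b
    by_cases hb : b ∈ Finset.Ioc 0 (n / 2)
    · obtain ⟨g, hg, hgc⟩ := exists_ne_zero_forall_no_factorization (K := K) (Ω := Ω) S (n - b) b P
        (fun u v huv => h'.2 _ _ (genMonic_monic S _ u) (genMonic_monic S _ v) huv (by
          rw [genMonic_natDegree]; exact hb))
      exact ⟨g, hg, fun _ => hgc⟩
    · exact ⟨1, one_ne_zero, fun h => absurd h hb⟩
  choose g hg hgc using key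
  refine ⟨∏ b ∈ Finset.Ioc 0 (n / 2), g b, Finset.prod_ne_zero_iff.2 fun b _ => hg b,
    fun F _ c hc => ?_⟩
  rw [(hP.map _).irreducible_iff_natDegree', hP.natDegree_map]
  refine ⟨fun h1 => h'.1 ?_, fun Q R hQ hR hQR hmem => ?_⟩
  · have h2 : P.natDegree = 0 := by
      rw [← hP.natDegree_map (MvPolynomial.map c), h1, natDegree_one]
    rw [hP.natDegree_eq_zero.1 h2, Polynomial.map_one]
  · refine hc ?_
    rw [map_prod]
    refine Finset.prod_eq_zero hmem (hgc _ hmem F c ?_)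
    have hsupp : ∀ Q', Q' ∣ P.map (MvPolynomial.map c) → ∀ j, (Q'.coeff j).support ⊆ S := by
      intro Q' hQ' j m hm
      rw [Set.Finite.mem_toFinset]
      have h3 := totalDegree_coeff_le_of_dvd (hP.map (MvPolynomial.map c)).ne_zero hQ' j
      rw [optionEquivLeft_symm_map] at h3
      exact (MvPolynomial.le_totalDegree hm).trans (h3.trans (totalDegree_map_le _ _))
    have hdeg : Q.natDegree = n - R.natDegree := by
      have := hQ.natDegree_mul hR
      rw [hQR, hP.natDegree_map] at this
      omega
    obtain ⟨u, hu⟩ := exists_eq_genMonic S hQ (hsupp Q ⟨R, hQR.symm⟩) hdeg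
    obtain ⟨v, hv⟩ := exists_eq_genMonic S hR (hsupp R ⟨Q, by rw [← hQR, mul_comm]⟩) rfl
    exact ⟨_, _, by rw [← hu, ← hv, hQR]⟩

end

section

theorem eq_zero_of_sum_algebraic_mul_eq_zero {K M Ω ι : Type*} [Field K] [Field M] [Field Ω]
    [Algebra K M] [Algebra M Ω] [Algebra K Ω] [IsScalarTower K M Ω]
    [IsGalois M Ω] (hK : ∀ x : M, IsAlgebraic K x → x ∈ Set.range (algebraMap K M))
    {b : ι → M} (hb : LinearIndependent K b) (s : Finset ι) :
    ∀ a : ι → Ω, (∀ i ∈ s, IsAlgebraic K (a i)) → ∑ i ∈ s, a i * algebraMap M Ω (b i) = 0 →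
      ∀ i ∈ s, a i = 0 := by
  induction s using Finset.strongInduction with
  | H s ih =>
    intro a ha h
    by_contra! hne
    obtain ⟨j, hj, hj0⟩ := hne
    have h1 : ∑ i ∈ s, (a i / a j) * algebraMap M Ω (b i) = 0 := by
      have : ∑ i ∈ s, (a i / a j) * algebraMap M Ω (b i) =
          (a j)⁻¹ * ∑ i ∈ s, a i * algebraMap M Ω (b i) := by
        rw [Finset.mul_sum]; exact Finset.sum_congr rfl fun i _ => by ring
      rw [this, h, mul_zero]
    have halg : ∀ i ∈ s, IsAlgebraic K (a i / a j) := fun i hi => by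
      rw [div_eq_mul_inv]; exact (ha i hi).mul (ha j hj).inv
    have hfix : ∀ τ : Ω ≃ₐ[M] Ω, ∀ i ∈ s, τ (a i / a j) = a i / a j := by
      intro τ i hi
      by_cases hij : i = j
      · rw [hij, div_self hj0, map_one]
      have h2 : ∑ i ∈ s.erase j, (τ (a i / a j) - a i / a j) * algebraMap M Ω (b i) = 0 := by
        have h3 : ∑ i ∈ s, (τ (a i / a j) - a i / a j) * algebraMap M Ω (b i) = 0 := by
          have h4 := congrArg τ h1
          rw [map_sum, map_zero] at h4
          simp only [map_mul, AlgEquiv.commutes] at h4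
          simp only [sub_mul, Finset.sum_sub_distrib, h4, h1, sub_zero]
        rw [← Finset.sum_erase_add _ _ hj, div_self hj0, map_one, sub_self, zero_mul,
          add_zero] at h3
        exact h3
      refine sub_eq_zero.1 (ih _ (Finset.erase_ssubset hj) _ (fun i hi => ?_) h2 i
        (Finset.mem_erase.2 ⟨hij, hi⟩))
      have h5 := halg i (Finset.mem_of_mem_erase hi)
      exact (h5.algHom (τ.toAlgHom.restrictScalars K)).sub h5
    have hm : ∀ i ∈ s, ∃ c : K, algebraMap K Ω c = a i / a j := by
      intro i hi
      obtain ⟨m, hm⟩ := (InfiniteGalois.mem_range_algebraMap_iff_fixed (k := M) (a i / a j)).2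
        fun τ => hfix τ i hi
      obtain ⟨c, rfl⟩ := hK m (by
        have := halg i hi
        rw [← hm] at this
        exact (isAlgebraic_algebraMap_iff (algebraMap M Ω).injective).1 this)
      exact ⟨c, by rw [IsScalarTower.algebraMap_apply K M Ω, hm]⟩
    choose! c hc using hm
    have h6 : ∑ i ∈ s, c i • b i = 0 := by
      apply (algebraMap M Ω).injective
      rw [map_sum, map_zero, ← h1]
      refine Finset.sum_congr rfl fun i hi => ?_
      rw [Algebra.smul_def, map_mul, ← IsScalarTower.algebraMap_apply, hc i hi]
    have h7 := linearIndependent_iff'.1 hb s c h6 j hj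
    have h8 := hc j hj
    rw [h7, map_zero, div_self hj0] at h8
    exact zero_ne_one h8

open Polynomial in
theorem linearIndependent_of_no_relation {D A : Type*} [CommRing D] [CommRing A] [Algebra D A]
    {θ : A} {n : ℕ} (h : ∀ f : D[X], f.natDegree < n → aeval θ f = 0 → f = 0) :
    LinearIndependent D fun i : Fin n => θ ^ (i : ℕ) := by
  rw [Fintype.linearIndependent_iff]
  intro g hg i
  have := h (∑ j : Fin n, C (g j) * X ^ (j : ℕ)) ?_ ?_
  · have h2 := congrArg (fun f => coeff f i) this
    simpa [finsetSum_coeff, coeff_C_mul, coeff_X_pow, Fin.val_inj] using h2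
  · have hn : 0 < n := i.pos
    refine lt_of_le_of_lt (natDegree_sum_le_of_forall_le (n := n - 1) _ _ fun j _ => ?_) (by omega)
    exact (natDegree_C_mul_X_pow_le _ _).trans (by omega)
  · simpa [Algebra.smul_def] using hg

open Polynomial in
theorem irreducible_map_algebraicClosure {C K M Ω Ω' : Type*} [CommRing C] [Field K]
    [Field M] [Field Ω] [Field Ω'] [Algebra C K] [IsFractionRing C K] [Algebra C M]
    [Algebra K M] [IsScalarTower C K M] [Algebra M Ω] [Algebra K Ω] [IsScalarTower K M Ω]
    [IsGalois M Ω] (hK : ∀ x : M, IsAlgebraic K x → x ∈ Set.range (algebraMap K M))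
    [Algebra K Ω'] [Algebra.IsAlgebraic K Ω'] (j : Ω' →ₐ[K] Ω)
    {d : ℕ} (t : Fin d → M) (θ : M) {P : (MvPolynomial (Fin d) C)[X]} (hP : P.Monic)
    (hP0 : P.eval₂ (MvPolynomial.aeval t : MvPolynomial (Fin d) C →ₐ[C] M).toRingHom θ = 0)
    (hn : P ≠ 1)
    (hli : LinearIndependent C fun x : (Fin d →₀ ℕ) × Fin P.natDegree =>
      (∏ i, t i ^ x.1 i) * θ ^ (x.2 : ℕ)) :
    Irreducible (P.map (MvPolynomial.map ((algebraMap K Ω').comp (algebraMap C K)))) := by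
  set φ : C →+* Ω' := (algebraMap K Ω').comp (algebraMap C K) with hφ
  have hli' : LinearIndependent K fun x : (Fin d →₀ ℕ) × Fin P.natDegree =>
      (∏ i, t i ^ x.1 i) * θ ^ (x.2 : ℕ) := (LinearIndependent.iff_fractionRing C K).1 hli
  let ψ : MvPolynomial (Fin d) Ω' →+* Ω :=
    MvPolynomial.eval₂Hom j.toRingHom fun i => algebraMap M Ω (t i)
  have hψ : ψ.comp (MvPolynomial.map φ) = (algebraMap M Ω).comp
      (MvPolynomial.aeval t : MvPolynomial (Fin d) C →ₐ[C] M).toRingHom := by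
    ext x
    · simp [ψ, hφ]
      rw [IsScalarTower.algebraMap_apply K M Ω, ← IsScalarTower.algebraMap_apply C K M]
    · simp [ψ]
  have key : ∀ Q : (MvPolynomial (Fin d) Ω')[X], Q.natDegree < P.natDegree →
      Q.eval₂ ψ (algebraMap M Ω θ) = 0 → Q = 0 := by
    intro Q hQ h
    let s : Finset (Fin d →₀ ℕ) := (Finset.range P.natDegree).biUnion fun l => (Q.coeff l).support
    have h1 : ∑ x ∈ s ×ˢ (Finset.univ : Finset (Fin P.natDegree)),
        j (MvPolynomial.coeff x.1 (Q.coeff x.2)) *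
          algebraMap M Ω ((∏ i, t i ^ x.1 i) * θ ^ (x.2 : ℕ)) = 0 := by
      rw [← h, eval₂_eq_sum_range' _ hQ, Finset.sum_product_right, ← Fin.sum_univ_eq_sum_range
        (fun l => ψ (Q.coeff l) * algebraMap M Ω θ ^ l)]
      refine Finset.sum_congr rfl fun l _ => ?_
      have h2 : ψ (Q.coeff l) = ∑ m ∈ s, j (MvPolynomial.coeff m (Q.coeff l)) *
          ∏ i, algebraMap M Ω (t i) ^ m i := by
        simp only [ψ, MvPolynomial.coe_eval₂Hom, MvPolynomial.eval₂_eq']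
        refine Finset.sum_subset (fun m hm => Finset.mem_biUnion.2 ⟨l, by simp, hm⟩)
          fun m _ hm => ?_
        rw [MvPolynomial.notMem_support_iff.1 hm, map_zero, zero_mul]
      rw [h2, Finset.sum_mul]
      refine Finset.sum_congr rfl fun m _ => ?_
      simp only [map_mul, map_prod, map_pow]; ring
    have h2 := eq_zero_of_sum_algebraic_mul_eq_zero hK hli' _ _
      (fun x _ => (Algebra.IsAlgebraic.isAlgebraic (R := K) _).algHom j) h1
    ext l m
    rw [coeff_zero, MvPolynomial.coeff_zero]
    by_cases hl : l < P.natDegree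
    · by_cases hm : m ∈ (Q.coeff l).support
      · have := h2 (m, ⟨l, hl⟩) (by
          simp only [Finset.mem_product, Finset.mem_univ, and_true]
          exact Finset.mem_biUnion.2 ⟨l, by simpa using hl, hm⟩)
        exact j.injective (by simpa using this)
      · exact MvPolynomial.notMem_support_iff.1 hm
    · rw [coeff_eq_zero_of_natDegree_lt (by omega), MvPolynomial.coeff_zero]
  rw [(hP.map _).irreducible_iff_natDegree']
  refine ⟨fun h => hn ?_, fun f g hf hg hfg hmem => ?_⟩
  · have h2 : P.natDegree = 0 := by
      rw [← hP.natDegree_map (MvPolynomial.map φ), h, natDegree_one]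
    rw [hP.natDegree_eq_zero.1 h2]
  · rw [hP.natDegree_map, Finset.mem_Ioc] at hmem
    have hdeg := hf.natDegree_mul hg
    rw [hfg, hP.natDegree_map] at hdeg
    have h0 : f.eval₂ ψ (algebraMap M Ω θ) * g.eval₂ ψ (algebraMap M Ω θ) = 0 := by
      rw [← eval₂_mul, hfg, eval₂_map, hψ, ← hom_eval₂, hP0, map_zero]
    rcases mul_eq_zero.1 h0 with h0 | h0
    · exact hf.ne_zero (key f (by omega) h0)
    · exact hg.ne_zero (key g (by omega) h0)

end

section

/-- The elements of `A` which lie in `S` after multiplication by a power of `g`. -/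
def Subalgebra.away {k A : Type*} [CommRing k] [CommRing A] [Algebra k A] (S : Subalgebra k A)
    (g : S) : Subalgebra k A where
  carrier := {x | ∃ n : ℕ, (g : A) ^ n * x ∈ S}
  mul_mem' := by
    rintro x y ⟨m, hm⟩ ⟨n, hn⟩
    exact ⟨m + n, by simpa [pow_add, mul_mul_mul_comm] using S.mul_mem hm hn⟩
  add_mem' := by
    rintro x y ⟨m, hm⟩ ⟨n, hn⟩
    refine ⟨m + n, ?_⟩
    have h := S.add_mem (S.mul_mem (S.pow_mem g.2 n) hm) (S.mul_mem (S.pow_mem g.2 m) hn)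
    convert h using 1
    ring
  algebraMap_mem' r := ⟨0, by simp⟩

theorem exists_forall_mem_away {k A : Type*} [CommRing k] [CommRing A] [Algebra k A]
    (S : Subalgebra k A) (T : Submonoid S) (s : Finset A)
    (h : ∀ x ∈ s, ∃ g ∈ T, (g : A) * x ∈ S) :
    ∃ g ∈ T, ∀ g', g ∣ g' → Algebra.adjoin k (s : Set A) ≤ S.away g' := by
  choose! g hgT hg using h
  refine ⟨∏ x ∈ s, g x, T.prod_mem hgT, fun g' hg' => Algebra.adjoin_le fun x hx => ?_⟩
  obtain ⟨c, hc⟩ := (Finset.dvd_prod_of_mem g hx).trans hg'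
  refine ⟨1, ?_⟩
  have := S.mul_mem c.2 (hg x hx)
  rw [hc]
  simpa [mul_comm, mul_assoc, mul_left_comm] using this

open Polynomial IntermediateField in
theorem exists_generic_primitive_element (D A : Type*) [CommRing D] [IsDomain D] [CharZero D]
    [CommRing A] [IsDomain A] [Algebra D A] [FaithfulSMul D A] [Algebra.FiniteType D A]
    [Algebra.IsAlgebraic D A] :
    ∃ (θ : A) (P : D[X]), P.Monic ∧ aeval θ P = 0 ∧
      (∀ f : D[X], f.natDegree < P.natDegree → aeval θ f = 0 → f = 0) ∧
      ∃ s : D, s ≠ 0 ∧ ∀ x : A, ∃ (k : ℕ) (f : D[X]), s ^ k • x = aeval θ f := by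
  let K := FractionRing D
  let L := FractionRing A
  let _ : Algebra K L := FractionRing.liftAlgebra D L
  have _ : IsScalarTower D K L := FractionRing.isScalarTower_liftAlgebra D L
  have _ : Algebra.IsAlgebraic A L := IsLocalization.isAlgebraic L (nonZeroDivisors A)
  have _ : Algebra.IsAlgebraic D L := Algebra.IsAlgebraic.trans D A L
  have _ : Algebra.IsAlgebraic K L := (IsFractionRing.comap_isAlgebraic_iff (A := D)).1 inferInstance
  have hinj : Function.Injective (algebraMap A L) := IsFractionRing.injective A L
  have hinjK : Function.Injective (algebraMap D K) := IsFractionRing.injective D K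
  have _ : CharZero K := charZero_of_injective_algebraMap hinjK
  have hloc : IsLocalization (Algebra.algebraMapSubmonoid A (nonZeroDivisors D)) L := inferInstance
  have hfrac : ∀ x : L, ∃ (a : A) (c : K), x = c • algebraMap A L a := by
    intro x
    obtain ⟨⟨a, ⟨_, δ, hδ, rfl⟩⟩, ha⟩ :=
      IsLocalization.surj (Algebra.algebraMapSubmonoid A (nonZeroDivisors D)) x
    refine ⟨a, (algebraMap D K δ)⁻¹, ?_⟩
    have h0 : algebraMap D K δ ≠ 0 := IsLocalization.to_map_ne_zero_of_mem_nonZeroDivisors K le_rfl hδ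
    rw [eq_inv_smul_iff₀ h0, ← ha, algebraMap_smul, Algebra.smul_def, mul_comm,
      IsScalarTower.algebraMap_apply D A L]
  obtain ⟨S, hS⟩ := (Algebra.FiniteType.out : (⊤ : Subalgebra D A).FG)
  have htop : IntermediateField.adjoin K (algebraMap A L '' (S : Set A)) = ⊤ := by
    rw [eq_top_iff]
    intro x _
    obtain ⟨a, c, rfl⟩ := hfrac x
    refine IntermediateField.smul_mem _ ?_
    have h1 : algebraMap A L a ∈ Algebra.adjoin D (algebraMap A L '' (S : Set A)) := by
      have h2 : (⊤ : Subalgebra D A).map (IsScalarTower.toAlgHom D A L) =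
          Algebra.adjoin D (algebraMap A L '' (S : Set A)) := by
        rw [← hS, AlgHom.map_adjoin]; rfl
      rw [← h2]
      exact ⟨a, trivial, rfl⟩
    have h3 : Algebra.adjoin D (algebraMap A L '' (S : Set A)) ≤
        (IntermediateField.adjoin K (algebraMap A L '' (S : Set A))).toSubalgebra.restrictScalars D :=
      Algebra.adjoin_le (IntermediateField.subset_adjoin K _)
    exact h3 h1
  have hfin : FiniteDimensional K L := by
    have _ : Finite (algebraMap A L '' (S : Set A)) := (S.finite_toSet.image _).to_subtype
    have h1 := IntermediateField.finiteDimensional_adjoin (K := K)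
      (S := algebraMap A L '' (S : Set A)) fun x _ => (Algebra.IsAlgebraic.isAlgebraic x).isIntegral
    rw [htop] at h1
    exact (IntermediateField.topEquiv (F := K) (E := L)).toLinearEquiv.finiteDimensional
  obtain ⟨α, hα⟩ := Field.exists_primitive_element K L
  obtain ⟨a, c, rfl⟩ := hfrac α
  have ha : K⟮algebraMap A L a⟯ = ⊤ := by
    rw [eq_top_iff, ← hα, IntermediateField.adjoin_simple_le_iff]
    exact IntermediateField.smul_mem _ (IntermediateField.mem_adjoin_simple_self K _)
  have hintegral : IsIntegral K (algebraMap A L a) := (Algebra.IsAlgebraic.isAlgebraic _).isIntegral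
  obtain ⟨⟨s, hs⟩, hs'⟩ := IsLocalization.exist_integer_multiples_of_finset (nonZeroDivisors D)
    (minpoly K (algebraMap A L a)).coeffs
  have hs0 : s ≠ 0 := nonZeroDivisors.ne_zero hs
  have hmonic : ((minpoly K (algebraMap A L a)).scaleRoots (algebraMap D K s)).Monic :=
    (monic_scaleRoots_iff _).2 (minpoly.monic hintegral)
  obtain ⟨P, hPmap, hPdeg, hP⟩ := lifts_and_natDegree_eq_and_monic (f := algebraMap D K) (by
    rw [lifts_iff_coeff_lifts]
    intro i
    rw [coeff_scaleRoots]
    by_cases h0 : (minpoly K (algebraMap A L a)).coeff i = 0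
    · exact ⟨0, by simp [h0]⟩
    by_cases hi : i = (minpoly K (algebraMap A L a)).natDegree
    · refine ⟨1, ?_⟩
      rw [hi, Nat.sub_self, pow_zero, mul_one, coeff_natDegree, (minpoly.monic hintegral).leadingCoeff,
        map_one]
    obtain ⟨b, hb⟩ := hs' _ (coeff_mem_coeffs h0)
    have hlt := lt_of_le_of_ne (le_natDegree_of_ne_zero h0) hi
    refine ⟨b * s ^ ((minpoly K (algebraMap A L a)).natDegree - i - 1), ?_⟩
    rw [map_mul, hb, map_pow, Algebra.smul_def]
    obtain ⟨m, hm⟩ : ∃ m, (minpoly K (algebraMap A L a)).natDegree - i = m + 1 :=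
      ⟨(minpoly K (algebraMap A L a)).natDegree - i - 1, by omega⟩
    rw [hm, Nat.add_sub_cancel, pow_succ]
    ring) hmonic
  let θ : A := s • a
  have hθ : algebraMap A L θ = algebraMap K L (algebraMap D K s) * algebraMap A L a := by
    rw [← IsScalarTower.algebraMap_apply, ← Algebra.smul_def]
    exact algebraMap.coe_smul s a L
  have haeval : ∀ f : D[X], algebraMap A L (aeval θ f) =
      aeval (algebraMap A L θ) (f.map (algebraMap D K)) := fun f => by
    rw [aeval_map_algebraMap, aeval_algebraMap_apply]
  have hθtop : K⟮algebraMap A L θ⟯ = ⊤ := by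
    rw [eq_top_iff, ← ha, IntermediateField.adjoin_simple_le_iff]
    have h0 : algebraMap D K s ≠ 0 := IsLocalization.to_map_ne_zero_of_mem_nonZeroDivisors K le_rfl hs
    have h1 : algebraMap A L a = (algebraMap D K s)⁻¹ • algebraMap A L θ := by
      rw [eq_inv_smul_iff₀ h0, hθ, Algebra.smul_def]
    rw [h1]
    exact IntermediateField.smul_mem _ (IntermediateField.mem_adjoin_simple_self K _)
  have hdeg : (minpoly K (algebraMap A L θ)).natDegree = P.natDegree := by
    rw [hPdeg, natDegree_scaleRoots, (Field.primitive_element_iff_minpoly_natDegree_eq K _).1 ha,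
      (Field.primitive_element_iff_minpoly_natDegree_eq K _).1 hθtop]
  have hroot : aeval θ P = 0 := by
    apply hinj
    rw [haeval, hPmap, hθ, map_zero]
    exact scaleRoots_aeval_eq_zero (minpoly.aeval _ _)
  refine ⟨θ, P, hP, hroot, fun f hf h0 => ?_, ?_⟩
  · by_contra hne
    have h1 : f.map (algebraMap D K) ≠ 0 := (Polynomial.map_ne_zero_iff hinjK).2 hne
    have h2 := natDegree_le_natDegree (minpoly.degree_le_of_ne_zero K (algebraMap A L θ) h1
      (by rw [← haeval, h0, map_zero]))
    rw [hdeg, natDegree_map_eq_of_injective hinjK] at h2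
    omega
  · have hgen : ∀ x : A, ∃ δ : D, δ ≠ 0 ∧ δ • x ∈ Algebra.adjoin D {θ} := by
      intro x
      have h1 : algebraMap A L x ∈ K⟮algebraMap A L θ⟯.toSubalgebra := by
        rw [hθtop]; trivial
      rw [IntermediateField.adjoin_simple_toSubalgebra_of_isAlgebraic
        (Algebra.IsAlgebraic.isAlgebraic _), Algebra.adjoin_singleton_eq_range_aeval] at h1
      obtain ⟨q, hq⟩ := h1
      obtain ⟨b, hb, hb'⟩ := IsLocalization.integerNormalization_spec (nonZeroDivisors D) q
      refine ⟨b, nonZeroDivisors.ne_zero hb, ?_⟩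
      rw [Algebra.adjoin_singleton_eq_range_aeval]
      refine ⟨IsLocalization.integerNormalization (nonZeroDivisors D) q, hinj ?_⟩
      change algebraMap A L (aeval θ _) = _
      rw [haeval, hb', ← algebraMap_smul K b q, map_smul, algebraMap_smul]
      exact (congrArg _ hq).trans (algebraMap.coe_smul b x L).symm
    have h2 : ∃ g ∈ (nonZeroDivisors D).map
        (algebraMap D (Algebra.adjoin D {θ})), ∀ g', g ∣ g' →
        Algebra.adjoin D (S : Set A) ≤ (Algebra.adjoin D {θ}).away g' := by
      refine exists_forall_mem_away _ _ _ fun x _ => ?_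
      obtain ⟨δ, hδ, hδx⟩ := hgen x
      refine ⟨_, ⟨δ, mem_nonZeroDivisors_of_ne_zero hδ, rfl⟩, ?_⟩
      rw [Algebra.smul_def] at hδx
      exact hδx
    obtain ⟨_, ⟨δ, hδ, rfl⟩, h3⟩ := h2
    refine ⟨δ, nonZeroDivisors.ne_zero hδ, fun x => ?_⟩
    obtain ⟨n, hn⟩ := h3 _ dvd_rfl (hS ▸ Algebra.mem_top : x ∈ Algebra.adjoin D (S : Set A))
    rw [Algebra.adjoin_singleton_eq_range_aeval] at hn
    obtain ⟨f, hf⟩ := hn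
    refine ⟨n, f, ?_⟩
    rw [Algebra.smul_def, map_pow]
    exact hf.symm

end

section

theorem exists_algHom_ker_eq {k A : Type*} [Field k] [IsAlgClosed k] [CommRing A] [Algebra k A]
    [Algebra.FiniteType k A] (m : Ideal A) [hm : m.IsMaximal] :
    ∃ ρ : A →ₐ[k] k, RingHom.ker ρ = m := by
  let _ : Field (A ⧸ m) := Ideal.Quotient.field m
  have _ : Algebra.FiniteType k (A ⧸ m) :=
    Algebra.FiniteType.of_surjective (Ideal.Quotient.mkₐ k m) (Ideal.Quotient.mkₐ_surjective k m)
  have _ := finite_of_finite_type_of_isJacobsonRing k (A ⧸ m)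
  have hb := IsAlgClosed.algebraMap_bijective_of_isIntegral (k := k) (K := A ⧸ m)
  let e : k ≃ₐ[k] A ⧸ m := AlgEquiv.ofBijective (Algebra.ofId k _) hb
  refine ⟨e.symm.toAlgHom.comp (Ideal.Quotient.mkₐ k m), ?_⟩
  ext x
  rw [RingHom.mem_ker]
  simp [Ideal.Quotient.eq_zero_iff_mem]

theorem AlgHom.eq_of_ker_le {k A : Type*} [CommRing k] [CommRing A] [Algebra k A]
    {ρ σ : A →ₐ[k] k} (h : ∀ x, ρ x = 0 → σ x = 0) : ρ = σ := by
  ext x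
  have := h (x - algebraMap k A (ρ x)) (by simp)
  rw [map_sub, AlgHom.commutes] at this
  exact (sub_eq_zero.1 this).symm

theorem mem_of_forall_algHom_eq_zero {k A : Type*} [Field k] [IsAlgClosed k] [CommRing A]
    [Algebra k A] [Algebra.FiniteType k A] {q : Ideal A} [hq : q.IsPrime] {x : A}
    (h : ∀ ρ : A →ₐ[k] k, (∀ y ∈ q, ρ y = 0) → ρ x = 0) : x ∈ q := by
  have hJ : IsJacobsonRing A := isJacobsonRing_of_finiteType (A := k)
  rw [← IsJacobsonRing.out hJ hq.isRadical, Ideal.jacobson, Ideal.mem_sInf]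
  rintro m ⟨hqm, hm⟩
  obtain ⟨ρ, hρ⟩ := exists_algHom_ker_eq (k := k) m
  rw [← hρ] at hqm ⊢
  exact h ρ hqm

open Polynomial in
theorem exists_mul_eq_add_of_not_dvd {S : Type*} [CommRing S] [IsDomain S] {P f : S[X]}
    (hm : P.Monic) (hP : Prime P) (hf : ¬ P ∣ f) :
    ∃ (u w : S[X]) (r : S), r ≠ 0 ∧ f * u = C r + P * w := by
  have _ := AdjoinRoot.isDomain_of_prime hP
  have _ := hm.finite_adjoinRoot
  have h0 : AdjoinRoot.mk P f ≠ 0 := fun h => hf (AdjoinRoot.mk_eq_zero.1 h)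
  have h1 : IsAlgebraic S (AdjoinRoot.mk P f) :=
    (Algebra.IsIntegral.isIntegral (R := S) (AdjoinRoot.mk P f)).isAlgebraic
  obtain ⟨r, hr, y, hy⟩ := h1.exists_nonzero_dvd (mem_nonZeroDivisors_of_ne_zero h0)
  obtain ⟨u, rfl⟩ := AdjoinRoot.mk_surjective y
  rw [← map_mul] at hy
  have h2 : AdjoinRoot.mk P (C r) = AdjoinRoot.mk P (f * u) := hy
  obtain ⟨w, hw⟩ := AdjoinRoot.mk_eq_mk.1 h2.symm
  exact ⟨u, w, r, hr, by rw [← hw]; ring⟩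

open Polynomial in
theorem aeval_mem_iff_map_dvd {D A S : Type*} [CommRing D] [CommRing A] [CommRing S] [IsDomain S]
    [Algebra D A] {γ : D →+* S} (hγ : Function.Surjective γ) {θ : A} {P : D[X]} (hm : P.Monic)
    (hP0 : aeval θ P = 0) (hP : Prime (P.map γ)) {q : Ideal A} [q.IsPrime]
    (h : ∀ x, algebraMap D A x ∈ q ↔ γ x = 0) (f : D[X]) :
    aeval θ f ∈ q ↔ P.map γ ∣ f.map γ := by
  have key : ∀ f : D[X], f.map γ = 0 → aeval θ f ∈ q := by
    intro f hf
    rw [aeval_eq_sum_range]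
    refine Ideal.sum_mem _ fun i _ => ?_
    rw [Algebra.smul_def]
    refine Ideal.mul_mem_right _ _ ((h _).2 ?_)
    rw [← coeff_map, hf, coeff_zero]
  constructor
  · intro hf
    by_contra hnd
    obtain ⟨u, w, r, hr, huw⟩ := exists_mul_eq_add_of_not_dvd (hm.map γ) hP hnd
    obtain ⟨u, rfl⟩ := Polynomial.map_surjective γ hγ u
    obtain ⟨w, rfl⟩ := Polynomial.map_surjective γ hγ w
    obtain ⟨r, rfl⟩ := hγ r
    have h1 := key (f * u - C r - P * w) (by
      rw [Polynomial.map_sub, Polynomial.map_sub, Polynomial.map_mul, Polynomial.map_mul, huw,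
        Polynomial.map_C]; ring)
    rw [map_sub, map_sub, map_mul, map_mul, hP0, zero_mul, sub_zero, aeval_C] at h1
    have h2 : algebraMap D A r ∈ q := by
      have := q.sub_mem (q.mul_mem_right (aeval θ u) hf) h1
      simpa using this
    exact hr ((h r).1 h2)
  · rintro ⟨w, hw⟩
    obtain ⟨w, rfl⟩ := Polynomial.map_surjective γ hγ w
    have h1 := key (f - P * w) (by rw [Polynomial.map_sub, Polynomial.map_mul, hw, sub_self])
    rwa [map_sub, map_mul, hP0, zero_mul, sub_zero] at h1

end

section

theorem exists_prime_mem_iff_map_eq_zero {k R C A : Type*} [Field k]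
    [CommRing R] [CommRing C] [CommRing A] [IsDomain R] [IsDomain A]
    [Algebra k R] [Algebra k C] [Algebra k A] [Algebra R C] [Algebra R A] [Algebra C A]
    [IsScalarTower k R C] [IsScalarTower R C A] [IsScalarTower k C A]
    [Algebra.IsIntegral R C] {d : ℕ} [IsIntegrallyClosed (MvPolynomial (Fin d) R)]
    {t : Fin d → A} (ht : Function.Injective (MvPolynomial.aeval (R := R) t))
    (hintegral : (MvPolynomial.aeval (R := R) t).toRingHom.IsIntegral)
    (c : C →ₐ[k] k) (ρ : A →ₐ[k] k) (hρ : ∀ x, ρ (algebraMap C A x) = c x) :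
    ∃ q : Ideal A, q.IsPrime ∧ (∀ y ∈ q, ρ y = 0) ∧
      ∀ f : MvPolynomial (Fin d) C,
        MvPolynomial.aeval t f ∈ q ↔ MvPolynomial.map c.toRingHom f = 0 := by
  let l : R →+* k := c.toRingHom.comp (algebraMap R C)
  have hl : ∀ x : k, l (algebraMap k R x) = x := fun x => by
    change c (algebraMap R C (algebraMap k R x)) = x
    rw [← IsScalarTower.algebraMap_apply, c.commutes]; rfl
  let _ : Algebra (MvPolynomial (Fin d) R) A := (MvPolynomial.aeval (R := R) t).toAlgebra
  have halg : ∀ f, algebraMap (MvPolynomial (Fin d) R) A f = MvPolynomial.aeval t f := fun _ => rfl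
  have _ : FaithfulSMul (MvPolynomial (Fin d) R) A :=
    (faithfulSMul_iff_algebraMap_injective _ _).2 ht
  have _ : Algebra.IsIntegral (MvPolynomial (Fin d) R) A := ⟨hintegral⟩
  have hcoef : ∀ f : MvPolynomial (Fin d) C, MvPolynomial.map c.toRingHom f =
      0 → ∀ q : Ideal A, (∀ x, c x = 0 → algebraMap C A x ∈ q) → MvPolynomial.aeval t f ∈ q := by
    intro f hf q hq
    rw [MvPolynomial.aeval_def, MvPolynomial.eval₂_eq]
    refine Ideal.sum_mem _ fun m _ => q.mul_mem_right _ (hq _ ?_)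
    have := congrArg (MvPolynomial.coeff m) hf
    rwa [MvPolynomial.coeff_map, MvPolynomial.coeff_zero] at this
  have hBD : ∀ f : MvPolynomial (Fin d) R, MvPolynomial.aeval t f =
      MvPolynomial.aeval t (MvPolynomial.map (algebraMap R C) f) := fun f =>
    (MvPolynomial.aeval_map_algebraMap C t f).symm
  have hmaps : ∀ f : MvPolynomial (Fin d) R, MvPolynomial.map c.toRingHom
      (MvPolynomial.map (algebraMap R C) f) = MvPolynomial.map l f := fun f => by
    rw [MvPolynomial.map_map]
  let p : Ideal (MvPolynomial (Fin d) R) := RingHom.ker (MvPolynomial.map (σ := Fin d) l)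
  let m : Ideal A := RingHom.ker ρ
  have hp : p.IsPrime := RingHom.ker_isPrime _
  have hm : m.IsPrime := RingHom.ker_isPrime _
  have hpm : p ≤ m.comap (algebraMap (MvPolynomial (Fin d) R) A) := by
    intro f hf
    rw [Ideal.mem_comap, halg, hBD]
    refine hcoef _ ((hmaps f).trans hf) m fun x hx => ?_
    rw [RingHom.mem_ker, hρ, hx]
  have hm' : (m.comap (algebraMap (MvPolynomial (Fin d) R) A)).IsPrime := inferInstance
  have _ : m.LiesOver (m.comap (algebraMap (MvPolynomial (Fin d) R) A)) := ⟨rfl⟩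
  have _ : Algebra.HasGoingDown (MvPolynomial (Fin d) R) A := inferInstance
  obtain ⟨q, hqm, hq, ⟨hqp⟩⟩ := Ideal.exists_ideal_le_liesOver_of_le (p := p)
    (q := m.comap (algebraMap (MvPolynomial (Fin d) R) A)) m hpm
  have hqB : ∀ f : MvPolynomial (Fin d) R,
      MvPolynomial.aeval t f ∈ q ↔ MvPolynomial.map l f = 0 := by
    intro f
    rw [← halg, ← Ideal.mem_under, ← hqp, RingHom.mem_ker]
  have hqC : ∀ x, c x = 0 → algebraMap C A x ∈ q := by
    have h1 : (q.comap (algebraMap C A)).comap (algebraMap R C) = RingHom.ker l := by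
      ext x
      rw [Ideal.mem_comap, Ideal.mem_comap, ← IsScalarTower.algebraMap_apply, RingHom.mem_ker]
      have := hqB (MvPolynomial.C x)
      rwa [MvPolynomial.aeval_C, MvPolynomial.map_C, ← map_zero MvPolynomial.C,
        (MvPolynomial.C_injective _ _).eq_iff] at this
    have h2 : (RingHom.ker l).IsMaximal := RingHom.ker_isMaximal_of_surjective l fun x => ⟨_, hl x⟩
    have h3 : (q.comap (algebraMap C A)).IsMaximal :=
      Ideal.isMaximal_of_isIntegral_of_isMaximal_comap _ (R := R) (h1 ▸ h2)
    have h4 : q.comap (algebraMap C A) = RingHom.ker c :=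
      h3.eq_of_le (RingHom.ker_ne_top _) fun x hx => by
        have := hqm hx
        rw [RingHom.mem_ker] at this ⊢
        rw [← hρ]; exact this
    intro x hx
    have : x ∈ q.comap (algebraMap C A) := by rw [h4]; exact hx
    exact this
  refine ⟨q, hq, fun y hy => hqm hy, fun f => ⟨fun hf => ?_, fun hf => hcoef f hf q hqC⟩⟩
  let f' : MvPolynomial (Fin d) R :=
    MvPolynomial.map (algebraMap k R) (MvPolynomial.map c.toRingHom f)
  have h1 : MvPolynomial.map l f' = MvPolynomial.map c.toRingHom f := by
    have : l.comp (algebraMap k R) = RingHom.id k := RingHom.ext hl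
    rw [MvPolynomial.map_map, this, MvPolynomial.map_id]
  rw [← h1, ← hqB, hBD]
  have h2 : MvPolynomial.aeval t (f - MvPolynomial.map (algebraMap R C) f') ∈ q :=
    hcoef _ (by rw [map_sub, hmaps, h1, sub_self]) q hqC
  rw [map_sub] at h2
  have := q.sub_mem hf h2
  simpa using this

open Polynomial in
theorem exists_ne_zero_forall_algHom {k R C A K M : Type*} [Field k] [IsAlgClosed k] [CharZero k]
    [CommRing R] [CommRing C] [CommRing A] [IsDomain R] [IsDomain C] [IsDomain A]
    [Algebra k R] [Algebra k C] [Algebra k A] [Algebra R C] [Algebra R A] [Algebra C A]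
    [IsScalarTower k R C] [IsScalarTower R C A] [IsScalarTower k C A] [Algebra.FiniteType k A]
    [Algebra.IsIntegral R C] {d : ℕ} [IsIntegrallyClosed (MvPolynomial (Fin d) R)]
    {t : Fin d → A} (ht : Function.Injective (MvPolynomial.aeval (R := R) t))
    (hintegral : (MvPolynomial.aeval (R := R) t).toRingHom.IsIntegral)
    [Field K] [Field M] [Algebra C K] [IsFractionRing C K] [Algebra C M] [Algebra A M]
    [Algebra K M] [IsScalarTower C K M] [IsScalarTower C A M] [FaithfulSMul A M]
    (hK : ∀ x : M, IsAlgebraic K x → x ∈ Set.range (algebraMap K M)) :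
    ∃ h : C, h ≠ 0 ∧ ∀ c : C →ₐ[k] k, c h ≠ 0 →
      (∃ ρ : A →ₐ[k] k, ∀ x, ρ (algebraMap C A x) = c x) ∧
      ∀ f g : A, (∀ ρ : A →ₐ[k] k, (∀ x, ρ (algebraMap C A x) = c x) → ρ (f * g) = 0) →
        (∀ ρ : A →ₐ[k] k, (∀ x, ρ (algebraMap C A x) = c x) → ρ f = 0) ∨
        (∀ ρ : A →ₐ[k] k, (∀ x, ρ (algebraMap C A x) = c x) → ρ g = 0) := by
  let _ : Algebra (MvPolynomial (Fin d) C) A := (MvPolynomial.aeval (R := C) t).toAlgebra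
  have halg : ∀ f, algebraMap (MvPolynomial (Fin d) C) A f = MvPolynomial.aeval t f := fun _ => rfl
  have hBD : ∀ f : MvPolynomial (Fin d) R, MvPolynomial.aeval t f =
      MvPolynomial.aeval t (MvPolynomial.map (algebraMap R C) f) := fun f =>
    (MvPolynomial.aeval_map_algebraMap C t f).symm
  have _ : IsScalarTower C (MvPolynomial (Fin d) C) A :=
    IsScalarTower.of_algebraMap_eq fun x => by rw [halg]; simp
  have _ : IsScalarTower k (MvPolynomial (Fin d) C) A :=
    IsScalarTower.of_algebraMap_eq fun x => by
      rw [IsScalarTower.algebraMap_apply k C A, IsScalarTower.algebraMap_apply k C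
        (MvPolynomial (Fin d) C), ← IsScalarTower.algebraMap_apply C (MvPolynomial (Fin d) C)]
  have _ : Algebra.IsIntegral (MvPolynomial (Fin d) C) A := ⟨fun x => by
    have h1 : (MvPolynomial.aeval (R := R) t).toRingHom.IsIntegralElem x := hintegral x
    obtain ⟨P, hP, hP0⟩ := h1
    refine ⟨P.map (MvPolynomial.map (algebraMap R C)), hP.map _, ?_⟩
    rw [eval₂_map, ← hP0]
    congr 1
    exact RingHom.ext fun f => (hBD f).symm⟩
  have hinj : Function.Injective (algebraMap (MvPolynomial (Fin d) C) A) := by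
    rw [injective_iff_map_eq_zero]
    intro f hf
    have h1 : RingHom.ker (algebraMap (MvPolynomial (Fin d) C) A) = ⊥ := by
      let _ : Algebra (MvPolynomial (Fin d) R) (MvPolynomial (Fin d) C) :=
        MvPolynomial.algebraMvPolynomial
      refine Ideal.eq_bot_of_comap_eq_bot (R := MvPolynomial (Fin d) R) ?_
      rw [eq_bot_iff]
      intro f hf
      rw [Ideal.mem_comap, RingHom.mem_ker, MvPolynomial.algebraMap_def, halg, ← hBD] at hf
      exact ht (by rw [hf, map_zero])
    have h2 : f ∈ RingHom.ker (algebraMap (MvPolynomial (Fin d) C) A) := hf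
    rwa [h1] at h2
  have _ : FaithfulSMul (MvPolynomial (Fin d) C) A :=
    (faithfulSMul_iff_algebraMap_injective _ _).2 hinj
  have _ : Algebra.FiniteType (MvPolynomial (Fin d) C) A :=
    Algebra.FiniteType.of_restrictScalars_finiteType k _ A
  have _ : CharZero (MvPolynomial (Fin d) C) :=
    charZero_of_injective_algebraMap (algebraMap k (MvPolynomial (Fin d) C)).injective
  obtain ⟨θ, P, hP, hP0, hmin, s, hs, hsx⟩ :=
    exists_generic_primitive_element (MvPolynomial (Fin d) C) A
  have hMinj : Function.Injective (algebraMap A M) := FaithfulSMul.algebraMap_injective A M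
  have hli : LinearIndependent C fun x : (Fin d →₀ ℕ) × Fin P.natDegree =>
      (∏ i, algebraMap A M (t i) ^ x.1 i) * algebraMap A M θ ^ (x.2 : ℕ) := by
    have h1 := linearIndependent_smul (MvPolynomial.basisMonomials (Fin d) C).linearIndependent
      (linearIndependent_of_no_relation hmin)
    have h2 := h1.map' (IsScalarTower.toAlgHom C A M).toLinearMap (LinearMap.ker_eq_bot.2 hMinj)
    have h3 : (⇑(IsScalarTower.toAlgHom C A M).toLinearMap ∘
        fun p : (Fin d →₀ ℕ) × Fin P.natDegree =>
          (MvPolynomial.basisMonomials (Fin d) C) p.1 • θ ^ (p.2 : ℕ)) =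
        fun x => (∏ i, algebraMap A M (t i) ^ x.1 i) * algebraMap A M θ ^ (x.2 : ℕ) := by
      ext x
      simp [Algebra.smul_def, halg, MvPolynomial.aeval_monomial, Finsupp.prod_fintype]
    rwa [h3] at h2
  have _ : CharZero A := charZero_of_injective_algebraMap (algebraMap k A).injective
  have _ : CharZero M := charZero_of_injective_algebraMap hMinj
  have hirr : Irreducible (P.map (MvPolynomial.map
      ((algebraMap K (algebraicClosure K (AlgebraicClosure M))).comp (algebraMap C K)))) := by
    refine irreducible_map_algebraicClosure (M := M) (Ω := AlgebraicClosure M) hK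
      (algebraicClosure K (AlgebraicClosure M)).val (fun i => algebraMap A M (t i))
      (algebraMap A M θ) hP ?_ ?_ hli
    · have h1 : (MvPolynomial.aeval (R := C) fun i => algebraMap A M (t i)).toRingHom =
          (algebraMap A M).comp (algebraMap (MvPolynomial (Fin d) C) A) := by
        ext x
        · simp [halg, ← IsScalarTower.algebraMap_apply C A M]
        · simp [halg]
      rw [h1, ← hom_eval₂]
      change algebraMap A M (aeval θ P) = 0
      rw [hP0, map_zero]
    · rintro rfl
      simp at hP0
  have _ : IsAlgClosed (algebraicClosure K (AlgebraicClosure M)) :=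
    (algebraicClosure.isAlgClosure K (AlgebraicClosure M)).isAlgClosed
  obtain ⟨g, hg, hgc⟩ := exists_ne_zero_forall_irreducible (K := K)
    (Ω := algebraicClosure K (AlgebraicClosure M)) hP hirr
  obtain ⟨m, hm⟩ := MvPolynomial.ne_zero_iff.1 hs
  refine ⟨g * MvPolynomial.coeff m s, mul_ne_zero hg hm, fun c hc => ?_⟩
  rw [map_mul] at hc
  have hPc : Irreducible (P.map (MvPolynomial.map c.toRingHom)) :=
    hgc k c.toRingHom (left_ne_zero_of_mul hc)
  have hsc : MvPolynomial.map c.toRingHom s ≠ 0 := fun h => right_ne_zero_of_mul hc (by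
    have := congrArg (MvPolynomial.coeff m) h
    rwa [MvPolynomial.coeff_map, MvPolynomial.coeff_zero] at this)
  have hγ : Function.Surjective (MvPolynomial.map (σ := Fin d) c.toRingHom) :=
    MvPolynomial.map_surjective _ fun x => ⟨algebraMap k C x, c.commutes x⟩
  have hex : ∃ ρ : A →ₐ[k] k, ∀ x, ρ (algebraMap C A x) = c x := by
    let σ : MvPolynomial (Fin d) C →ₐ[k] k :=
      { MvPolynomial.eval₂Hom c.toRingHom (fun _ => (0 : k)) with
        commutes' := fun x => by
          simp [IsScalarTower.algebraMap_apply k C (MvPolynomial (Fin d) C)] }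
    have hσ : ∀ x, σ (algebraMap C _ x) = c x := fun x => by simp [σ]
    have h1 : (RingHom.ker σ).IsMaximal :=
      RingHom.ker_isMaximal_of_surjective σ fun x => ⟨algebraMap k _ x, σ.commutes x⟩
    obtain ⟨m, hm, hmσ⟩ := Ideal.exists_ideal_over_maximal_of_isIntegral (S := A) (RingHom.ker σ)
      (((RingHom.injective_iff_ker_eq_bot _).1 hinj).trans_le bot_le)
    obtain ⟨ρ, hρ⟩ := exists_algHom_ker_eq (k := k) m
    have h2 : σ = ρ.comp (IsScalarTower.toAlgHom k (MvPolynomial (Fin d) C) A) := by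
      refine AlgHom.eq_of_ker_le fun x hx => ?_
      have h3 : x ∈ Ideal.comap (algebraMap (MvPolynomial (Fin d) C) A) m := by rw [hmσ]; exact hx
      rw [← hρ] at h3
      exact h3
    refine ⟨ρ, fun x => ?_⟩
    rw [← hσ, h2]
    simp [halg]
  have huniq : ∀ q : Ideal A, q.IsPrime → (∀ f : MvPolynomial (Fin d) C,
      MvPolynomial.aeval t f ∈ q ↔ MvPolynomial.map c.toRingHom f = 0) →
      ∀ (x : A) (n : ℕ) (f : (MvPolynomial (Fin d) C)[X]), s ^ n • x = aeval θ f →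
      (x ∈ q ↔ P.map (MvPolynomial.map c.toRingHom) ∣ f.map (MvPolynomial.map c.toRingHom)) := by
    intro q hq hqf x n f hxf
    rw [← aeval_mem_iff_map_dvd hγ hP hP0 hPc.prime (q := q) hqf, ← hxf, Algebra.smul_def]
    refine ⟨fun h => q.mul_mem_left _ h, fun h => (hq.mem_or_mem h).resolve_left fun h' => hsc ?_⟩
    rw [map_pow] at h'
    exact (hqf s).1 (hq.mem_of_pow_mem _ h')
  refine ⟨hex, ?_⟩
  obtain ⟨ρ₀, hρ₀⟩ := hex
  obtain ⟨q, hq, hqρ, hqf⟩ := exists_prime_mem_iff_map_eq_zero ht hintegral c ρ₀ hρ₀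
  have hqall : ∀ ρ : A →ₐ[k] k, (∀ x, ρ (algebraMap C A x) = c x) → ∀ y ∈ q, ρ y = 0 := by
    intro ρ hρ y hy
    obtain ⟨q', hq', hqρ', hqf'⟩ := exists_prime_mem_iff_map_eq_zero ht hintegral c ρ hρ
    obtain ⟨n, f, hf⟩ := hsx y
    exact hqρ' y ((huniq q' hq' hqf' y n f hf).2 ((huniq q hq hqf y n f hf).1 hy))
  intro f g hfg
  have h1 : f * g ∈ q := mem_of_forall_algHom_eq_zero (k := k) fun ρ hρ => hfg ρ (by
    have h2 : c = ρ.comp (IsScalarTower.toAlgHom k C A) := by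
      refine AlgHom.eq_of_ker_le fun x hx => hρ _ ?_
      have := (hqf (MvPolynomial.C x)).2 (by rw [MvPolynomial.map_C]; exact (congrArg _ hx).trans (map_zero _))
      rwa [MvPolynomial.aeval_C] at this
    intro x
    rw [h2]; rfl)
  exact (hq.mem_or_mem h1).imp (fun h ρ hρ => hqall ρ hρ f h) fun h ρ hρ => hqall ρ hρ g h

end

section

theorem Subalgebra.exists_ne_zero_forall_algHom {k M : Type*} [Field k] [IsAlgClosed k] [CharZero k]
    [Field M] [Algebra k M] {R C A : Subalgebra k M} (hRC : R ≤ C) (hCA : C ≤ A) (hA : A.FG)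
    (hC : ∀ x ∈ C, IsIntegral R x) {d : ℕ} [IsIntegrallyClosed (MvPolynomial (Fin d) R)]
    {t : Fin d → M} (htA : ∀ i, t i ∈ A) (ht : AlgebraicIndependent R t)
    (hintegral : ∀ x ∈ A, (MvPolynomial.aeval (R := R) t).toRingHom.IsIntegralElem x)
    (hrel : ∀ x : M, IsAlgebraic (IntermediateField.adjoin k (C : Set M)) x →
      x ∈ IntermediateField.adjoin k (C : Set M)) :
    ∃ h : C, h ≠ 0 ∧ ∀ c : C →ₐ[k] k, c h ≠ 0 →
      (∃ ρ : A →ₐ[k] k, ρ.comp (Subalgebra.inclusion hCA) = c) ∧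
      ∀ f g : A, (∀ ρ : A →ₐ[k] k, ρ.comp (Subalgebra.inclusion hCA) = c → ρ (f * g) = 0) →
        (∀ ρ : A →ₐ[k] k, ρ.comp (Subalgebra.inclusion hCA) = c → ρ f = 0) ∨
        (∀ ρ : A →ₐ[k] k, ρ.comp (Subalgebra.inclusion hCA) = c → ρ g = 0) := by
  let _ : Algebra R C := (Subalgebra.inclusion hRC).toAlgebra
  let _ : Algebra R A := (Subalgebra.inclusion (hRC.trans hCA)).toAlgebra
  let _ : Algebra C A := (Subalgebra.inclusion hCA).toAlgebra
  have _ : IsScalarTower R C A := IsScalarTower.of_algebraMap_eq fun _ => rfl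
  have _ : IsScalarTower k R C := IsScalarTower.of_algebraMap_eq fun _ => rfl
  have _ : IsScalarTower k C A := IsScalarTower.of_algebraMap_eq fun _ => rfl
  have _ : IsScalarTower C A M := IsScalarTower.of_algebraMap_eq fun _ => rfl
  have _ : Algebra.FiniteType k A := A.fg_iff_finiteType.1 hA
  have _ : Algebra.IsIntegral R C := ⟨fun x => by
    have h1 : IsIntegral R (x : M) := hC x x.2
    obtain ⟨P, hP, hP0⟩ := h1
    refine ⟨P, hP, Subtype.val_injective ?_⟩
    have h2 := Polynomial.hom_eval₂ P (algebraMap R C) C.val.toRingHom x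
    exact h2.trans hP0⟩
  let t' : Fin d → A := fun i => ⟨t i, htA i⟩
  have hval : ∀ f : MvPolynomial (Fin d) R,
      (MvPolynomial.aeval t' f : M) = MvPolynomial.aeval t f := fun f => by
    have h1 : A.val.toRingHom.comp (MvPolynomial.aeval (R := R) t').toRingHom =
        (MvPolynomial.aeval (R := R) t).toRingHom := by
      ext i
      · simp; rfl
      · simp [t']
    exact congrArg (fun φ => φ f) h1
  have hvc : A.val.toRingHom.comp (MvPolynomial.aeval (R := R) t').toRingHom =
        (MvPolynomial.aeval (R := R) t).toRingHom := RingHom.ext hval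
  let K := FractionRing C
  let _ : Algebra K M := FractionRing.liftAlgebra C M
  have _ : IsScalarTower C K M := FractionRing.isScalarTower_liftAlgebra C M
  obtain ⟨h, hh, H⟩ := _root_.exists_ne_zero_forall_algHom (k := k) (R := R) (C := C) (A := A)
    (K := K) (M := M) (t := t') (fun f g hfg => ht (by
      rw [← hval, ← hval, hfg])) (fun x => by
      obtain ⟨P, hP, hP0⟩ := hintegral x x.2
      refine ⟨P, hP, Subtype.val_injective ?_⟩
      have h2 := Polynomial.hom_eval₂ P (MvPolynomial.aeval (R := R) t').toRingHom A.val.toRingHom x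
      rw [hvc] at h2
      exact h2.trans hP0) (fun x hx => by
      have h1 : IsAlgebraic C x := (IsFractionRing.isAlgebraic_iff C K M).2 hx
      have h2 : IsAlgebraic (IntermediateField.adjoin k (C : Set M)) x := by
        obtain ⟨P, hP, hP0⟩ := h1
        let j : C →+* IntermediateField.adjoin k (C : Set M) :=
          { toFun := fun x => ⟨x, IntermediateField.subset_adjoin k _ x.2⟩
            map_one' := rfl
            map_mul' := fun _ _ => rfl
            map_zero' := rfl
            map_add' := fun _ _ => rfl }
        refine ⟨P.map j, (Polynomial.map_ne_zero_iff fun a b hab => ?_).2 hP, ?_⟩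
        · have h3 : (j a : M) = (j b : M) :=
            congrArg (fun y : IntermediateField.adjoin k (C : Set M) => (y : M)) hab
          exact Subtype.ext h3
        · rw [Polynomial.aeval_def, Polynomial.eval₂_map, ← hP0]
          rfl
      obtain ⟨a, ha, b, hb, rfl⟩ := IntermediateField.mem_adjoin_iff_div.1 (hrel x h2)
      rw [Algebra.adjoin_eq] at ha hb
      refine ⟨algebraMap C K ⟨a, ha⟩ / algebraMap C K ⟨b, hb⟩, ?_⟩
      rw [map_div₀, ← IsScalarTower.algebraMap_apply, ← IsScalarTower.algebraMap_apply]
      rfl)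
  refine ⟨h, hh, fun c hc => ?_⟩
  obtain ⟨⟨ρ, hρ⟩, H2⟩ := H c hc
  exact ⟨⟨ρ, AlgHom.ext hρ⟩, fun f g hfg =>
    (H2 f g fun ρ hρ => hfg ρ (AlgHom.ext hρ)).imp
      (fun h ρ hρ => h ρ fun x => DFunLike.congr_fun hρ x)
      (fun h ρ hρ => h ρ fun x => DFunLike.congr_fun hρ x)⟩

end

section

theorem Subalgebra.le_away {k A : Type*} [CommRing k] [CommRing A] [Algebra k A]
    (S : Subalgebra k A) (g : S) : S ≤ S.away g := fun x hx => ⟨0, by simpa using hx⟩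

theorem Subalgebra.away_mono {k A : Type*} [CommRing k] [CommRing A] [Algebra k A]
    {S S' : Subalgebra k A} (h : S ≤ S') (g : S) : S.away g ≤ S'.away (Subalgebra.inclusion h g) :=
  fun _ ⟨n, hn⟩ => ⟨n, h hn⟩

theorem Subalgebra.inv_mem_away {k M : Type*} [CommRing k] [Field M] [Algebra k M]
    (S : Subalgebra k M) {g : S} (hg : g ≠ 0) : (g : M)⁻¹ ∈ S.away g :=
  ⟨1, by
    have h : (g : M) ≠ 0 := fun h => hg (Subtype.ext h)
    rw [pow_one, mul_inv_cancel₀ h]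
    exact S.one_mem⟩

theorem Subalgebra.away_eq_sup {k M : Type*} [CommRing k] [Field M] [Algebra k M]
    (S : Subalgebra k M) {g : S} (hg : g ≠ 0) :
    S.away g = S ⊔ Algebra.adjoin k {(g : M)⁻¹} := by
  refine le_antisymm ?_ (sup_le (S.le_away g)
    (Algebra.adjoin_le (by simpa using S.inv_mem_away hg)))
  rintro x ⟨n, hn⟩
  have h : (g : M) ≠ 0 := fun h => hg (Subtype.ext h)
  have h1 : x = ((g : M)⁻¹) ^ n * ((g : M) ^ n * x) := by
    rw [← mul_assoc, ← mul_pow, inv_mul_cancel₀ h, one_pow, one_mul]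
  rw [h1]
  exact mul_mem (pow_mem ((le_sup_right : _ ≤ S ⊔ Algebra.adjoin k {(g : M)⁻¹})
    (Algebra.subset_adjoin rfl)) n) ((le_sup_left : S ≤ S ⊔ _) hn)

theorem Subalgebra.FG.away {k M : Type*} [CommRing k] [Field M] [Algebra k M]
    {S : Subalgebra k M} (hS : S.FG) {g : S} (hg : g ≠ 0) : (S.away g).FG := by
  rw [S.away_eq_sup hg]
  exact hS.sup ⟨{(g : M)⁻¹}, by simp⟩

theorem Subalgebra.exists_away_algHom {k M : Type*} [Field k] [Field M] [Algebra k M]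
    (S : Subalgebra k M) {g : S} (c : S →ₐ[k] k) (hc : c g ≠ 0) :
    ∃ c' : S.away g →ₐ[k] k, c'.comp (Subalgebra.inclusion (S.le_away g)) = c := by
  have hmul : ∀ (m n : ℕ) (x : M) (hm : (g : M) ^ m * x ∈ S) (hn : (g : M) ^ n * x ∈ S),
      c ⟨_, hm⟩ / c g ^ m = c ⟨_, hn⟩ / c g ^ n := by
    intro m n x hm hn
    rw [div_eq_div_iff (pow_ne_zero _ hc) (pow_ne_zero _ hc), ← map_pow, ← map_pow, ← map_mul,
      ← map_mul]
    congr 1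
    apply Subtype.ext
    simp only [Subalgebra.coe_mul, Subalgebra.coe_pow]
    ring
  choose N hN using fun x : S.away g => x.2
  have key : ∀ (x : S.away g) (n : ℕ) (hn : (g : M) ^ n * x ∈ S),
      c ⟨_, hN x⟩ / c g ^ N x = c ⟨_, hn⟩ / c g ^ n := fun x n hn => hmul _ _ _ _ _
  have key0 : ∀ (x : S.away g) (hx : (x : M) ∈ S), c ⟨_, hN x⟩ / c g ^ N x = c ⟨x, hx⟩ := by
    intro x hx
    rw [key x 0 (by simpa using hx)]
    simp
  refine ⟨{ toFun := fun x => c ⟨_, hN x⟩ / c g ^ N x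
            map_one' := ?_
            map_mul' := ?_
            map_zero' := ?_
            map_add' := ?_
            commutes' := ?_ }, ?_⟩
  · rw [key0 1 S.one_mem]
    exact map_one c
  · intro x y
    have h := S.mul_mem (hN x) (hN y)
    rw [mul_mul_mul_comm, ← pow_add] at h
    rw [key (x * y) _ h, div_mul_div_comm, ← map_mul, ← pow_add]
    congr 2
    apply Subtype.ext
    simp only [Subalgebra.coe_mul]
    ring
  · rw [key0 0 S.zero_mem]
    exact map_zero c
  · intro x y
    have hx : (g : M) ^ (N x + N y) * x ∈ S := by
      have := S.mul_mem (S.pow_mem g.2 (N y)) (hN x)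
      rwa [← mul_assoc, ← pow_add, add_comm] at this
    have hy : (g : M) ^ (N x + N y) * y ∈ S := by
      have := S.mul_mem (S.pow_mem g.2 (N x)) (hN y)
      rwa [← mul_assoc, ← pow_add] at this
    have hxy : (g : M) ^ (N x + N y) * (x + y : S.away g) ∈ S := by
      have := S.add_mem hx hy
      rwa [← mul_add] at this
    rw [key _ _ hx, key _ _ hy, key _ _ hxy, ← add_div, ← map_add]
    congr 2
    apply Subtype.ext
    simp only [Subalgebra.coe_add]
    ring
  · intro r
    rw [key0 _ (S.algebraMap_mem r)]
    exact c.commutes r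
  · ext x
    exact key0 _ x.2

theorem Subalgebra.away_algHom_eq {k M : Type*} [Field k] [Field M] [Algebra k M]
    (S : Subalgebra k M) {g : S} (c : S →ₐ[k] k) (hc : c g ≠ 0) (c' : S.away g →ₐ[k] k)
    (h : c'.comp (Subalgebra.inclusion (S.le_away g)) = c) (x : S.away g) {n : ℕ}
    (hn : (g : M) ^ n * x ∈ S) : c' x = c ⟨_, hn⟩ / c g ^ n := by
  rw [eq_div_iff (pow_ne_zero _ hc), ← h, ← map_pow, mul_comm]
  simp only [AlgHom.comp_apply]
  rw [← map_mul]
  rfl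

theorem Subalgebra.isLocalization_away {k M : Type*} [Field k] [Field M] [Algebra k M]
    (S : Subalgebra k M) {g : S} (hg : g ≠ 0) :
    let _ : Algebra S (S.away g) := (Subalgebra.inclusion (S.le_away g)).toAlgebra
    IsLocalization.Away g (S.away g) := by
  intro _
  have h : (g : M) ≠ 0 := fun h => hg (Subtype.ext h)
  refine ⟨⟨?_, ?_, ?_⟩⟩
  · rintro ⟨_, n, rfl⟩
    rw [map_pow]
    refine IsUnit.pow n (IsUnit.of_mul_eq_one ⟨_, S.inv_mem_away hg⟩ ?_)
    exact Subtype.ext (mul_inv_cancel₀ h)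
  · intro x
    obtain ⟨n, hn⟩ := x.2
    refine ⟨(⟨_, hn⟩, ⟨g ^ n, n, rfl⟩), Subtype.ext ?_⟩
    exact (mul_comm _ _)
  · intro x y hxy
    refine ⟨1, ?_⟩
    have h1 : (x : M) = y := congrArg (fun z : S.away g => (z : M)) hxy
    rw [Subtype.ext h1]

end

section

theorem Subalgebra.isIntegralElem_of_mem_away {k M B : Type*} [Field k] [Field M] [Algebra k M]
    [CommRing B] (φ : B →+* M) (hk : ∀ r : k, algebraMap k M r ∈ φ.range) {s : Set M}
    {S : Subalgebra k M} (hS : S = Algebra.adjoin k s) (hs : ∀ x ∈ s, φ.IsIntegralElem x) {g : S}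
    (hg : g ≠ 0) (hgφ : (g : M)⁻¹ ∈ φ.range) {x : M} (hx : x ∈ S.away g) : φ.IsIntegralElem x := by
  have hr : ∀ y ∈ φ.range, φ.IsIntegralElem y := by
    rintro _ ⟨b, rfl⟩
    exact φ.isIntegralElem_map
  have h1 : ∀ y ∈ S, φ.IsIntegralElem y := by
    intro y hy
    rw [hS] at hy
    induction hy using Algebra.adjoin_induction with
    | mem y hy => exact hs y hy
    | algebraMap r => exact hr _ (hk r)
    | add y z _ _ hy hz => exact hy.add φ hz
    | mul y z _ _ hy hz => exact hy.mul φ hz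
  obtain ⟨n, hn⟩ := hx
  have h : (g : M) ≠ 0 := fun h => hg (Subtype.ext h)
  have h2 : x = ((g : M)⁻¹) ^ n * ((g : M) ^ n * x) := by
    rw [← mul_assoc, ← mul_pow, inv_mul_cancel₀ h, one_pow, one_mul]
  rw [h2]
  exact (hr _ (pow_mem hgφ n)).mul φ (h1 _ hn)

theorem exists_isIntegralElem_aeval_mul {R K M σ : Type*} [CommRing R] [Field K] [Field M]
    [Algebra R K] [IsFractionRing R K] [Algebra K M] [Algebra R M] [IsScalarTower R K M]
    (t : σ → M) {x : M} (hx : (MvPolynomial.aeval (R := K) t).toRingHom.IsIntegralElem x) :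
    ∃ m ∈ nonZeroDivisors R,
      (MvPolynomial.aeval (R := R) t).toRingHom.IsIntegralElem (algebraMap R M m * x) := by
  let _ : Algebra (MvPolynomial σ R) (MvPolynomial σ K) := MvPolynomial.algebraMvPolynomial
  have _ := MvPolynomial.isLocalization (σ := σ) (nonZeroDivisors R) K
  let _ : Algebra (MvPolynomial σ K) M := (MvPolynomial.aeval (R := K) t).toRingHom.toAlgebra
  let _ : Algebra (MvPolynomial σ R) M := (MvPolynomial.aeval (R := R) t).toRingHom.toAlgebra
  have _ : IsScalarTower (MvPolynomial σ R) (MvPolynomial σ K) M := by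
    refine IsScalarTower.of_algebraMap_eq' (R := MvPolynomial σ R) ?_
    change (MvPolynomial.aeval (R := R) t).toRingHom =
      (MvPolynomial.aeval (R := K) t).toRingHom.comp (MvPolynomial.map (algebraMap R K))
    ext i
    · simp [← IsScalarTower.algebraMap_apply]
    · simp
  obtain ⟨⟨_, m, hm, rfl⟩, H⟩ := IsIntegral.exists_multiple_integral_of_isLocalization
    (Submonoid.map (MvPolynomial.C (σ := σ)) (nonZeroDivisors R)) (Rₘ := MvPolynomial σ K) x hx
  refine ⟨m, hm, ?_⟩
  have h1 : (⟨MvPolynomial.C m, m, hm, rfl⟩ :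
      Submonoid.map (MvPolynomial.C (σ := σ)) (nonZeroDivisors R)) • x = algebraMap R M m * x := by
    rw [Submonoid.smul_def, Algebra.smul_def]
    congr 1
    exact MvPolynomial.aeval_C _ _
  rw [← h1]
  exact H

theorem exists_algebraicIndependent_isIntegralElem {K M : Type*} [Field K] [Field M] [Algebra K M]
    (s : Finset M) : ∃ (d : ℕ) (t : Fin d → M), AlgebraicIndependent K t ∧
      (∀ i, t i ∈ Algebra.adjoin K (s : Set M)) ∧
      ∀ x ∈ Algebra.adjoin K (s : Set M),
        (MvPolynomial.aeval (R := K) t).toRingHom.IsIntegralElem x := by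
  have _ : Algebra.FiniteType K (Algebra.adjoin K (s : Set M)) :=
    (Algebra.adjoin K (s : Set M)).fg_iff_finiteType.1 ⟨s, rfl⟩
  obtain ⟨d, φ, hφ, hintegral⟩ := exists_integral_inj_algHom_of_fg K (Algebra.adjoin K (s : Set M))
  have h1 : (Algebra.adjoin K (s : Set M)).val.comp φ =
      MvPolynomial.aeval fun i => (φ (MvPolynomial.X i) : M) := by
    ext i
    simp
  refine ⟨d, fun i => φ (MvPolynomial.X i), fun f g hfg => hφ (Subtype.ext ?_),
    fun i => (φ (MvPolynomial.X i)).2, fun x hx => ?_⟩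
  · rw [← h1] at hfg
    exact hfg
  · obtain ⟨P, hP, hP0⟩ := hintegral ⟨x, hx⟩
    refine ⟨P, hP, ?_⟩
    rw [← h1]
    have h2 := Polynomial.hom_eval₂ P φ.toRingHom
      (Algebra.adjoin K (s : Set M)).val.toRingHom ⟨x, hx⟩
    exact h2.symm.trans ((congrArg _ hP0).trans (map_zero _))

theorem IsLocalization.Away.isIntegrallyClosed_mvPolynomial {R S : Type*} [CommRing R] [IsDomain R]
    [UniqueFactorizationMonoid R] [CommRing S] [Algebra R S] {g : R} (hg : g ≠ 0)
    [IsLocalization.Away g S] (d : ℕ) : IsIntegrallyClosed (MvPolynomial (Fin d) S) := by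
  let _ : Algebra (MvPolynomial (Fin d) R) (MvPolynomial (Fin d) S) :=
    MvPolynomial.algebraMvPolynomial
  have _ := MvPolynomial.isLocalization (σ := Fin d) (Submonoid.powers g) S
  have _ : UniqueFactorizationMonoid (MvPolynomial (Fin d) R) := inferInstance
  have _ : IsIntegrallyClosed (MvPolynomial (Fin d) R) := inferInstance
  refine isIntegrallyClosed_of_isLocalization (R := MvPolynomial (Fin d) R) _
    (Submonoid.map MvPolynomial.C (Submonoid.powers g)) ?_
  refine le_nonZeroDivisors_of_noZeroDivisors ?_
  rintro ⟨_, ⟨n, rfl⟩, h⟩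
  exact pow_ne_zero n hg (MvPolynomial.C_injective (Fin d) R (h.trans (map_zero _).symm))

theorem Subalgebra.isIntegrallyClosed_mvPolynomial_away {k M ε : Type*} [Field k] [Field M]
    [Algebra k M] [Finite ε] {Λ : ε → M} (hΛ : AlgebraicIndependent k Λ)
    {g : Algebra.adjoin k (Set.range Λ)} (hg : g ≠ 0) (d : ℕ) :
    IsIntegrallyClosed (MvPolynomial (Fin d) ((Algebra.adjoin k (Set.range Λ)).away g)) := by
  have _ : UniqueFactorizationMonoid (Algebra.adjoin k (Set.range Λ)) :=
    hΛ.aevalEquiv.toMulEquiv.uniqueFactorizationMonoid inferInstance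
  let _ : Algebra (Algebra.adjoin k (Set.range Λ)) ((Algebra.adjoin k (Set.range Λ)).away g) :=
    (Subalgebra.inclusion ((Algebra.adjoin k (Set.range Λ)).le_away g)).toAlgebra
  have _ : IsLocalization.Away g ((Algebra.adjoin k (Set.range Λ)).away g) :=
    (Algebra.adjoin k (Set.range Λ)).isLocalization_away hg
  exact IsLocalization.Away.isIntegrallyClosed_mvPolynomial hg d

end

section

open IntermediateField.algebraAdjoinAdjoin in
theorem exists_denominator_mem {k M : Type*} [Field k] [Field M] [Algebra k M] {X : Set M}
    {S : Subalgebra k M} (hX : Algebra.adjoin k X ≤ S) {s : Set M} (hs : s ⊆ S) {x : M}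
    (hx : x ∈ Algebra.adjoin (IntermediateField.adjoin k X) s) :
    ∃ r : Algebra.adjoin k X, r ≠ 0 ∧ (r : M) * x ∈ S := by
  induction hx using Algebra.adjoin_induction with
  | mem y hy => exact ⟨1, one_ne_zero, by simpa using hs hy⟩
  | algebraMap r =>
    obtain ⟨a, ha, b, hb, hr⟩ := IntermediateField.mem_adjoin_iff_div.1 r.2
    by_cases hb0 : b = 0
    · refine ⟨1, one_ne_zero, ?_⟩
      have h0 : (r : M) = 0 := by rw [hr, hb0, div_zero]
      have h1 : algebraMap (IntermediateField.adjoin k X) M r = 0 := h0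
      rw [h1, mul_zero]
      exact S.zero_mem
    · refine ⟨⟨b, hb⟩, fun h => hb0 (congrArg Subtype.val h), ?_⟩
      have h1 : b * algebraMap (IntermediateField.adjoin k X) M r = a := by
        change b * (r : M) = a
        rw [hr, mul_div_cancel₀ _ hb0]
      change b * _ ∈ S
      rw [h1]
      exact hX ha
  | add y z _ _ hy hz =>
    obtain ⟨a, ha, hay⟩ := hy
    obtain ⟨b, hb, hbz⟩ := hz
    refine ⟨a * b, mul_ne_zero ha hb, ?_⟩
    have h1 : ((a * b : Algebra.adjoin k X) : M) * (y + z) =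
      (b : M) * (a * y) + (a : M) * (b * z) := by
      rw [Subalgebra.coe_mul]
      ring
    rw [h1]
    exact S.add_mem (S.mul_mem (hX b.2) hay) (S.mul_mem (hX a.2) hbz)
  | mul y z _ _ hy hz =>
    obtain ⟨a, ha, hay⟩ := hy
    obtain ⟨b, hb, hbz⟩ := hz
    refine ⟨a * b, mul_ne_zero ha hb, ?_⟩
    have h1 : ((a * b : Algebra.adjoin k X) : M) * (y * z) = ((a : M) * y) * (b * z) := by
      rw [Subalgebra.coe_mul]
      ring
    rw [h1]
    exact S.mul_mem hay hbz

theorem exists_ne_zero_forall_dvd {ι R : Type*} [CommRing R] [IsDomain R] (s : Finset ι)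
    (P : ι → R → Prop) (h : ∀ i ∈ s, ∃ r, r ≠ 0 ∧ P i r) :
    ∃ g : R, g ≠ 0 ∧ ∀ i ∈ s, ∃ r, r ≠ 0 ∧ r ∣ g ∧ P i r := by
  choose! r hr hP using h
  exact ⟨∏ i ∈ s, r i, Finset.prod_ne_zero_iff.2 hr, fun i hi =>
    ⟨r i, hr i hi, Finset.dvd_prod_of_mem r hi, hP i hi⟩⟩

theorem Subalgebra.inv_mem_away_of_dvd {k M : Type*} [Field k] [Field M] [Algebra k M]
    (S : Subalgebra k M) {g r : S} (hg : g ≠ 0) (h : r ∣ g) : (r : M)⁻¹ ∈ S.away g := by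
  obtain ⟨c, rfl⟩ := h
  have h1 : (r : M) ≠ 0 := fun h => left_ne_zero_of_mul hg (Subtype.ext h)
  refine ⟨1, ?_⟩
  rw [pow_one, Subalgebra.coe_mul, mul_right_comm, mul_inv_cancel₀ h1, one_mul]
  exact c.2

open IntermediateField.algebraAdjoinAdjoin in
theorem exists_mvPolynomial_forall_algHom {k M ε : Type*} [Field k] [IsAlgClosed k] [CharZero k]
    [Field M] [Algebra k M] [Finite ε] {C A : Subalgebra k M} (hCA : C ≤ A) (hCfg : C.FG)
    (hAfg : A.FG) {Λ : ε → M} (hΛC : ∀ e, Λ e ∈ C) (hΛ : AlgebraicIndependent k Λ)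
    (hC : ∀ x ∈ C, IsAlgebraic (IntermediateField.adjoin k (Set.range Λ)) x)
    (hrel : ∀ x : M, IsAlgebraic (IntermediateField.adjoin k (C : Set M)) x →
      x ∈ IntermediateField.adjoin k (C : Set M)) :
    ∃ F : MvPolynomial ε k, F ≠ 0 ∧ ∀ c : C →ₐ[k] k,
      MvPolynomial.eval (fun e => c ⟨Λ e, hΛC e⟩) F ≠ 0 →
      (∃ ρ : A →ₐ[k] k, ρ.comp (Subalgebra.inclusion hCA) = c) ∧
      ∀ f g : A, (∀ ρ : A →ₐ[k] k, ρ.comp (Subalgebra.inclusion hCA) = c → ρ (f * g) = 0) →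
        (∀ ρ : A →ₐ[k] k, ρ.comp (Subalgebra.inclusion hCA) = c → ρ f = 0) ∨
        (∀ ρ : A →ₐ[k] k, ρ.comp (Subalgebra.inclusion hCA) = c → ρ g = 0) := by
  set R := Algebra.adjoin k (Set.range Λ) with hR
  set K := IntermediateField.adjoin k (Set.range Λ) with hK
  have hRC : R ≤ C := Algebra.adjoin_le (by rintro _ ⟨e, rfl⟩; exact hΛC e)
  have halg : ∀ x ∈ C, IsAlgebraic R x := fun x hx =>
    (IsFractionRing.isAlgebraic_iff R K M).2 (hC x hx)
  obtain ⟨sC, hsC⟩ := hCfg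
  obtain ⟨sA, hsA⟩ := hAfg
  obtain ⟨d, t, ht, htA, hintegral⟩ := exists_algebraicIndependent_isIntegralElem (K := K) sA
  obtain ⟨g₁, hg₁, H₁⟩ := exists_ne_zero_forall_dvd (R := R) (Finset.univ : Finset (Fin d))
    (fun i r => (r : M) * t i ∈ A) fun i _ => exists_denominator_mem (hRC.trans hCA)
      (by rw [← hsA]; exact Algebra.subset_adjoin) (htA i)
  obtain ⟨g₂, hg₂, H₂⟩ := exists_ne_zero_forall_dvd (R := R) sA
    (fun x r => (MvPolynomial.aeval (R := R) t).toRingHom.IsIntegralElem ((r : M) * x))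
    fun x hx => by
      obtain ⟨m, hm, h⟩ := exists_isIntegralElem_aeval_mul (R := R) t
        (hintegral x (Algebra.subset_adjoin hx))
      exact ⟨m, nonZeroDivisors.ne_zero hm, h⟩
  obtain ⟨g₃, hg₃, H₃⟩ := exists_ne_zero_forall_dvd (R := R) sC
    (fun x r => IsIntegral R ((r : M) * x)) fun x hx =>
      (halg x (by rw [← hsC]; exact Algebra.subset_adjoin hx)).exists_integral_multiple
  set g : R := g₁ * g₂ * g₃ with hgdef
  have hg : g ≠ 0 := mul_ne_zero (mul_ne_zero hg₁ hg₂) hg₃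
  have hgA : Subalgebra.inclusion (hRC.trans hCA) g ≠ 0 := fun h =>
    hg (Subtype.ext (congrArg (fun y : A => (y : M)) h))
  have hgC : Subalgebra.inclusion hRC g ≠ 0 := fun h =>
    hg (Subtype.ext (congrArg (fun y : C => (y : M)) h))
  let R' := R.away g
  let C' := C.away (Subalgebra.inclusion hRC g)
  let A' := A.away (Subalgebra.inclusion (hRC.trans hCA) g)
  have hRC' : R' ≤ C' := Subalgebra.away_mono hRC g
  have hCA' : C' ≤ A' := Subalgebra.away_mono hCA _
  have hRR' : R ≤ R' := R.le_away g
  have _ : IsIntegrallyClosed (MvPolynomial (Fin d) R') :=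
    Subalgebra.isIntegrallyClosed_mvPolynomial_away hΛ hg d
  have hR'K : ∀ x ∈ R', x ∈ K := by
    rintro x ⟨n, hn⟩
    have h0 : (g : M) ^ n ≠ 0 := pow_ne_zero n fun h => hg (Subtype.ext h)
    have h1 := IntermediateField.algebra_adjoin_le_adjoin k (Set.range Λ) hn
    have h2 := IntermediateField.algebra_adjoin_le_adjoin k (Set.range Λ) (R.pow_mem g.2 n)
    have h3 := K.div_mem h1 h2
    rwa [mul_div_cancel_left₀ _ h0] at h3
  have htA' : ∀ i, t i ∈ A' := fun i => by
    obtain ⟨r, hr, ⟨c, hc⟩, hrA⟩ := H₁ i (Finset.mem_univ i)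
    refine ⟨1, ?_⟩
    have h1 : (g : M) = (c * g₂ * g₃ : R) * r := by
      rw [hgdef, hc, ← Subalgebra.coe_mul]
      congr 1
      ring
    change (g : M) ^ 1 * t i ∈ A
    rw [pow_one, h1, mul_assoc]
    exact A.mul_mem (hCA (hRC (c * g₂ * g₃).2)) hrA
  have hC' : ∀ x ∈ C', IsIntegral R' x := by
    intro x hx
    refine Subalgebra.isIntegralElem_of_mem_away (algebraMap R' M)
      (fun r => ⟨algebraMap k R' r, rfl⟩) hsC.symm (fun y hy => ?_) hgC
      ⟨⟨_, R.inv_mem_away hg⟩, rfl⟩ hx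
    obtain ⟨r, hr, hrg, hry⟩ := H₃ y hy
    have h0 : (r : M) ≠ 0 := fun h => hr (Subtype.ext h)
    have h1 : IsIntegral R' ((r : M) * y) := isIntegral_of_forall_mem hRR' hry
    have h2 : (r : M)⁻¹ ∈ R' := R.inv_mem_away_of_dvd hg (hrg.mul_left _)
    have h3 : IsIntegral R' ((r : M)⁻¹ * ((r : M) * y)) :=
      (isIntegral_algebraMap (R := R') (A := M) (x := ⟨_, h2⟩)).mul h1
    rwa [← mul_assoc, inv_mul_cancel₀ h0, one_mul] at h3
  have hA' : ∀ x ∈ A', (MvPolynomial.aeval (R := R') t).toRingHom.IsIntegralElem x := by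
    have hrange : ∀ y ∈ R', y ∈ (MvPolynomial.aeval (R := R') t).toRingHom.range := fun y hy =>
      ⟨MvPolynomial.C ⟨y, hy⟩, MvPolynomial.aeval_C _ _⟩
    intro x hx
    refine Subalgebra.isIntegralElem_of_mem_away (MvPolynomial.aeval (R := R') t).toRingHom
      (fun r => hrange _ (R'.algebraMap_mem r)) hsA.symm (fun y hy => ?_) hgA
      (hrange _ (R.inv_mem_away hg)) hx
    obtain ⟨r, hr, hrg, P, hP, hP0⟩ := H₂ y hy
    have h0 : (r : M) ≠ 0 := fun h => hr (Subtype.ext h)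
    have h1 : (MvPolynomial.aeval (R := R') t).toRingHom.IsIntegralElem ((r : M) * y) := by
      have h4 : (MvPolynomial.aeval (R := R') t).toRingHom.comp
          (MvPolynomial.map (Subalgebra.inclusion hRR').toRingHom) =
          (MvPolynomial.aeval (R := R) t).toRingHom := by
        ext i
        · simp
        · simp
      refine ⟨P.map (MvPolynomial.map (Subalgebra.inclusion hRR').toRingHom), hP.map _, ?_⟩
      rw [Polynomial.eval₂_map, h4]
      exact hP0
    have h2 : (r : M)⁻¹ ∈ R' := R.inv_mem_away_of_dvd hg ((hrg.mul_left _).mul_right _)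
    have h3 : (MvPolynomial.aeval (R := R') t).toRingHom.IsIntegralElem
        ((r : M)⁻¹ * ((r : M) * y)) := by
      obtain ⟨b, hb⟩ := hrange _ h2
      rw [← hb]
      exact (RingHom.isIntegralElem_map _).mul _ h1
    rwa [← mul_assoc, inv_mul_cancel₀ h0, one_mul] at h3
  have ht' : AlgebraicIndependent R' t := by
    let _ : Algebra R' K := (Subring.inclusion (S := R'.toSubring) (T := K.toSubring) hR'K).toAlgebra
    have _ : IsScalarTower R' K M := IsScalarTower.of_algebraMap_eq fun _ => rfl
    exact ht.restrictScalars fun a b hab =>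
      Subtype.ext (congrArg (fun y : K => (y : M)) hab)
  have hadj : IntermediateField.adjoin k (C' : Set M) = IntermediateField.adjoin k (C : Set M) := by
    refine le_antisymm (IntermediateField.adjoin_le_iff.2 ?_)
      (IntermediateField.adjoin.mono k _ _ (C.le_away _))
    rintro x ⟨n, hn⟩
    have h0 : (g : M) ^ n ≠ 0 := pow_ne_zero n fun h => hg (Subtype.ext h)
    have h1 := IntermediateField.subset_adjoin k (C : Set M) hn
    have h2 := IntermediateField.subset_adjoin k (C : Set M) (C.pow_mem (hRC g.2) n)
    have h3 := IntermediateField.div_mem _ h1 h2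
    rwa [show ((Subalgebra.inclusion hRC g : C) : M) = g from rfl,
      mul_div_cancel_left₀ _ h0] at h3
  obtain ⟨h, hh, H⟩ := Subalgebra.exists_ne_zero_forall_algHom hRC' hCA'
    (Subalgebra.FG.away ⟨sA, hsA⟩ hgA) hC' htA' ht' hA' (fun x hx => by
      rw [hadj] at hx ⊢
      exact hrel x hx)
  obtain ⟨n, hn⟩ := h.2
  have hn0 : (⟨_, hn⟩ : C) ≠ 0 := fun h0 => by
    have h1 : (g : M) ^ n * h = 0 := congrArg (fun y : C => (y : M)) h0
    rcases mul_eq_zero.1 h1 with h2 | h2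
    · exact pow_ne_zero n (fun h => hg (Subtype.ext h)) h2
    · exact hh (Subtype.ext h2)
  let _ : Algebra R C := (Subalgebra.inclusion hRC).toAlgebra
  have _ : IsScalarTower R C M := IsScalarTower.of_algebraMap_eq fun _ => rfl
  have hw : IsAlgebraic R (⟨_, hn⟩ : C) :=
    (isAlgebraic_algebraMap_iff (R := R) (S := C) (A := M) Subtype.val_injective).1 (halg _ hn)
  obtain ⟨r, hr, u, hu⟩ := hw.exists_nonzero_dvd (mem_nonZeroDivisors_of_ne_zero hn0)
  have hpre : ∀ y : R, ∃ P : MvPolynomial ε k, MvPolynomial.aeval Λ P = (y : M) := fun y => by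
    have h1 : (y : M) ∈ (MvPolynomial.aeval (R := k) Λ).range := by
      rw [← Algebra.adjoin_range_eq_range_aeval]
      exact y.2
    exact h1
  obtain ⟨F₁, hF₁⟩ := hpre g
  obtain ⟨F₂, hF₂⟩ := hpre r
  have heval : ∀ (c : C →ₐ[k] k) (P : MvPolynomial ε k) (y : R), MvPolynomial.aeval Λ P = (y : M) →
      MvPolynomial.eval (fun e => c ⟨Λ e, hΛC e⟩) P = c (Subalgebra.inclusion hRC y) := by
    intro c P y hy
    have h1 : C.val.comp (MvPolynomial.aeval fun e => (⟨Λ e, hΛC e⟩ : C)) =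
        MvPolynomial.aeval (R := k) Λ := by
      ext e
      simp
    have h2 : MvPolynomial.aeval (fun e => (⟨Λ e, hΛC e⟩ : C)) P = Subalgebra.inclusion hRC y :=
      Subtype.ext ((DFunLike.congr_fun h1 P).trans hy)
    rw [← h2]
    have h3 : c.comp (MvPolynomial.aeval fun e => (⟨Λ e, hΛC e⟩ : C)) =
        MvPolynomial.aeval (R := k) (fun e => c ⟨Λ e, hΛC e⟩) := by
      ext e
      simp
    have h4 := DFunLike.congr_fun h3 P
    rw [AlgHom.comp_apply] at h4
    rw [h4, MvPolynomial.aeval_eq_eval]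
  refine ⟨F₁ * F₂, mul_ne_zero ?_ ?_, fun c hc => ?_⟩
  · rintro rfl
    exact hg (Subtype.ext (by rw [← hF₁, map_zero]; rfl))
  · rintro rfl
    exact hr (Subtype.ext (by rw [← hF₂, map_zero]; rfl))
  rw [map_mul, heval c F₁ g hF₁, heval c F₂ r hF₂] at hc
  have hcg : c (Subalgebra.inclusion hRC g) ≠ 0 := left_ne_zero_of_mul hc
  have hcr : c (Subalgebra.inclusion hRC r) ≠ 0 := right_ne_zero_of_mul hc
  obtain ⟨c', hc'⟩ := C.exists_away_algHom c hcg
  have hc'h : c' h ≠ 0 := by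
    rw [C.away_algHom_eq c hcg c' hc' h hn]
    refine div_ne_zero (fun h0 => hcr ?_) (pow_ne_zero n hcg)
    have h1 : Subalgebra.inclusion hRC r = ⟨_, hn⟩ * u := hu
    rw [h1, map_mul, h0, zero_mul]
  obtain ⟨⟨ρ', hρ'⟩, H'⟩ := H c' hc'h
  have hres : ∀ ρ : A' →ₐ[k] k, ρ.comp (Subalgebra.inclusion hCA') = c' →
      (ρ.comp (Subalgebra.inclusion (A.le_away _))).comp (Subalgebra.inclusion hCA) = c := by
    intro ρ hρ
    rw [← hc', ← hρ]
    rfl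
  refine ⟨⟨_, hres ρ' hρ'⟩, fun f₁ f₂ hf => ?_⟩
  have hext : ∀ ρ : A →ₐ[k] k, ρ.comp (Subalgebra.inclusion hCA) = c →
      ∃ ρ₁ : A' →ₐ[k] k, ρ₁.comp (Subalgebra.inclusion (A.le_away _)) = ρ ∧
        ρ₁.comp (Subalgebra.inclusion hCA') = c' := by
    intro ρ hρ
    obtain ⟨ρ₁, hρ₁⟩ := A.exists_away_algHom (g := Subalgebra.inclusion (hRC.trans hCA) g) ρ
      (by rw [← hρ] at hcg; exact hcg)
    refine ⟨ρ₁, hρ₁, ?_⟩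
    ext x
    obtain ⟨m, hm⟩ := x.2
    rw [C.away_algHom_eq c hcg c' hc' x hm]
    refine C.away_algHom_eq c hcg (ρ₁.comp (Subalgebra.inclusion hCA')) ?_ x hm
    rw [← hρ, ← hρ₁]
    rfl
  refine (H' (Subalgebra.inclusion (A.le_away _) f₁) (Subalgebra.inclusion (A.le_away _) f₂)
    fun ρ hρ => ?_).imp (fun h0 ρ hρ => ?_) (fun h0 ρ hρ => ?_)
  · rw [← map_mul]
    exact hf _ (hres ρ hρ)
  · obtain ⟨ρ₁, rfl, h2⟩ := hext ρ hρ
    exact h0 ρ₁ h2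
  · obtain ⟨ρ₁, rfl, h2⟩ := hext ρ hρ
    exact h0 ρ₁ h2

end

section

theorem isAlgebraic_of_ncard_le {F L : Type*} [Field F] [Field L] [Algebra F L] {I S : Set L}
    (hI : AlgebraicIndepOn F id I) (hIfin : I.Finite) (hS : S.encard ≤ I.encard)
    (hIS : ∀ x ∈ I, IsAlgebraic (Algebra.adjoin F S) x) {x : L}
    (hx : IsAlgebraic (Algebra.adjoin F S) x) : IsAlgebraic (Algebra.adjoin F I) x := by
  have hcl : ∀ {s : Set L} {x : L}, x ∈ (AlgebraicIndependent.matroid F L).closure s ↔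
      IsAlgebraic (Algebra.adjoin F s) x := fun {s x} => by
    rw [AlgebraicIndependent.matroid_closure_eq]
    exact Iff.rfl
  have hI' : (AlgebraicIndependent.matroid F L).Indep I := AlgebraicIndependent.matroid_indep_iff.2 hI
  have h1 := hI'.isBasis_of_eRk_ge (X := (AlgebraicIndependent.matroid F L).closure S) hIfin
    (fun y hy => hcl.2 (hIS y hy)) (by
      rw [Matroid.eRk_closure_eq, hI'.eRk_eq_encard]
      exact (Matroid.eRk_le_encard _ _).trans hS)
  have h2 := h1.closure_eq_closure
  rw [Matroid.closure_closure] at h2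
  exact hcl.1 (h2 ▸ hcl.2 hx)

open IntermediateField.algebraAdjoinAdjoin in
/-- The invariants of a body are algebraic over the lengths of a tight set of edges. -/
theorem isAlgebraic_of_mem_bodyGen {F L ι : Type*} [Field F] [Field L] [Algebra F L] [CharZero F]
    {p : ι × Fin 2 → L} (hp : AlgebraicIndependent F p) {E : Finset (Sym2 ι)} (hE : EdgeSparse E)
    {V : Finset ι} (hEV : ∀ e ∈ E, e ∈ V.sym2) (hcard : E.card = 2 * V.card - 3) {x : L}
    (hx : x ∈ bodyGen p V) :
    IsAlgebraic (IntermediateField.adjoin F (Set.range fun e : E => sdist p e)) x := by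
  obtain ⟨E', -, -, -, hE', hfan⟩ := exists_fans (fun _ : Unit => V)
  have key : ∀ y ∈ bodyGen p V, IsAlgebraic (Algebra.adjoin F (sdist p '' (E' : Set (Sym2 ι)))) y := by
    intro y hy
    rw [IsFractionRing.isAlgebraic_iff _ (IntermediateField.adjoin F (sdist p '' (E' : Set (Sym2 ι)))) L]
    refine isAlgebraic_of_forall_derivation fun D => ?_
    refine hfan F L p hp (D.restrictScalars F) (fun e he => ?_) () y hy
    exact D.map_algebraMap ⟨sdist p e, IntermediateField.subset_adjoin _ _ ⟨e, he, rfl⟩⟩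
  have hind := hE.algebraicIndependent hp
  rw [← IsFractionRing.isAlgebraic_iff (Algebra.adjoin F (Set.range fun e : E => sdist p e))]
  refine isAlgebraic_of_ncard_le (AlgebraicIndependent.to_subtype_range hind) (Set.finite_range _) ?_ ?_ (key x hx)
  · have h1 : (Set.range fun e : E => sdist p e).encard = E.card := by
      rw [← Set.image_univ, hind.injective.injOn.encard_image]
      simp
    rw [h1]
    refine (Set.encard_image_le _ _).trans ?_
    rw [Set.encard_coe_eq_coe_finsetCard, hcard]
    have h2 : E'.card ≤ 2 * V.card - 3 := by simpa using hE'
    exact_mod_cast h2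
  · rintro _ ⟨⟨e, he⟩, rfl⟩
    refine key _ ?_
    induction e with
    | _ u t =>
      have := hEV _ he
      rw [Finset.mk_mem_sym2_iff] at this
      exact sdist_mem_bodyGen p this.1 this.2

end

section

theorem IsAlgebraic.intermediateField_adjoin_mono {F L : Type*} [Field F] [Field L] [Algebra F L]
    {S T : Set L} (h : S ⊆ T) {x : L} (hx : IsAlgebraic (IntermediateField.adjoin F S) x) :
    IsAlgebraic (IntermediateField.adjoin F T) x := by
  let _ : Algebra (IntermediateField.adjoin F S) (IntermediateField.adjoin F T) :=
    (IntermediateField.inclusion (IntermediateField.adjoin.mono F S T h)).toRingHom.toAlgebra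
  have : IsScalarTower (IntermediateField.adjoin F S) (IntermediateField.adjoin F T) L :=
    IsScalarTower.of_algebraMap_eq fun _ => rfl
  exact hx.tower_top _

theorem isAlgebraic_of_mem_adjoin {F L : Type*} [Field F] [Field L] [Algebra F L]
    (K : IntermediateField F L) {S : Set L} (h : ∀ x ∈ S, IsAlgebraic K x) {x : L}
    (hx : x ∈ Algebra.adjoin F S) : IsAlgebraic K x := by
  induction hx using Algebra.adjoin_induction with
  | mem x hx => exact h x hx
  | algebraMap r => exact isAlgebraic_algebraMap (A := L) (algebraMap F K r)
  | add x y _ _ hx hy => exact hx.add hy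
  | mul x y _ _ hx hy => exact hx.mul hy

theorem bodyGen_image {ι R R' : Type*} [CommRing R] [CommRing R'] (f : R →+* R')
    (p : ι × Fin 2 → R) (V : Finset ι) : f '' bodyGen p V = bodyGen (fun q => f (p q)) V := by
  ext x
  constructor
  · rintro ⟨_, ⟨u, hu, t, ht, u', hu', t', ht', rfl⟩, rfl⟩
    exact ⟨u, hu, t, ht, u', hu', t', ht', by simp⟩
  · rintro ⟨u, hu, t, ht, u', hu', t', ht', rfl⟩
    exact ⟨_, ⟨u, hu, t, ht, u', hu', t', ht', rfl⟩, by simp⟩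

theorem bodyGen_map {ι κ R : Type*} [CommRing R] (f : ι ↪ κ) (p : κ × Fin 2 → R) (V : Finset ι) :
    bodyGen p (V.map f) = bodyGen (fun q => p (f q.1, q.2)) V := by
  ext x
  simp [bodyGen]

theorem bodyGen_finite {ι R : Type*} [CommRing R] (p : ι × Fin 2 → R) (V : Finset ι) :
    (bodyGen p V).Finite := by
  refine ((V ×ˢ V ×ˢ V ×ˢ V).finite_toSet.image fun q =>
    (p (q.1, 0) - p (q.2.1, 0)) * (p (q.2.2.1, 1) - p (q.2.2.2, 1))).subset ?_
  rintro _ ⟨u, hu, t, ht, u', hu', t', ht', rfl⟩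
  exact ⟨(u, t, u', t'), by simp [hu, ht, hu', ht'], rfl⟩

variable {α I : Type*}

/-- The algebra of body invariants. -/
abbrev bodyAlgebra {R : Type*} [CommRing R] [Algebra ℂ R] (p : α × Fin 2 → R)
    (Vi : I → Finset α) : Subalgebra ℂ R :=
  Algebra.adjoin ℂ (⋃ i, bodyGen p (Vi i))

theorem bodyAlgebra_map {R R' : Type*} [CommRing R] [CommRing R'] [Algebra ℂ R] [Algebra ℂ R']
    (f : R →ₐ[ℂ] R') (p : α × Fin 2 → R) (Vi : I → Finset α) :
    (bodyAlgebra p Vi).map f = bodyAlgebra (fun q => f (p q)) Vi := by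
  rw [bodyAlgebra, AlgHom.map_adjoin, Set.image_iUnion]
  congr 2
  ext i : 1
  exact bodyGen_image f.toRingHom p (Vi i)

theorem IsSubgraph.mem_sym2 [_inst : DecidableEq α] {V V' : Finset α} {E E' : Finset (Sym2 α)}
    (h : IsSubgraph V' E' V E) {e : Sym2 α} (he : e ∈ E') : e ∈ V'.sym2 :=
  Finset.mem_sym2_iff.2 (h.1 e he).2

theorem IsMaxTight.isAlgebraic [_inst : DecidableEq α] {F L : Type*} [Field F] [Field L]
    [Algebra F L] [CharZero F] {p : α × Fin 2 → L} (hp : AlgebraicIndependent F p)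
    {V V' : Finset α} {E E' : Finset (Sym2 α)} (h : IsMaxTight V' E' V E) {x : L}
    (hx : x ∈ bodyGen p V') :
    IsAlgebraic (IntermediateField.adjoin F (sdist p '' (E' : Set (Sym2 α)))) x := by
  rw [Set.image_eq_range]
  exact isAlgebraic_of_mem_bodyGen hp h.2.1.1.edgeSparse (fun e he => h.1.mem_sym2 he) h.edge_card hx

theorem IsMaxTightDecomp.isAlgebraic [_inst : DecidableEq α] {L : Type*} [Field L]
    [Algebra ℂ L] {p : α × Fin 2 → L} (hp : AlgebraicIndependent ℂ p)
    {V : Finset α} {E : Finset (Sym2 α)} {Vi : I → Finset α} {Ei : I → Finset (Sym2 α)}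
    (h : IsMaxTightDecomp V E Vi Ei) {x : L} (hx : x ∈ bodyAlgebra p Vi) :
    IsAlgebraic (IntermediateField.adjoin ℂ (Set.range fun e : E => sdist p e)) x := by
  refine isAlgebraic_of_mem_adjoin _ (fun y hy => ?_) hx
  obtain ⟨i, hi⟩ := Set.mem_iUnion.1 hy
  refine ((h.1 i).isAlgebraic hp hi).intermediateField_adjoin_mono ?_
  rintro _ ⟨e, he, rfl⟩
  exact ⟨⟨e, (h.1 i).1.2.2 he⟩, rfl⟩

theorem IsMaxTightDecomp.sdist_mem [_inst : DecidableEq α] {R : Type*} [CommRing R]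
    [Algebra ℂ R] (p : α × Fin 2 → R)
    {V : Finset α} {E : Finset (Sym2 α)} {Vi : I → Finset α} {Ei : I → Finset (Sym2 α)}
    (h : IsMaxTightDecomp V E Vi Ei) {e : Sym2 α} (he : e ∈ E) : sdist p e ∈ bodyAlgebra p Vi := by
  obtain ⟨i, hi⟩ := h.2.2.1 e he
  refine Algebra.subset_adjoin (Set.mem_iUnion.2 ⟨i, ?_⟩)
  have := (h.1 i).1.mem_sym2 hi
  induction e with
  | _ u t =>
    rw [Finset.mk_mem_sym2_iff] at this
    exact sdist_mem_bodyGen p this.1 this.2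

theorem bodyAlgebra_fg [Finite I] {R : Type*} [CommRing R] [Algebra ℂ R] (p : α × Fin 2 → R)
    (Vi : I → Finset α) : (bodyAlgebra p Vi).FG :=
  Subalgebra.fg_def.2 ⟨_, Set.finite_iUnion fun i => bodyGen_finite p (Vi i), rfl⟩

/-- The algebra generated by the coordinates of the vertices in `V`. -/
abbrev vertexAlgebra {R : Type*} [CommRing R] [Algebra ℂ R] (p : α × Fin 2 → R)
    (V : Finset α) : Subalgebra ℂ R :=
  Algebra.adjoin ℂ (p '' {q | q.1 ∈ V})

theorem vertexAlgebra_fg {R : Type*} [CommRing R] [Algebra ℂ R] (p : α × Fin 2 → R)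
    (V : Finset α) : (vertexAlgebra p V).FG := by
  refine Subalgebra.fg_def.2 ⟨_, Set.Finite.image _ ?_, rfl⟩
  refine (V ×ˢ (Finset.univ : Finset (Fin 2))).finite_toSet.subset fun q hq => ?_
  simpa using hq

theorem bodyAlgebra_le {R : Type*} [CommRing R] [Algebra ℂ R] (p : α × Fin 2 → R)
    {V : Finset α} {Vi : I → Finset α} (h : ∀ i, Vi i ⊆ V) :
    bodyAlgebra p Vi ≤ vertexAlgebra p V := by
  refine Algebra.adjoin_le (Set.iUnion_subset fun i => ?_)
  rintro _ ⟨u, hu, t, ht, u', hu', t', ht', rfl⟩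
  have key : ∀ a ∈ Vi i, ∀ k, p (a, k) ∈ vertexAlgebra p V := fun a ha k =>
    Algebra.subset_adjoin ⟨(a, k), h i ha, rfl⟩
  exact mul_mem (sub_mem (key _ hu _) (key _ ht _)) (sub_mem (key _ hu' _) (key _ ht' _))

open MvPolynomial in
theorem adjoin_range_algebraMap_X_eq_top {F σ : Type*} [Field F] :
    IntermediateField.adjoin F (Set.range fun q : σ =>
      algebraMap (MvPolynomial σ F) (FractionRing (MvPolynomial σ F)) (X q)) = ⊤ := by
  refine eq_top_iff.2 fun x _ => ?_
  have key : ∀ a, algebraMap (MvPolynomial σ F) (FractionRing (MvPolynomial σ F)) a ∈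
      IntermediateField.adjoin F (Set.range fun q : σ =>
      algebraMap (MvPolynomial σ F) (FractionRing (MvPolynomial σ F)) (X q)) := by
    intro a
    induction a using MvPolynomial.induction_on with
    | C r => exact IntermediateField.algebraMap_mem _ r
    | add a b ha hb => rw [map_add]; exact add_mem ha hb
    | mul_X a q ha =>
      rw [map_mul]
      exact mul_mem ha (IntermediateField.subset_adjoin _ _ ⟨q, rfl⟩)
  obtain ⟨a, b, -, rfl⟩ := IsFractionRing.div_surjective (A := MvPolynomial σ F) x
  exact div_mem (key a) (key b)

open MvPolynomial in
/-- A generic fibre of the map to the spectrum of the algebra of body invariants is nonempty and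
irreducible. -/
theorem IsMaxTightDecomp.exists_mvPolynomial_forall_aeval [_inst : DecidableEq α] [Fintype I]
    {V : Finset α} {E : Finset (Sym2 α)} {Vi : I → Finset α} {Ei : I → Finset (Sym2 α)}
    (hS : IsSparse V E) (h : IsMaxTightDecomp V E Vi Ei) :
    ∃ F : MvPolynomial E ℂ, F ≠ 0 ∧ ∀ c : bodyAlgebra (X (R := ℂ)) Vi →ₐ[ℂ] ℂ,
      eval (fun e : E => c ⟨sdist X e.1, h.sdist_mem _ e.2⟩) F ≠ 0 →
      (∃ z : α × Fin 2 → ℂ, ∀ x : bodyAlgebra (X (R := ℂ)) Vi, aeval z x.1 = c x) ∧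
      ∀ f ∈ vertexAlgebra (X (R := ℂ)) V, ∀ g ∈ vertexAlgebra (X (R := ℂ)) V,
        (∀ z : α × Fin 2 → ℂ, (∀ x : bodyAlgebra (X (R := ℂ)) Vi, aeval z x.1 = c x) →
          aeval z (f * g) = 0) →
        (∀ z : α × Fin 2 → ℂ, (∀ x : bodyAlgebra (X (R := ℂ)) Vi, aeval z x.1 = c x) →
          aeval z f = 0) ∨
        ∀ z : α × Fin 2 → ℂ, (∀ x : bodyAlgebra (X (R := ℂ)) Vi, aeval z x.1 = c x) →
          aeval z g = 0 := by
  let S := MvPolynomial ((α ⊕ ℕ) × Fin 2) ℂ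
  let M := FractionRing S
  let p : (α ⊕ ℕ) × Fin 2 → M := fun q => algebraMap S M (X q)
  have hp : AlgebraicIndependent ℂ p :=
    (MvPolynomial.algebraicIndependent_X _ _).map' (f := IsScalarTower.toAlgHom ℂ S M)
      (IsFractionRing.injective S M)
  have htop : IntermediateField.adjoin ℂ (Set.range p) = ⊤ := adjoin_range_algebraMap_X_eq_top
  let ι : MvPolynomial (α × Fin 2) ℂ →ₐ[ℂ] M :=
    (IsScalarTower.toAlgHom ℂ S M).comp (rename (Prod.map Sum.inl id))
  have hι : Function.Injective ι := (IsFractionRing.injective S M).comp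
    (rename_injective _ (Sum.inl_injective.prodMap Function.injective_id))
  have hιX : ∀ q, ι (X q) = p (Sum.inl q.1, q.2) := fun q => by
    simp only [ι, p, AlgHom.comp_apply]
    exact congrArg (algebraMap S M) (rename_X _ _)
  have hP : AlgebraicIndependent ℂ fun q => ι (X q) :=
    (MvPolynomial.algebraicIndependent_X _ _).map' hι
  have hsub : ∀ i, Vi i ⊆ V := fun i => (h.1 i).1.2.1
  have hCA : bodyAlgebra (X (R := ℂ)) Vi ≤ vertexAlgebra X V := bodyAlgebra_le _ hsub
  have hΛ : ∀ e, sdist (fun q => ι (X q)) e = ι (sdist X e) := fun e =>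
    (sdist_map ι.toRingHom X e).symm
  have hfield : IntermediateField.adjoin ℂ
      (((bodyAlgebra (X (R := ℂ)) Vi).map ι : Subalgebra ℂ M) : Set M) =
      bodyField ℂ p fun i => (Vi i).map Function.Embedding.inl := by
    rw [bodyAlgebra_map, bodyField]
    simp_rw [bodyGen_map, hιX]
    exact le_antisymm (IntermediateField.adjoin_le_iff.2
      (IntermediateField.algebra_adjoin_le_adjoin _ _))
      (IntermediateField.adjoin.mono _ _ _ Algebra.subset_adjoin)
  obtain ⟨F, hF, hFc⟩ := exists_mvPolynomial_forall_algHom (k := ℂ) (M := M)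
    (Subalgebra.map_mono (f := ι) hCA) ((bodyAlgebra_fg X Vi).map ι)
    ((vertexAlgebra_fg X V).map ι) (Λ := fun e : E => ι (sdist X e.1))
    (fun e => ⟨_, h.sdist_mem _ e.2, rfl⟩)
    (by
      have := hS.edgeSparse.algebraicIndependent hP
      simpa only [hΛ] using this)
    (fun x hx => by
      rw [bodyAlgebra_map] at hx
      have := h.isAlgebraic hP hx
      rwa [funext fun e : E => hΛ e.1] at this)
    (fun x hx => by
      rw [hfield] at hx ⊢
      exact BodySparse.mem_bodyField_of_isAlgebraic hp htop ((h.bodySparse hS).map _) hx)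
  refine ⟨F, hF, fun c hc => ?_⟩
  let C := bodyAlgebra (X (R := ℂ)) Vi
  let A := vertexAlgebra (X (R := ℂ)) V
  let eC : C ≃ₐ[ℂ] C.map ι := C.equivMapOfInjective ι hι
  let eA : A ≃ₐ[ℂ] A.map ι := A.equivMapOfInjective ι hι
  have heC : ∀ x (hx : x ∈ C), eC.symm ⟨ι x, x, hx, rfl⟩ = ⟨x, hx⟩ := fun x hx =>
    (eC.symm_apply_eq).2 rfl
  have heA : ∀ x (hx : x ∈ A), eA.symm ⟨ι x, x, hx, rfl⟩ = ⟨x, hx⟩ := fun x hx =>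
    (eA.symm_apply_eq).2 rfl
  let c' : C.map ι →ₐ[ℂ] ℂ := c.comp eC.symm.toAlgHom
  have hc' : ∀ x (hx : x ∈ C), c' ⟨ι x, x, hx, rfl⟩ = c ⟨x, hx⟩ := fun x hx =>
    congrArg c (heC x hx)
  let ρ : (α × Fin 2 → ℂ) → A.map ι →ₐ[ℂ] ℂ := fun z =>
    ((aeval z).comp A.val).comp eA.symm.toAlgHom
  have hρ : ∀ z x (hx : x ∈ A), ρ z ⟨ι x, x, hx, rfl⟩ = aeval z x := fun z x hx =>
    congrArg (fun y : A => aeval z y.1) (heA x hx)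
  have hρc : ∀ z, (∀ x : C, aeval z x.1 = c x) →
      (ρ z).comp (Subalgebra.inclusion (Subalgebra.map_mono hCA)) = c' := by
    intro z hz
    ext ⟨_, x, hx, rfl⟩
    exact (hρ z x (hCA hx)).trans ((hz ⟨x, hx⟩).trans (hc' x hx).symm)
  have hsurj : ∀ σ : A.map ι →ₐ[ℂ] ℂ, ∃ z : α × Fin 2 → ℂ, ∀ x (hx : x ∈ A),
      σ ⟨ι x, x, hx, rfl⟩ = aeval z x := by
    intro σ
    let σ' : A →ₐ[ℂ] ℂ := σ.comp eA.toAlgHom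
    refine ⟨fun q => if hq : q.1 ∈ V then σ' ⟨X q, Algebra.subset_adjoin ⟨q, hq, rfl⟩⟩ else 0,
      fun x hx => ?_⟩
    change σ' ⟨x, hx⟩ = _
    induction hx using Algebra.adjoin_induction with
    | mem x hx =>
      obtain ⟨q, hq, rfl⟩ := hx
      rw [aeval_X]
      rw [dif_pos (show q.1 ∈ V from hq)]
    | algebraMap r =>
      rw [AlgHom.commutes]
      exact σ'.commutes r
    | add x y hx hy h1 h2 => rw [map_add, ← h1, ← h2, ← map_add]; rfl
    | mul x y hx hy h1 h2 => rw [map_mul, ← h1, ← h2, ← map_mul]; rfl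
  have hσc : ∀ σ : A.map ι →ₐ[ℂ] ℂ, ∀ z : α × Fin 2 → ℂ,
      (∀ x (hx : x ∈ A), σ ⟨ι x, x, hx, rfl⟩ = aeval z x) →
      σ.comp (Subalgebra.inclusion (Subalgebra.map_mono hCA)) = c' →
      ∀ x : C, aeval z x.1 = c x := by
    intro σ z hz hσ x
    rw [← hz x (hCA x.2), ← hc' x x.2, ← hσ]
    rfl
  obtain ⟨⟨σ, hσ⟩, hprime⟩ := hFc c' ((congrArg (fun v => eval v F)
    (funext fun e : E => hc' (sdist X e.1) (h.sdist_mem _ e.2))).trans_ne hc)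
  obtain ⟨z, hz⟩ := hsurj σ
  refine ⟨⟨z, hσc σ z hz hσ⟩, fun f hf g hg hfg => ?_⟩
  refine (hprime ⟨ι f, f, hf, rfl⟩ ⟨ι g, g, hg, rfl⟩ fun σ hσ => ?_).imp ?_ ?_
  · obtain ⟨z, hz⟩ := hsurj σ
    rw [map_mul, hz f hf, hz g hg, ← map_mul]
    exact hfg z (hσc σ z hz hσ)
  · exact fun H z hz => (hρ z f hf).symm.trans (H (ρ z) (hρc z hz))
  · exact fun H z hz => (hρ z g hg).symm.trans (H (ρ z) (hρc z hz))

end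

section

theorem Ideal.ncard_minimalPrimes_iInf {R K : Type*} [CommRing R] [Finite K] (P : K → Ideal R)
    (hP : ∀ k, (P k).IsPrime) (h : ∀ k k', P k ≤ P k' → k = k') :
    (⨅ k, P k).minimalPrimes.ncard = Nat.card K := by
  have hmin : ∀ Q : Ideal R, Q.IsPrime → ⨅ k, P k ≤ Q → ∃ k, P k ≤ Q := by
    intro Q hQ hle
    have := Fintype.ofFinite K
    rw [← Finset.inf_univ_eq_iInf, hQ.inf_le'] at hle
    obtain ⟨k, -, hk⟩ := hle
    exact ⟨k, hk⟩
  have : (⨅ k, P k).minimalPrimes = Set.range P := by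
    ext Q
    constructor
    · rintro ⟨⟨hQ, hle⟩, hQmin⟩
      obtain ⟨k, hk⟩ := hmin Q hQ hle
      exact ⟨k, le_antisymm hk (hQmin ⟨hP k, iInf_le _ _⟩ hk)⟩
    · rintro ⟨k, rfl⟩
      refine ⟨⟨hP k, iInf_le _ _⟩, fun Q ⟨hQ, hle⟩ hQk => ?_⟩
      obtain ⟨k', hk'⟩ := hmin Q hQ hle
      obtain rfl := h _ _ (hk'.trans hQk)
      exact hk'
  rw [this, ← Nat.card_coe_set_eq, Nat.card_range_of_injective fun k k' hk => h k k' hk.le]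

variable {α I : Type*}

/-- Isotropic coordinates of a realization. -/
noncomputable def isoCoords {β : Type*} (r : β → ℂ × ℂ) : β × Fin 2 → ℂ :=
  fun q => if q.2 = 0 then (r q.1).1 + Complex.I * (r q.1).2 else (r q.1).1 - Complex.I * (r q.1).2

theorem sdist_isoCoords (r : α → ℂ × ℂ) (e : Sym2 α) : sdist (isoCoords r) e = edgeVal r e := by
  induction e with
  | _ u t =>
    simp only [sdist_mk, isoCoords, edgeVal, Sym2.lift_mk, sd, if_true, one_ne_zero, if_false]
    linear_combination (-((r u).2 - (r t).2) ^ 2) * Complex.I_sq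

/-- The realization of `V` with given isotropic coordinates. -/
noncomputable def ofIsoCoords (V : Finset α) (z : α × Fin 2 → ℂ) : V → ℂ × ℂ :=
  fun v => ((z (v, 0) + z (v, 1)) / 2, (z (v, 0) - z (v, 1)) / (2 * Complex.I))

theorem isoCoords_extendR_ofIsoCoords [_inst : DecidableEq α] (V : Finset α) (z : α × Fin 2 → ℂ)
    {q : α × Fin 2} (hq : q.1 ∈ V) : isoCoords (extendR V (ofIsoCoords V z)) q = z q := by
  obtain ⟨a, k⟩ := q
  have hI := Complex.I_ne_zero
  simp only [isoCoords, extendR, dif_pos (show a ∈ V from hq), ofIsoCoords]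
  fin_cases k
  · simp; field_simp; ring
  · simp; field_simp; ring

theorem ofIsoCoords_isoCoords_extendR [_inst : DecidableEq α] (V : Finset α) (r : V → ℂ × ℂ) :
    ofIsoCoords V (isoCoords (extendR V r)) = r := by
  have hI := Complex.I_ne_zero
  funext v
  simp only [isoCoords, extendR, ofIsoCoords, v.2, dif_pos, if_true, one_ne_zero, if_false]
  ext
  · simp
  · field_simp; ring

open MvPolynomial in
theorem aeval_congr_of_mem_vertexAlgebra {V : Finset α} {z z' : α × Fin 2 → ℂ}
    (h : ∀ q : α × Fin 2, q.1 ∈ V → z q = z' q) {f : MvPolynomial (α × Fin 2) ℂ}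
    (hf : f ∈ vertexAlgebra (X (R := ℂ)) V) : aeval z f = aeval z' f := by
  induction hf using Algebra.adjoin_induction with
  | mem x hx =>
    obtain ⟨q, hq, rfl⟩ := hx
    rw [aeval_X, aeval_X, h q hq]
  | algebraMap r => rw [AlgHom.commutes, AlgHom.commutes]
  | add x y hx hy h1 h2 => rw [map_add, h1, h2, ← map_add]
  | mul x y hx hy h1 h2 => rw [map_mul, h1, h2, ← map_mul]

open MvPolynomial in
/-- The change from cartesian to isotropic coordinates. -/
noncomputable def toIso (V : Finset α) :
    MvPolynomial (V × Fin 2) ℂ →ₐ[ℂ] MvPolynomial (α × Fin 2) ℂ :=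
  aeval fun q => if q.2 = 0 then C (1 / 2) * (X (q.1.1, 0) + X (q.1.1, 1))
    else C (1 / (2 * Complex.I)) * (X (q.1.1, 0) - X (q.1.1, 1))

open MvPolynomial in
/-- The change from isotropic to cartesian coordinates. -/
noncomputable def ofIso (V : Finset α) :
    MvPolynomial (α × Fin 2) ℂ →ₐ[ℂ] MvPolynomial (V × Fin 2) ℂ :=
  aeval fun q => if h : q.1 ∈ V then
    if q.2 = 0 then X (⟨q.1, h⟩, 0) + C Complex.I * X (⟨q.1, h⟩, 1)
    else X (⟨q.1, h⟩, 0) - C Complex.I * X (⟨q.1, h⟩, 1) else 0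

open MvPolynomial in
theorem toIso_mem (V : Finset α) (f : MvPolynomial (V × Fin 2) ℂ) :
    toIso V f ∈ vertexAlgebra (X (R := ℂ)) V := by
  have key : ∀ (v : V) k, X (v.1, k) ∈ vertexAlgebra (X (R := ℂ)) V := fun v k =>
    Algebra.subset_adjoin ⟨_, v.2, rfl⟩
  induction f using MvPolynomial.induction_on with
  | C r => exact (AlgHom.commutes (toIso V) r) ▸ Subalgebra.algebraMap_mem _ r
  | add f g hf hg => rw [map_add]; exact add_mem hf hg
  | mul_X f q hf =>
    rw [map_mul]
    refine mul_mem hf ?_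
    rw [toIso, aeval_X]
    split_ifs
    · exact mul_mem (Subalgebra.algebraMap_mem _ _) (add_mem (key _ _) (key _ _))
    · exact mul_mem (Subalgebra.algebraMap_mem _ _) (sub_mem (key _ _) (key _ _))

open MvPolynomial in
theorem eval_coords_ofIsoCoords (V : Finset α) (z : α × Fin 2 → ℂ)
    (f : MvPolynomial (V × Fin 2) ℂ) :
    eval (coords (ofIsoCoords V z)) f = aeval z (toIso V f) := by
  rw [← MvPolynomial.coe_aeval_eq_eval]
  change aeval _ f = ((aeval z).comp (toIso V)) f
  congr 1
  ext q
  simp only [aeval_X, AlgHom.comp_apply, toIso, coords, ofIsoCoords]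
  split_ifs
  · simp; ring
  · simp; linear_combination ((z (q.1, 0) - z (q.1, 1)) / 2) * Complex.inv_I

open MvPolynomial in
theorem eval_coords_ofIso [_inst : DecidableEq α] (V : Finset α) (r : V → ℂ × ℂ)
    (f : MvPolynomial (α × Fin 2) ℂ) :
    eval (coords r) (ofIso V f) = aeval (isoCoords (extendR V r)) f := by
  rw [← MvPolynomial.coe_aeval_eq_eval]
  change ((aeval (coords r)).comp (ofIso V)) f = aeval _ f
  congr 1
  ext q
  simp only [aeval_X, AlgHom.comp_apply, ofIso, isoCoords, extendR]
  split_ifs <;> simp [coords]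

theorem mem_vanishingIdeal {β : Type*} {S : Set (β → ℂ × ℂ)} {f : MvPolynomial (β × Fin 2) ℂ} :
    f ∈ vanishingIdeal S ↔ ∀ r ∈ S, MvPolynomial.eval (coords r) f = 0 := Iff.rfl

theorem vanishingIdeal_iUnion {β K : Type*} (S : K → Set (β → ℂ × ℂ)) :
    vanishingIdeal (⋃ k, S k) = ⨅ k, vanishingIdeal (S k) := by
  ext f
  simp only [Ideal.mem_iInf, mem_vanishingIdeal, Set.mem_iUnion]
  exact ⟨fun h k r hr => h r ⟨k, hr⟩, fun h r ⟨k, hr⟩ => h k r hr⟩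

open MvPolynomial in
theorem aeval_isoCoords_sdist (r : α → ℂ × ℂ) (e : Sym2 α) :
    aeval (isoCoords r) (sdist (X (R := ℂ)) e) = edgeVal r e := by
  rw [← sdist_isoCoords]
  have := sdist_map (aeval (isoCoords r)).toRingHom (X (R := ℂ)) e
  simpa using this

open MvPolynomial in
/-- The components of a fibre are its intersections with the fibres of the map to the spectrum of
the algebra of body invariants, if these are irreducible. -/
theorem IsMaxTightDecomp.ncard_minimalPrimes [_inst : DecidableEq α]
    {V : Finset α} {E : Finset (Sym2 α)} {Vi : I → Finset α} {Ei : I → Finset (Sym2 α)}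
    (h : IsMaxTightDecomp V E Vi Ei) (lam : {e // e ∈ E} → ℂ)
    [Finite {c : bodyAlgebra (X (R := ℂ)) Vi →ₐ[ℂ] ℂ //
      ∀ e : E, c ⟨sdist X e.1, h.sdist_mem _ e.2⟩ = lam e}]
    (hc : ∀ c : bodyAlgebra (X (R := ℂ)) Vi →ₐ[ℂ] ℂ,
      (∀ e : E, c ⟨sdist X e.1, h.sdist_mem _ e.2⟩ = lam e) →
      (∃ z : α × Fin 2 → ℂ, ∀ x : bodyAlgebra (X (R := ℂ)) Vi, aeval z x.1 = c x) ∧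
      ∀ f ∈ vertexAlgebra (X (R := ℂ)) V, ∀ g ∈ vertexAlgebra (X (R := ℂ)) V,
        (∀ z : α × Fin 2 → ℂ, (∀ x : bodyAlgebra (X (R := ℂ)) Vi, aeval z x.1 = c x) →
          aeval z (f * g) = 0) →
        (∀ z : α × Fin 2 → ℂ, (∀ x : bodyAlgebra (X (R := ℂ)) Vi, aeval z x.1 = c x) →
          aeval z f = 0) ∨
        ∀ z : α × Fin 2 → ℂ, (∀ x : bodyAlgebra (X (R := ℂ)) Vi, aeval z x.1 = c x) →
          aeval z g = 0) :
    (vanishingIdeal (fiber V E lam)).minimalPrimes.ncard =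
      Nat.card {c : bodyAlgebra (X (R := ℂ)) Vi →ₐ[ℂ] ℂ //
        ∀ e : E, c ⟨sdist X e.1, h.sdist_mem _ e.2⟩ = lam e} := by
  have hCA : bodyAlgebra (X (R := ℂ)) Vi ≤ vertexAlgebra X V :=
    bodyAlgebra_le _ fun i => (h.1 i).1.2.1
  let Z : {c : bodyAlgebra (X (R := ℂ)) Vi →ₐ[ℂ] ℂ //
      ∀ e : E, c ⟨sdist X e.1, h.sdist_mem _ e.2⟩ = lam e} → Set (V → ℂ × ℂ) := fun c =>
    {r | ∀ x : bodyAlgebra (X (R := ℂ)) Vi, aeval (isoCoords (extendR V r)) x.1 = c.1 x}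
  have hZ : ∀ c z, (∀ x : bodyAlgebra (X (R := ℂ)) Vi, aeval z x.1 = c.1 x) →
      ofIsoCoords V z ∈ Z c := by
    intro c z hz x
    rw [← hz x]
    exact aeval_congr_of_mem_vertexAlgebra
      (fun q hq => isoCoords_extendR_ofIsoCoords V z hq) (hCA x.2)
  have hfib : fiber V E lam = ⋃ c, Z c := by
    ext r
    rw [Set.mem_iUnion]
    constructor
    · intro hr
      refine ⟨⟨(aeval (isoCoords (extendR V r))).comp (bodyAlgebra X Vi).val, fun e => ?_⟩,
        fun x => rfl⟩
      rw [← show edgeMap V E r = lam from hr]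
      exact aeval_isoCoords_sdist _ _
    · rintro ⟨c, hr⟩
      funext e
      rw [← c.2 e, ← hr]
      exact (aeval_isoCoords_sdist _ _).symm
  rw [hfib, vanishingIdeal_iUnion]
  refine Ideal.ncard_minimalPrimes_iInf _ (fun c => ?_) fun c c' hcc => ?_
  · obtain ⟨⟨z, hz⟩, hprime⟩ := hc c.1 c.2
    refine ⟨fun h1 => ?_, fun {f g} hfg => ?_⟩
    · have := mem_vanishingIdeal.1 ((Ideal.eq_top_iff_one _).1 h1) _ (hZ c z hz)
      simp at this
    · have key : ∀ f, (∀ z : α × Fin 2 → ℂ, (∀ x : bodyAlgebra (X (R := ℂ)) Vi,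
          aeval z x.1 = c.1 x) → aeval z (toIso V f) = 0) → f ∈ vanishingIdeal (Z c) := by
        intro f hf r hr
        have h1 := hf _ hr
        rwa [← eval_coords_ofIsoCoords, ofIsoCoords_isoCoords_extendR] at h1
      refine (hprime (toIso V f) (toIso_mem V f) (toIso V g) (toIso_mem V g)
        fun z hz => ?_).imp (key f) (key g)
      rw [← map_mul, ← eval_coords_ofIsoCoords]
      exact hfg _ (hZ c z hz)
  · obtain ⟨⟨z, hz⟩, -⟩ := hc c'.1 c'.2
    ext x
    have h1 : ofIso V (x.1 - algebraMap ℂ _ (c.1 x)) ∈ vanishingIdeal (Z c) := by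
      intro r hr
      rw [eval_coords_ofIso, map_sub, hr, AlgHom.commutes]
      exact sub_self _
    have h2 := hcc h1 _ (hZ c' z hz)
    rw [eval_coords_ofIso, map_sub, hZ c' z hz, AlgHom.commutes, sub_eq_zero] at h2
    exact h2.symm

end

section

theorem IsTransf.exists_isoCoords {β : Type*} {t : ℂ × ℂ → ℂ × ℂ} (ht : IsTransf t)
    (r : β → ℂ × ℂ) : ∃ κ u v : ℂ, κ ≠ 0 ∧
      (∀ b, isoCoords (fun v => t (r v)) (b, 0) = κ * isoCoords r (b, 0) + u) ∧
      ∀ b, isoCoords (fun v => t (r v)) (b, 1) = κ⁻¹ * isoCoords r (b, 1) + v := by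
  obtain ⟨c, s, u, v, hcs, ht⟩ := ht
  have hI := Complex.I_sq
  have h1 : (c + Complex.I * s) * (c - Complex.I * s) = 1 := by
    linear_combination hcs - s ^ 2 * hI
  refine ⟨c + Complex.I * s, u + Complex.I * v, u - Complex.I * v, left_ne_zero_of_mul_eq_one h1,
    fun b => ?_, fun b => ?_⟩
  · simp only [isoCoords, ht, if_true]
    linear_combination - s * (r b).2 * hI
  · rw [inv_eq_of_mul_eq_one_right h1]
    simp only [isoCoords, ht, one_ne_zero, if_false]
    linear_combination - s * (r b).2 * hI

theorem exists_isTransf_of_isoCoords {β : Type*} {r s : β → ℂ × ℂ} {κ : ℂ} (hκ : κ ≠ 0) {u v : ℂ}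
    (h0 : ∀ b, isoCoords s (b, 0) = κ * isoCoords r (b, 0) + u)
    (h1 : ∀ b, isoCoords s (b, 1) = κ⁻¹ * isoCoords r (b, 1) + v) :
    ∃ t, IsTransf t ∧ s = fun v => t (r v) := by
  have hI := Complex.I_sq
  have hI' := Complex.I_ne_zero
  refine ⟨fun x => ((κ + κ⁻¹) / 2 * x.1 - (-Complex.I * (κ - κ⁻¹) / 2) * x.2 + (u + v) / 2,
    (-Complex.I * (κ - κ⁻¹) / 2) * x.1 + (κ + κ⁻¹) / 2 * x.2 + (-Complex.I * (u - v) / 2)),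
    ⟨_, _, _, _, ?_, fun x => rfl⟩, ?_⟩
  · have := mul_inv_cancel₀ hκ
    linear_combination (κ - κ⁻¹) ^ 2 / 4 * hI + this
  · funext b
    have h0 := h0 b
    have h1 := h1 b
    simp only [isoCoords, if_true, one_ne_zero, if_false] at h0 h1
    ext
    · linear_combination (h0 + h1) / 2
    · linear_combination -Complex.I * (h0 - h1) / 2 + (s b).2 * hI - (κ + κ⁻¹) / 2 * (r b).2 * hI

/-- Realizations with a nonzero distance are equivalent if and only if their invariants agree. -/
theorem exists_isTransf_iff {β : Type*} {r s : β → ℂ × ℂ}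
    (h : Subsingleton β ∨ ∃ a b, sd (r a) (r b) ≠ 0) :
    (∃ t, IsTransf t ∧ s = fun v => t (r v)) ↔ ∀ u t u' t',
      (isoCoords s (u, 0) - isoCoords s (t, 0)) * (isoCoords s (u', 1) - isoCoords s (t', 1)) =
      (isoCoords r (u, 0) - isoCoords r (t, 0)) * (isoCoords r (u', 1) - isoCoords r (t', 1)) := by
  constructor
  · rintro ⟨t, ht, rfl⟩ u t u' t'
    obtain ⟨κ, x, y, hκ, h0, h1⟩ := ht.exists_isoCoords r
    rw [h0, h0, h1, h1]
    field_simp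
    ring
  · intro H
    obtain h | ⟨a, b, hab⟩ := h
    · cases isEmpty_or_nonempty β with
      | inl h' =>
        exact exists_isTransf_of_isoCoords one_ne_zero (u := 0) (v := 0)
          (fun b => isEmptyElim b) (fun b => isEmptyElim b)
      | inr h' =>
        obtain ⟨a⟩ := h'
        refine exists_isTransf_of_isoCoords one_ne_zero
          (u := isoCoords s (a, 0) - isoCoords r (a, 0))
          (v := isoCoords s (a, 1) - isoCoords r (a, 1)) (fun b => ?_) (fun b => ?_)
        · rw [Subsingleton.elim b a]; ring
        · rw [Subsingleton.elim b a]; ring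
    · have hne : (isoCoords r (a, 0) - isoCoords r (b, 0)) *
          (isoCoords r (a, 1) - isoCoords r (b, 1)) ≠ 0 := by
        convert hab using 1
        exact sdist_isoCoords r s(a, b)
      have hne' := hne
      rw [← H] at hne'
      obtain ⟨hr0, hr1⟩ := mul_ne_zero_iff.1 hne
      obtain ⟨hs0, hs1⟩ := mul_ne_zero_iff.1 hne'
      obtain ⟨κ, hκ⟩ : ∃ κ, κ = (isoCoords s (a, 0) - isoCoords s (b, 0)) /
        (isoCoords r (a, 0) - isoCoords r (b, 0)) := ⟨_, rfl⟩
      have hab' := H a b a b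
      refine exists_isTransf_of_isoCoords (hκ ▸ div_ne_zero hs0 hr0)
        (u := isoCoords s (a, 0) - κ * isoCoords r (a, 0))
        (v := isoCoords s (a, 1) - κ⁻¹ * isoCoords r (a, 1)) (fun d => ?_) (fun d => ?_)
      · have hd := H d a a b
        rw [← sub_eq_zero, hκ]
        field_simp
        apply mul_left_cancel₀ hs1
        linear_combination (isoCoords r (a, 0) - isoCoords r (b, 0)) * hd -
          (isoCoords r (d, 0) - isoCoords r (a, 0)) * hab'
      · have hd := H a b d a
        rw [← sub_eq_zero, hκ]
        apply mul_left_cancel₀ hs0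
        field_simp
        linear_combination hd

end

section

open IntermediateField.algebraAdjoinAdjoin in
theorem eq_zero_of_isAlgebraic_of_map_eq_zero {F S T L ε : Type*} [Field F] [CommRing S] [IsDomain S]
    [Algebra F S] [CommRing T] [Algebra F T] [Field L] [Algebra F L] [Algebra S L]
    [IsScalarTower F S L] [IsFractionRing S L] (ψ : S →ₐ[F] T) {Λ : ε → S}
    (hΛ : AlgebraicIndependent F fun e => ψ (Λ e)) {y : S}
    (hy : IsAlgebraic (IntermediateField.adjoin F (Set.range fun e => algebraMap S L (Λ e)))
      (algebraMap S L y)) (h0 : ψ y = 0) : y = 0 := by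
  by_contra hne
  have hinj : Function.Injective (algebraMap S L) := IsFractionRing.injective S L
  rw [← IsFractionRing.isAlgebraic_iff
    (Algebra.adjoin F (Set.range fun e => algebraMap S L (Λ e)))] at hy
  let B := Algebra.adjoin F (Set.range Λ)
  have hB : B.map (IsScalarTower.toAlgHom F S L) =
      Algebra.adjoin F (Set.range fun e => algebraMap S L (Λ e)) := by
    rw [AlgHom.map_adjoin, ← Set.range_comp]
    rfl
  rw [← hB] at hy
  have hyB : IsAlgebraic B y := hy.of_ringHom_of_comp_eq
    ((IsScalarTower.toAlgHom F S L).subalgebraMap B) (algebraMap S L)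
    (AlgHom.subalgebraMap_surjective _ _) hinj rfl
  obtain ⟨⟨r, hr⟩, hr0, w, hw⟩ := hyB.exists_nonzero_dvd (mem_nonZeroDivisors_of_ne_zero hne)
  obtain ⟨G, rfl⟩ := (Algebra.adjoin_range_eq_range_aeval F Λ ▸ hr :
    r ∈ (MvPolynomial.aeval Λ : MvPolynomial ε F →ₐ[F] S).range)
  have hw' : MvPolynomial.aeval Λ G = y * w := hw
  have h1 : MvPolynomial.aeval (fun e => ψ (Λ e)) G = 0 := by
    have : ψ (MvPolynomial.aeval Λ G) = 0 := by rw [hw', map_mul, h0, zero_mul]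
    rwa [← MvPolynomial.comp_aeval_apply]
  have h2 : G = 0 := hΛ (h1.trans (map_zero _).symm)
  exact hr0 (Subtype.ext (by simp [h2]))

variable {α I : Type*}

theorem IsMaxTight.sdist_mem_bodyGen [_inst : DecidableEq α] {R : Type*} [CommRing R]
    (p : α × Fin 2 → R) {V V' : Finset α} {E E' : Finset (Sym2 α)} (h : IsMaxTight V' E' V E)
    {e : Sym2 α} (he : e ∈ E') : sdist p e ∈ bodyGen p V' := by
  have := h.1.mem_sym2 he
  induction e with
  | _ u t =>
    rw [Finset.mk_mem_sym2_iff] at this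
    exact _root_.sdist_mem_bodyGen p this.1 this.2

theorem mem_bodyAlgebra {R : Type*} [CommRing R] [Algebra ℂ R] (p : α × Fin 2 → R)
    (Vi : I → Finset α) {i : I} {x : R} (hx : x ∈ bodyGen p (Vi i)) : x ∈ bodyAlgebra p Vi :=
  Algebra.subset_adjoin (Set.mem_iUnion.2 ⟨i, hx⟩)

open MvPolynomial in
theorem EdgeSparse.algebraicIndependent_sdist_X {F ι : Type*} [Field F] [CharZero F]
    {E : Finset (Sym2 ι)} (hE : EdgeSparse E) :
    AlgebraicIndependent F fun e : E => sdist (X (R := F)) e.1 := by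
  let f := IsScalarTower.toAlgHom F (MvPolynomial (ι × Fin 2) F)
    (FractionRing (MvPolynomial (ι × Fin 2) F))
  have hf : Function.Injective f := IsFractionRing.injective _ _
  have h := hE.algebraicIndependent ((MvPolynomial.algebraicIndependent_X (ι × Fin 2) F).map' hf)
  have heq : (fun e : E => f (sdist X e.1)) = fun e : E => sdist (f ∘ X) e.1 :=
    funext fun e => sdist_map f.toRingHom X e.1
  rw [← AlgHom.algebraicIndependent_iff f hf]
  rw [← heq] at h
  exact h

open MvPolynomial in
/-- Distinct bodies impose independent conditions on their invariants. -/
theorem IsMaxTightDecomp.eq_zero_of_rename_eq_zero [_inst : DecidableEq α]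
    {V : Finset α} {E : Finset (Sym2 α)} {Vi : I → Finset α} {Ei : I → Finset (Sym2 α)}
    (hS : IsSparse V E) (h : IsMaxTightDecomp V E Vi Ei) {y : MvPolynomial ((I × α) × Fin 2) ℂ}
    (hy : y ∈ Algebra.adjoin ℂ (⋃ i, bodyGen (fun a : α × Fin 2 =>
      (X ((i, a.1), a.2) : MvPolynomial ((I × α) × Fin 2) ℂ)) (Vi i)))
    (h0 : rename (fun a : (I × α) × Fin 2 => (a.1.2, a.2)) y = 0) : y = 0 := by
  let L := FractionRing (MvPolynomial ((I × α) × Fin 2) ℂ)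
  let j := IsScalarTower.toAlgHom ℂ (MvPolynomial ((I × α) × Fin 2) ℂ) L
  have hj : Function.Injective j := IsFractionRing.injective _ _
  have hj' : ∀ x, algebraMap _ L x = j x := fun _ => rfl
  let q : (i : I) → α × Fin 2 → MvPolynomial ((I × α) × Fin 2) ℂ := fun i a => X ((i, a.1), a.2)
  let ψ : MvPolynomial ((I × α) × Fin 2) ℂ →ₐ[ℂ] MvPolynomial (α × Fin 2) ℂ :=
    rename fun a => (a.1.2, a.2)
  refine eq_zero_of_isAlgebraic_of_map_eq_zero (L := L) ψ
    (Λ := fun e : (Σ i, Ei i) => sdist (q e.1) e.2.1) ?_ ?_ h0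
  · have hψ : ∀ e : (Σ i, Ei i), ψ (sdist (q e.1) e.2.1) = sdist X e.2.1 := by
      intro e
      refine (sdist_map ψ.toRingHom (q e.1) e.2.1).trans ?_
      congr 1
      exact funext fun a => rename_X _ _
    have h1 := hS.edgeSparse.algebraicIndependent_sdist_X (F := ℂ)
    have h2 := h1.comp (fun e : (Σ i, Ei i) => (⟨e.2.1, (h.1 e.1).1.2.2 e.2.2⟩ : E)) (by
      rintro ⟨i, e, he⟩ ⟨i', e', he'⟩ hee
      obtain rfl : e = e' := congrArg Subtype.val hee
      obtain rfl : i = i' := by_contra fun hne => h.2.2.2 i i' hne e ⟨he, he'⟩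
      rfl)
    convert h2 using 2 with e
    exact hψ e
  · simp_rw [hj']
    refine isAlgebraic_of_mem_adjoin _ (S := ⋃ i, bodyGen (fun a => j (q i a)) (Vi i))
      (fun x hx => ?_) ?_
    · obtain ⟨i, hi⟩ := Set.mem_iUnion.1 hx
      have hp : AlgebraicIndependent ℂ fun a => j (q i a) := by
        refine ((MvPolynomial.algebraicIndependent_X _ ℂ).comp
          (fun a : α × Fin 2 => ((i, a.1), a.2)) fun a b hab => ?_).map' hj
        simpa [Prod.ext_iff] using hab
      refine ((h.1 i).isAlgebraic hp hi).intermediateField_adjoin_mono ?_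
      rintro _ ⟨e, he, rfl⟩
      exact ⟨⟨i, e, he⟩, sdist_map j.toRingHom (q i) e⟩
    · have h1 : j y ∈ (Algebra.adjoin ℂ (⋃ i, bodyGen (q i) (Vi i))).map j := ⟨y, hy, rfl⟩
      rw [AlgHom.map_adjoin, Set.image_iUnion] at h1
      have h2 : ∀ i, j '' bodyGen (q i) (Vi i) = bodyGen (fun a => j (q i a)) (Vi i) := fun i =>
        bodyGen_image j.toRingHom (q i) (Vi i)
      simpa only [h2] using h1

open MvPolynomial in
/-- Realizations of the bodies can be glued to a point of the spectrum of the algebra of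
body invariants. -/
theorem IsMaxTightDecomp.exists_algHom [_inst : DecidableEq α]
    {V : Finset α} {E : Finset (Sym2 α)} {Vi : I → Finset α} {Ei : I → Finset (Sym2 α)}
    (hS : IsSparse V E) (h : IsMaxTightDecomp V E Vi Ei) (z : I → α × Fin 2 → ℂ) :
    ∃ c : bodyAlgebra (X (R := ℂ)) Vi →ₐ[ℂ] ℂ, ∀ (i : I) x (hx : x ∈ bodyGen X (Vi i)),
      c ⟨x, mem_bodyAlgebra _ _ hx⟩ = aeval (z i) x := by
  let q : (i : I) → α × Fin 2 → MvPolynomial ((I × α) × Fin 2) ℂ := fun i a => X ((i, a.1), a.2)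
  let ψ : MvPolynomial ((I × α) × Fin 2) ℂ →ₐ[ℂ] MvPolynomial (α × Fin 2) ℂ :=
    rename fun a => (a.1.2, a.2)
  let D : Subalgebra ℂ (MvPolynomial ((I × α) × Fin 2) ℂ) :=
    Algebra.adjoin ℂ (⋃ i, bodyGen (q i) (Vi i))
  have hψ : ∀ i, ψ '' bodyGen (q i) (Vi i) = bodyGen X (Vi i) := by
    intro i
    refine (bodyGen_image ψ.toRingHom (q i) (Vi i)).trans ?_
    congr 1
    exact funext fun a => rename_X _ _
  have hDmap : D.map ψ = bodyAlgebra X Vi := by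
    rw [AlgHom.map_adjoin, Set.image_iUnion]
    simp_rw [hψ]
  have hbij : Function.Bijective (ψ.subalgebraMap D) := by
    refine ⟨(injective_iff_map_eq_zero _).2 fun y hy => Subtype.ext ?_,
      AlgHom.subalgebraMap_surjective _ _⟩
    exact h.eq_zero_of_rename_eq_zero hS y.2 (congrArg Subtype.val hy)
  let e : D ≃ₐ[ℂ] D.map ψ := AlgEquiv.ofBijective _ hbij
  let w : (I × α) × Fin 2 → ℂ := fun a => z a.1.1 (a.1.2, a.2)
  let c : D.map ψ →ₐ[ℂ] ℂ := ((aeval w).comp D.val).comp e.symm.toAlgHom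
  refine ⟨c.comp (Subalgebra.inclusion hDmap.ge), fun i x hx => ?_⟩
  obtain ⟨y, hy, rfl⟩ := (hψ i).ge hx
  have hyD : y ∈ D := Algebra.subset_adjoin (Set.mem_iUnion.2 ⟨i, hy⟩)
  have h1 : e.symm ⟨ψ y, y, hyD, rfl⟩ = ⟨y, hyD⟩ := (e.symm_apply_eq).2 rfl
  refine (congrArg (fun v : D => aeval w v.1) h1).trans ?_
  obtain ⟨u, hu, t, ht, u', hu', t', ht', rfl⟩ := hy
  simp [ψ, w, q]

end

section

/-- The invariants of a realization under direct isometries. -/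
noncomputable def bodyInvariants {β : Type*} (r : β → ℂ × ℂ) : β × β × β × β → ℂ := fun q =>
  (isoCoords r (q.1, 0) - isoCoords r (q.2.1, 0)) *
    (isoCoords r (q.2.2.1, 1) - isoCoords r (q.2.2.2, 1))

theorem exists_isTransf_iff_bodyInvariants {β : Type*} {r s : β → ℂ × ℂ}
    (h : Subsingleton β ∨ ∃ a b, sd (r a) (r b) ≠ 0) :
    (∃ t, IsTransf t ∧ s = fun v => t (r v)) ↔ bodyInvariants s = bodyInvariants r := by
  rw [exists_isTransf_iff h]
  exact ⟨fun H => funext fun q => H _ _ _ _, fun H u t u' t' => congrFun H (u, t, u', t')⟩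

theorem ncard_TClasses {β : Type*} {S : Set (β → ℂ × ℂ)}
    (h : ∀ r ∈ S, Subsingleton β ∨ ∃ a b, sd (r a) (r b) ≠ 0) :
    (TClasses S).ncard = (bodyInvariants '' S).ncard := by
  have h1 : TClasses S = (fun v => {s | s ∈ S ∧ bodyInvariants s = v}) '' (bodyInvariants '' S) := by
    rw [Set.image_image]
    ext D
    constructor
    · rintro ⟨r, hr, rfl⟩
      refine ⟨r, hr, Set.ext fun s => and_congr_right fun _ => ?_⟩
      exact (exists_isTransf_iff_bodyInvariants (h r hr)).symm
    · rintro ⟨r, hr, rfl⟩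
      refine ⟨r, hr, Set.ext fun s => and_congr_right fun _ => ?_⟩
      exact (exists_isTransf_iff_bodyInvariants (h r hr)).symm
  rw [h1, Set.InjOn.ncard_image]
  rintro _ ⟨r, hr, rfl⟩ w - hw
  have : r ∈ {s | s ∈ S ∧ bodyInvariants s = w} := hw.le ⟨hr, rfl⟩
  exact this.2

variable {α I : Type*}

theorem isoCoords_ofIsoCoords (V : Finset α) (z : α × Fin 2 → ℂ) (v : V) (k : Fin 2) :
    isoCoords (ofIsoCoords V z) (v, k) = z (v, k) := by
  have := isoCoords_extendR_ofIsoCoords V z (q := (v.1, k)) v.2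
  simpa only [isoCoords, extendR, v.2, dif_pos] using this

theorem isoCoords_extendR [_inst : DecidableEq α] (V : Finset α) (r : V → ℂ × ℂ) (v : V)
    (k : Fin 2) : isoCoords (extendR V r) (v.1, k) = isoCoords r (v, k) := by
  simp only [isoCoords, extendR, v.2, dif_pos]

/-- The generators of the algebra of invariants of a body. -/
noncomputable def bodyGenerator (V : Finset α) (q : V × V × V × V) : MvPolynomial (α × Fin 2) ℂ :=
  (.X (q.1.1, 0) - .X (q.2.1.1, 0)) * (.X (q.2.2.1.1, 1) - .X (q.2.2.2.1, 1))

theorem bodyGenerator_mem (V : Finset α) (q : V × V × V × V) :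
    bodyGenerator V q ∈ bodyGen MvPolynomial.X V :=
  ⟨_, q.1.2, _, q.2.1.2, _, q.2.2.1.2, _, q.2.2.2.2, rfl⟩

theorem exists_bodyGenerator_eq {V : Finset α} {x : MvPolynomial (α × Fin 2) ℂ}
    (hx : x ∈ bodyGen MvPolynomial.X V) : ∃ q, bodyGenerator V q = x := by
  obtain ⟨u, hu, t, ht, u', hu', t', ht', rfl⟩ := hx
  exact ⟨(⟨u, hu⟩, ⟨t, ht⟩, ⟨u', hu'⟩, ⟨t', ht'⟩), rfl⟩

theorem bodyInvariants_ofIsoCoords (V : Finset α) (z : α × Fin 2 → ℂ) (q : V × V × V × V) :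
    bodyInvariants (ofIsoCoords V z) q = MvPolynomial.aeval z (bodyGenerator V q) := by
  simp [bodyInvariants, bodyGenerator, isoCoords_ofIsoCoords]

theorem aeval_bodyGenerator [_inst : DecidableEq α] (V : Finset α) (r : V → ℂ × ℂ)
    (q : V × V × V × V) :
    MvPolynomial.aeval (isoCoords (extendR V r)) (bodyGenerator V q) = bodyInvariants r q := by
  simp [bodyInvariants, bodyGenerator, isoCoords_extendR]

theorem edgeVal_extendR_ofIsoCoords [_inst : DecidableEq α] {V : Finset α} (z : α × Fin 2 → ℂ)
    {e : Sym2 α} (he : e ∈ V.sym2) :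
    edgeVal (extendR V (ofIsoCoords V z)) e =
      MvPolynomial.aeval z (sdist (MvPolynomial.X (R := ℂ)) e) := by
  induction e with
  | _ u t =>
    rw [Finset.mk_mem_sym2_iff] at he
    rw [← aeval_isoCoords_sdist]
    simp [sdist_mk, isoCoords_extendR_ofIsoCoords V z (q := (u, _)) he.1,
      isoCoords_extendR_ofIsoCoords V z (q := (t, _)) he.2]

theorem IsMaxTight.subsingleton_or_exists [_inst : DecidableEq α] {V V' : Finset α}
    {E E' : Finset (Sym2 α)} (h : IsMaxTight V' E' V E) {lam : {e // e ∈ E'} → ℂ}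
    (hlam : ∀ e, lam e ≠ 0) {r : V' → ℂ × ℂ} (hr : r ∈ fiber V' E' lam) :
    Subsingleton V' ∨ ∃ a b, sd (r a) (r b) ≠ 0 := by
  obtain hc | hc := le_or_gt V'.card 1
  · exact .inl ⟨fun a b => Subtype.ext (Finset.card_le_one.1 hc a.1 a.2 b.1 b.2)⟩
  · have h1 := h.edge_card
    obtain ⟨e, he⟩ : E'.Nonempty := Finset.card_pos.1 (by omega)
    have h2 := h.1.mem_sym2 he
    have h3 : edgeVal (extendR V' r) e = lam ⟨e, he⟩ := congrFun hr ⟨e, he⟩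
    have h4 := hlam ⟨e, he⟩
    rw [← h3] at h4
    induction e with
    | _ u t =>
      rw [Finset.mk_mem_sym2_iff] at h2
      refine .inr ⟨⟨u, h2.1⟩, ⟨t, h2.2⟩, ?_⟩
      simpa [edgeVal, extendR, h2.1, h2.2] using h4

open MvPolynomial in
/-- Points of the spectrum of the algebra of body invariants with given edge lengths
correspond to tuples of classes of realizations of the bodies. -/
theorem IsMaxTightDecomp.nonempty_equiv [_inst : DecidableEq α]
    {V : Finset α} {E : Finset (Sym2 α)} {Vi : I → Finset α} {Ei : I → Finset (Sym2 α)}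
    (hS : IsSparse V E) (h : IsMaxTightDecomp V E Vi Ei) (lam : {e // e ∈ E} → ℂ)
    (hc : ∀ c : bodyAlgebra (X (R := ℂ)) Vi →ₐ[ℂ] ℂ,
      (∀ e : E, c ⟨sdist X e.1, h.sdist_mem _ e.2⟩ = lam e) →
      ∃ z : α × Fin 2 → ℂ, ∀ x : bodyAlgebra (X (R := ℂ)) Vi, aeval z x.1 = c x) :
    Nonempty ({c : bodyAlgebra (X (R := ℂ)) Vi →ₐ[ℂ] ℂ //
        ∀ e : E, c ⟨sdist X e.1, h.sdist_mem _ e.2⟩ = lam e} ≃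
      ∀ i, (bodyInvariants '' fiber (Vi i) (Ei i) fun e => lam ⟨e, (h.1 i).1.2.2 e.2⟩ :
        Set (Vi i × Vi i × Vi i × Vi i → ℂ))) := by
  let Θ : {c : bodyAlgebra (X (R := ℂ)) Vi →ₐ[ℂ] ℂ //
        ∀ e : E, c ⟨sdist X e.1, h.sdist_mem _ e.2⟩ = lam e} →
      ∀ i, (bodyInvariants '' fiber (Vi i) (Ei i) fun e => lam ⟨e, (h.1 i).1.2.2 e.2⟩ :
        Set (Vi i × Vi i × Vi i × Vi i → ℂ)) := fun c i =>
    ⟨fun q => c.1 ⟨_, mem_bodyAlgebra _ _ (bodyGenerator_mem (Vi i) q)⟩, by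
      obtain ⟨z, hz⟩ := hc c.1 c.2
      refine ⟨ofIsoCoords (Vi i) z, funext fun e => ?_, funext fun q => ?_⟩
      · rw [← c.2 ⟨e, (h.1 i).1.2.2 e.2⟩, ← hz]
        exact edgeVal_extendR_ofIsoCoords z ((h.1 i).1.mem_sym2 e.2)
      · rw [← hz]
        exact bodyInvariants_ofIsoCoords (Vi i) z q⟩
  refine ⟨Equiv.ofBijective Θ ⟨fun c c' hcc => Subtype.ext ?_, fun w => ?_⟩⟩
  · refine AlgHom.adjoin_ext fun x hx => ?_
    obtain ⟨i, hi⟩ := Set.mem_iUnion.1 hx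
    obtain ⟨q, rfl⟩ := exists_bodyGenerator_eq hi
    exact congrFun (congrArg Subtype.val (congrFun hcc i)) q
  · choose r hr hrw using fun i => (w i).2
    obtain ⟨c, hc'⟩ := h.exists_algHom hS fun i => isoCoords (extendR (Vi i) (r i))
    refine ⟨⟨c, fun e => ?_⟩, funext fun i => Subtype.ext (funext fun q => ?_)⟩
    · obtain ⟨i, hi⟩ := h.2.2.1 e.1 e.2
      refine (hc' i _ ((h.1 i).sdist_mem_bodyGen _ hi)).trans ?_
      rw [aeval_isoCoords_sdist]
      exact congrFun (hr i) ⟨e.1, hi⟩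
    · refine (hc' i _ (bodyGenerator_mem (Vi i) q)).trans ?_
      rw [aeval_bodyGenerator, hrw]

end

/-- For a sparse graph with max-tight decomposition
`{(Vi i, Ei i)}_{i ∈ I}`, if for each `i` the number of realizations of `G_i`
(for general edge lengths, counted modulo the transformation group `T`) equals
`n i ≥ 1`, then for a general edge length assignment `λ` the number of
irreducible components of `E_G⁻¹(λ)` (i.e. the number of minimal primes over
its vanishing ideal) equals `∏ i, n i`. -/
theorem number_of_components_of_general_fiber
    {α I : Type*} [DecidableEq α] [Fintype I]
    (V : Finset α) (E : Finset (Sym2 α))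
    (Vi : I → Finset α) (Ei : I → Finset (Sym2 α))
    (hSparse : IsSparse V E)
    (hDecomp : IsMaxTightDecomp V E Vi Ei)
    (n : I → ℕ) (hn : ∀ i, 1 ≤ n i)
    (Fi : (i : I) → MvPolynomial {e // e ∈ Ei i} ℂ)
    (hFi : ∀ i, Fi i ≠ 0)
    (hcount : ∀ (i : I) (lami : {e // e ∈ Ei i} → ℂ),
      MvPolynomial.eval lami (Fi i) ≠ 0 →
      (TClasses (fiber (Vi i) (Ei i) lami)).ncard = n i) :
    ∃ F : MvPolynomial {e // e ∈ E} ℂ, F ≠ 0 ∧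
      ∀ lam : {e // e ∈ E} → ℂ, MvPolynomial.eval lam F ≠ 0 →
        ((vanishingIdeal (fiber V E lam)).minimalPrimes).ncard = ∏ i, n i := by
  obtain ⟨F, hF, hFc⟩ := hDecomp.exists_mvPolynomial_forall_aeval hSparse
  have hsub : ∀ i, Ei i ⊆ E := fun i => (hDecomp.1 i).1.2.2
  let ι : (i : I) → {e // e ∈ Ei i} → {e // e ∈ E} := fun i e => ⟨e.1, hsub i e.2⟩
  have hι : ∀ i, Function.Injective (ι i) := fun i e e' hee =>
    Subtype.ext (congrArg (fun x : {e // e ∈ E} => x.1) hee)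
  refine ⟨F * ((∏ i, MvPolynomial.rename (ι i) (Fi i)) * ∏ e : {e // e ∈ E}, MvPolynomial.X e),
    mul_ne_zero hF (mul_ne_zero (Finset.prod_ne_zero_iff.2 fun i _ => ?_)
      (Finset.prod_ne_zero_iff.2 fun e _ => MvPolynomial.X_ne_zero e)), fun lam hlam => ?_⟩
  · rw [Ne, map_eq_zero_iff _ (MvPolynomial.rename_injective _ (hι i))]
    exact hFi i
  rw [map_mul, map_mul, map_prod, map_prod] at hlam
  obtain ⟨h1, h23⟩ := mul_ne_zero_iff.1 hlam
  obtain ⟨h2, h3⟩ := mul_ne_zero_iff.1 h23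
  have h3' : ∀ e, lam e ≠ 0 := fun e => by
    simpa using Finset.prod_ne_zero_iff.1 h3 e (Finset.mem_univ e)
  have hcard : ∀ i, (bodyInvariants '' fiber (Vi i) (Ei i) fun e => lam (ι i e)).ncard = n i := by
    intro i
    rw [← ncard_TClasses fun r hr => (hDecomp.1 i).subsingleton_or_exists (fun e => h3' _) hr]
    refine hcount i _ ?_
    have h4 := Finset.prod_ne_zero_iff.1 h2 i (Finset.mem_univ i)
    rwa [MvPolynomial.eval_rename] at h4
  have hcF : ∀ c : bodyAlgebra (MvPolynomial.X (R := ℂ)) Vi →ₐ[ℂ] ℂ,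
      (∀ e : E, c ⟨sdist MvPolynomial.X e.1, hDecomp.sdist_mem _ e.2⟩ = lam e) → _ :=
    fun c hc => hFc c ((congrArg (fun v => MvPolynomial.eval v F) (funext hc)).trans_ne h1)
  obtain ⟨e⟩ := hDecomp.nonempty_equiv hSparse lam fun c hc => (hcF c hc).1
  have hfin : ∀ i, Finite (bodyInvariants '' fiber (Vi i) (Ei i) fun e => lam (ι i e) :
      Set (Vi i × Vi i × Vi i × Vi i → ℂ)) := fun i =>
    Set.finite_of_ncard_pos ((hcard i).symm ▸ hn i)
  have := Finite.of_equiv _ e.symm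
  rw [hDecomp.ncard_minimalPrimes lam hcF, Nat.card_congr e, Nat.card_pi]
  exact Finset.prod_congr rfl fun i _ => (Nat.card_coe_set_eq _).trans (hcard i)
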